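/- (Intermediate identity (13), twisted case, not of type BC_l^{(2)}.) Let R_f have two root lengths with t = I_f(θ,θ)/I_f(θ_s,θ_s) ∈ {2,3}, let R_af = ((R_f)_s + ℤδ) ∪ ((R_f)_l + tℤδ) with simple roots α_0 = δ − θ_s, α_1, …, α_l, set h^∨_t = 1 + I_f(ρ_f, θ_s^∨), c = (I_f(θ_s,θ_s)/2)·h^∨_t, and ρ = ρ_f + c·Λ_0. Then the following identity holds in the algebra ℰ: e^{−(I_f(ρ_f,ρ_f)/(2c))δ} · ∏_{n=1}^∞ ( (1 − e^{−nδ})^{|Π_{f,s}|} (1 − e^{−tnδ})^{|Π_{f,l}|} · ∏_{α ∈ (R_f)_s} (1 − e^{−α − nδ}) · ∏_{α ∈ (R_f)_l} (1 − e^{−α − tnδ}) ) = Σ_{γ ∈ h^∨_t·Q(R_f)} A_γ · e^{−(I_f(ρ_f + γ, ρ_f + γ)/(2c))δ}, where for each γ, A_γ is the unique element of ℰ satisfying A_γ · ( e^{ρ_f} ∏_{α ∈ R_f^+} (1 − e^{−α}) ) = Σ_{u ∈ W(R_f)} det(u) e^{u(ρ_f + γ)}. -/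

import Mathlib

open scoped BigOperators Classical

/-- A reduced irreducible finite root system spanning a real vector space `V`,
equipped with a positive definite symmetric bilinear form `I`. -/
structure RootSys (V : Type) [AddCommGroup V] [Module ℝ V] where
  I : V →ₗ[ℝ] V →ₗ[ℝ] ℝ
  symm : ∀ x y : V, I x y = I y x
  posdef : ∀ x : V, x ≠ 0 → 0 < I x x
  R : Finset V
  zero_notmem : (0 : V) ∉ R
  spanning : Submodule.span ℝ (R : Set V) = ⊤
  reduced : ∀ α ∈ R, ∀ c : ℝ, c • α ∈ R → c = 1 ∨ c = -1
  integral : ∀ α ∈ R, ∀ β ∈ R, ∃ n : ℤ, I ((2 / I α α) • α) β = (n : ℝ)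
  reflect : ∀ α ∈ R, ∀ β ∈ R, β - (I ((2 / I α α) • α) β) • α ∈ R
  irred : ∀ R₁ R₂ : Finset V, R₁ ∪ R₂ = R →
    (∀ α ∈ R₁, ∀ β ∈ R₂, I α β = 0) → R₁ = ∅ ∨ R₂ = ∅

/-- The Weyl group of `R_f`: the subgroup of linear automorphisms generated by the
reflections `s_α(λ) = λ − I(λ,α^∨)α`, `α ∈ R_f`. -/
noncomputable def Weyl {V : Type} [AddCommGroup V] [Module ℝ V] (S : RootSys V) :
    Subgroup (V ≃ₗ[ℝ] V) :=
  Subgroup.closure {u | ∃ α ∈ S.R, ∀ x : V, u x = x - (2 * S.I α x / S.I α α) • α}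

/-- A choice of positive roots and simple roots for a finite root system. -/
structure Base {V : Type} [AddCommGroup V] [Module ℝ V] (S : RootSys V) where
  Pos : Finset V
  Pi : Finset V
  pos_sub : Pos ⊆ S.R
  mem_or_neg : ∀ α ∈ S.R, α ∈ Pos ∨ -α ∈ Pos
  not_both : ∀ α ∈ Pos, -α ∉ Pos
  pi_sub : Pi ⊆ Pos
  indep : LinearIndependent ℝ (fun b : {x // x ∈ Pi} => (b : V))
  decomp : ∀ α ∈ Pos, ∃ c : V → ℕ, α = ∑ b ∈ Pi, (c b : ℝ) • b

/-- The Weyl vector: half the sum of the positive roots. -/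
noncomputable def weylVec {V : Type} [AddCommGroup V] [Module ℝ V] {S : RootSys V}
    (B : Base S) : V := (2 : ℝ)⁻¹ • ∑ α ∈ B.Pos, α

/-- The root lattice `Q(R)`, generated by the roots. -/
noncomputable def rootLat {V : Type} [AddCommGroup V] [Module ℝ V] (S : RootSys V) :
    AddSubgroup V := AddSubgroup.closure (S.R : Set V)

/-- The extended space `F̂ = F_f ⊕ ℝδ ⊕ ℝΛ₀`. -/
abbrev HatV (V : Type) := V × ℝ × ℝ

/-- The null vector `δ`. -/
def deltaH {V : Type} [AddCommGroup V] : HatV V := (0, 1, 0)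

/-- The null vector `Λ₀`. -/
def lamH {V : Type} [AddCommGroup V] : HatV V := (0, 0, 1)

/-- The embedding `F_f → F̂`. -/
def embH {V : Type} [AddCommGroup V] (x : V) : HatV V := (x, 0, 0)

/-- The symmetric bilinear form `Î` on `F̂` extending `I`, with
`Î(δ, F_f) = Î(Λ₀, F_f) = 0`, `Î(δ,δ) = Î(Λ₀,Λ₀) = 0`, `Î(δ,Λ₀) = 1`. -/
noncomputable def hatI {V : Type} [AddCommGroup V] [Module ℝ V]
    (I : V →ₗ[ℝ] V →ₗ[ℝ] ℝ) (p q : HatV V) : ℝ :=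
  I p.1 q.1 + p.2.1 * q.2.2 + p.2.2 * q.2.1

/-- The translation `t_γ(λ) = λ + Î(λ,δ)γ − (Î(λ,γ) + (1/2)Î(γ,γ)Î(λ,δ))δ` for `γ ∈ F_f`. -/
noncomputable def tH {V : Type} [AddCommGroup V] [Module ℝ V]
    (I : V →ₗ[ℝ] V →ₗ[ℝ] ℝ) (γ : V) (p : HatV V) : HatV V :=
  p + (hatI I p deltaH) • embH γ -
    (hatI I p (embH γ) + (1 / 2) * hatI I (embH γ) (embH γ) * hatI I p deltaH) • deltaH

/-- Membership in the algebra `ℰ`: viewing an element of `ℰ` as the function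
`F̂ → ℝ` recording its coefficients, its support must be contained in a finite union
of sets of the form `μ − Σ_{i=0}^l ℤ_{≥0} α_i`, where `α₀` is the affine simple root
and `α_1, …, α_l ∈ Π_f` are the finite simple roots. -/
def memE {V : Type} [AddCommGroup V] [Module ℝ V] {S : RootSys V} (B : Base S)
    (α₀ : HatV V) (f : HatV V → ℝ) : Prop :=
  ∃ (r : ℕ) (μ : Fin r → HatV V), ∀ p : HatV V, f p ≠ 0 →
    ∃ (i : Fin r) (k : ℕ) (m : V → ℕ),
      p = μ i - (k : ℝ) • α₀ - embH (∑ b ∈ B.Pi, (m b : ℝ) • b)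

namespace TwistedMacdonald

section Roots

variable {V : Type} [AddCommGroup V] [Module ℝ V] (S : RootSys V)

/-- The pairing `(x, a^∨)`. -/
noncomputable def pr (a : V) : V →ₗ[ℝ] ℝ := (2 / S.I a a) • S.I a

/-- The reflection in `a`. -/
noncomputable def rf (a : V) : V →ₗ[ℝ] V := LinearMap.id - (pr S a).smulRight a

theorem pr_apply (a x : V) : pr S a x = 2 * S.I a x / S.I a a := by
  simp [pr]; ring

theorem rf_apply (a x : V) : rf S a x = x - pr S a x • a := by
  simp [rf]

variable {S}

theorem ne_zero_of_mem {a : V} (ha : a ∈ S.R) : a ≠ 0 := by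
  rintro rfl; exact S.zero_notmem ha

theorem norm_pos {a : V} (ha : a ∈ S.R) : 0 < S.I a a := S.posdef a (ne_zero_of_mem ha)

theorem two_mul_form {a : V} (ha : a ∈ S.R) (x : V) : 2 * S.I a x = pr S a x * S.I a a := by
  rw [pr_apply]; field_simp [(norm_pos ha).ne']

theorem pr_self {a : V} (ha : a ∈ S.R) : pr S a a = 2 := by
  rw [pr_apply]; field_simp [(norm_pos ha).ne']

theorem pr_int {a b : V} (ha : a ∈ S.R) (hb : b ∈ S.R) : ∃ n : ℤ, pr S a b = n := by
  obtain ⟨n, hn⟩ := S.integral a ha b hb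
  refine ⟨n, ?_⟩
  rw [← hn]; simp [pr]

theorem rf_mem {a b : V} (ha : a ∈ S.R) (hb : b ∈ S.R) : rf S a b ∈ S.R := by
  have := S.reflect a ha b hb
  rw [rf_apply]
  convert this using 2
  simp [pr]

theorem rf_self {a : V} (ha : a ∈ S.R) : rf S a a = -a := by
  rw [rf_apply, pr_self ha]; module

theorem rf_rf {a : V} (ha : a ∈ S.R) (x : V) : rf S a (rf S a x) = x := by
  simp only [rf_apply, map_sub, map_smul, pr_self ha]; module

theorem neg_mem {a : V} (ha : a ∈ S.R) : -a ∈ S.R := by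
  rw [← rf_self ha]; exact rf_mem ha ha

theorem form_rf_rf {a : V} (ha : a ∈ S.R) (x y : V) :
    S.I (rf S a x) (rf S a y) = S.I x y := by
  have h1 := two_mul_form ha x
  have h2 := two_mul_form ha y
  simp only [rf_apply, map_sub, map_smul, LinearMap.sub_apply, LinearMap.smul_apply, smul_eq_mul]
  rw [S.symm x a]
  linear_combination (-pr S a y / 2) * h1 - pr S a x / 2 * h2

theorem form_rf {a : V} (ha : a ∈ S.R) (x y : V) :
    S.I (rf S a x) y = S.I x (rf S a y) := by
  conv_lhs => rw [← rf_rf ha y]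
  rw [form_rf_rf ha]

theorem form_neg_neg (x : V) : S.I (-x) (-x) = S.I x x := by simp

theorem pr_neg_left (a x : V) : pr S (-a) x = - pr S a x := by
  simp [pr_apply]; ring

theorem pr_rf_rf {a : V} (ha : a ∈ S.R) (b x : V) :
    pr S (rf S a b) (rf S a x) = pr S b x := by
  simp only [pr_apply, form_rf_rf ha]

theorem pr_abs_lt_two {a x : V} (ha : a ∈ S.R) (hx : S.I x x ≤ S.I a a) (h1 : x ≠ a)
    (h2 : x ≠ -a) : |pr S a x| < 2 := by
  have p := norm_pos ha
  have e1 := S.posdef (x - a) (sub_ne_zero.mpr h1)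
  have e2 := S.posdef (x + a) (fun h => h2 (eq_neg_of_add_eq_zero_left h))
  simp only [map_sub, map_add, LinearMap.sub_apply, LinearMap.add_apply, S.symm x a] at e1 e2
  have h := two_mul_form ha x
  rw [abs_lt]
  constructor
  · by_contra hh
    nlinarith
  · by_contra hh
    nlinarith

/-- Weak irreducibility: a colouring of the roots that is constant on non-orthogonal pairs. -/
theorem irred_pred (p : V → Prop) (hp : ∀ a ∈ S.R, ∀ b ∈ S.R, p a → ¬ p b → S.I a b = 0)
    {a : V} (ha : a ∈ S.R) (hpa : p a) {b : V} (hb : b ∈ S.R) : p b := by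
  rcases S.irred (S.R.filter p) (S.R.filter fun x => ¬ p x) (Finset.filter_union_filter_not_eq _ _)
    (by
      intro x hx y hy
      rw [Finset.mem_filter] at hx hy
      exact hp x hx.1 y hy.1 hx.2 hy.2) with h | h
  · exact absurd hpa (Finset.filter_eq_empty_iff.mp h ha)
  · exact not_not.mp (Finset.filter_eq_empty_iff.mp h hb)

theorem eq_zero_of_orthogonal {x : V} (h : ∀ a ∈ S.R, S.I x a = 0) : x = 0 := by
  have : ∀ y : V, S.I x y = 0 := by
    intro y
    have hy : y ∈ Submodule.span ℝ (S.R : Set V) := by rw [S.spanning]; trivial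
    induction hy using Submodule.span_induction with
    | mem y hy => exact h y hy
    | zero => simp
    | add y z _ _ hy hz => simp [hy, hz]
    | smul c y _ hy => simp [hy]
  by_contra hx
  exact (S.posdef x hx).ne' (this x)

/-! Positive roots -/

variable (B : Base S)

theorem span_Pi : Submodule.span ℝ (Set.range fun b : {x // x ∈ B.Pi} => (b : V)) = ⊤ := by
  rw [eq_top_iff, ← S.spanning, Submodule.span_le]
  have hpos : ∀ a ∈ B.Pos, a ∈ Submodule.span ℝ (Set.range fun b : {x // x ∈ B.Pi} => (b : V)) := by
    intro a ha
    obtain ⟨c, hc⟩ := B.decomp a ha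
    rw [hc]
    exact Submodule.sum_mem _ fun b hb =>
      Submodule.smul_mem _ _ (Submodule.subset_span ⟨⟨b, hb⟩, rfl⟩)
  intro a ha
  rcases B.mem_or_neg a ha with h | h
  · exact hpos a h
  · simpa using Submodule.neg_mem _ (hpos _ h)

/-- The basis of simple roots. -/
noncomputable def simpleBasis : Module.Basis {x // x ∈ B.Pi} ℝ V :=
  Module.Basis.mk B.indep (span_Pi B).ge

theorem simpleBasis_apply (b : {x // x ∈ B.Pi}) : simpleBasis B b = b := by
  simp [simpleBasis]

/-- The coordinate of a vector on a simple root. -/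
noncomputable def crd (b : {x // x ∈ B.Pi}) : V →ₗ[ℝ] ℝ := (simpleBasis B).coord b

theorem crd_simple (b b' : {x // x ∈ B.Pi}) : crd B b (b' : V) = if b' = b then 1 else 0 := by
  have h : crd B b (simpleBasis B b') = if b' = b then 1 else 0 := by
    simp [crd, Finsupp.single_apply]
  rwa [simpleBasis_apply] at h

theorem crd_simple_of_mem {b : V} (hb : b ∈ B.Pi) (j : {x // x ∈ B.Pi}) :
    crd B j b = if b = j then 1 else 0 := by
  have := crd_simple B j ⟨b, hb⟩
  simpa [Subtype.ext_iff] using this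

theorem crd_sum (c : V → ℝ) (b : {x // x ∈ B.Pi}) : crd B b (∑ b ∈ B.Pi, c b • b) = c b := by
  rw [← Finset.sum_coe_sort B.Pi fun b => c b • b]
  simp [crd_simple]

theorem sum_crd (x : V) : x = ∑ b : {x // x ∈ B.Pi}, crd B b x • (b : V) := by
  conv_lhs => rw [← (simpleBasis B).sum_repr x]
  simp [simpleBasis_apply, crd]

theorem eq_of_crd {x y : V} (h : ∀ b, crd B b x = crd B b y) : x = y := by
  rw [sum_crd B x, sum_crd B y]; simp [h]

theorem Pi_sub {b : V} (hb : b ∈ B.Pi) : b ∈ S.R := B.pos_sub (B.pi_sub hb)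

variable {B}

theorem crd_nat_of_pos {a : V} (ha : a ∈ B.Pos) (b : {x // x ∈ B.Pi}) :
    ∃ n : ℕ, crd B b a = n := by
  obtain ⟨c, hc⟩ := B.decomp a ha
  exact ⟨c b, by rw [hc, crd_sum B fun b => (c b : ℝ)]⟩

theorem crd_nonneg {a : V} (ha : a ∈ B.Pos) (b : {x // x ∈ B.Pi}) : 0 ≤ crd B b a := by
  obtain ⟨n, hn⟩ := crd_nat_of_pos ha b
  rw [hn]; positivity

theorem pos_or_neg {a : V} (ha : a ∈ S.R) (h : a ∉ B.Pos) : -a ∈ B.Pos :=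
  (B.mem_or_neg a ha).resolve_left h

theorem pos_of_crd_pos {a : V} (ha : a ∈ S.R) {b : {x // x ∈ B.Pi}} (h : 0 < crd B b a) :
    a ∈ B.Pos := by
  by_contra h'
  have := crd_nonneg (pos_or_neg ha h') b
  simp at this; linarith

theorem rf_simple_pos {a b : V} (ha : a ∈ B.Pos) (hb : b ∈ B.Pi) (hab : a ≠ b) :
    rf S b a ∈ B.Pos := by
  obtain ⟨j, hj, hj'⟩ : ∃ j : {x // x ∈ B.Pi}, (j : V) ≠ b ∧ 0 < crd B j a := by
    by_contra hcon
    push Not at hcon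
    have e : a = crd B ⟨b, hb⟩ a • b := by
      apply eq_of_crd B
      intro j
      rw [map_smul, smul_eq_mul, crd_simple_of_mem B hb]
      split_ifs with h
      · subst h; simp
      · simpa using le_antisymm (hcon j (Ne.symm h)) (crd_nonneg ha j)
    have e' := B.pos_sub ha
    rw [e] at e'
    rcases S.reduced b (Pi_sub B hb) _ e' with h | h
    · rw [h, one_smul] at e; exact hab e
    · have := crd_nonneg ha ⟨b, hb⟩
      linarith
  refine pos_of_crd_pos (rf_mem (Pi_sub B hb) (B.pos_sub ha)) (b := j) ?_
  rw [rf_apply, map_sub, map_smul, crd_simple_of_mem B hb, if_neg (Ne.symm hj)]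
  simpa using hj'

theorem neg_notMem_pos {a : V} (ha : a ∈ B.Pos) : -a ∉ B.Pos := B.not_both a ha

theorem pr_weylVec {b : V} (hb : b ∈ B.Pi) : pr S b (weylVec B) = 1 := by
  have hbR := Pi_sub B hb
  have hsum : ∑ a ∈ B.Pos.erase b, rf S b a = ∑ a ∈ B.Pos.erase b, a := by
    have hm : ∀ a ∈ B.Pos.erase b, rf S b a ∈ B.Pos.erase b := by
      intro a ha
      rw [Finset.mem_erase] at ha ⊢
      refine ⟨fun h => ?_, rf_simple_pos ha.2 hb ha.1⟩
      have : a = -b := by rw [← rf_rf hbR a, h, rf_self hbR]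
      exact B.not_both b (B.pi_sub hb) (this ▸ ha.2)
    exact Finset.sum_bij' (fun a _ => rf S b a) (fun a _ => rf S b a) hm hm
      (fun a _ => rf_rf hbR a) (fun a _ => rf_rf hbR a) (fun a _ => rfl)
  have h1 : rf S b (weylVec B) = weylVec B - b := by
    rw [weylVec, ← Finset.add_sum_erase _ _ (B.pi_sub hb), map_smul, map_add, map_sum, hsum,
      rf_self hbR]
    module
  rw [rf_apply] at h1
  have h2 := congrArg (S.I b) (sub_right_injective h1)
  rw [map_smul, smul_eq_mul] at h2
  have := norm_pos hbR
  exact mul_right_cancel₀ this.ne' (by linarith)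

theorem form_weylVec_simple {b : V} (hb : b ∈ B.Pi) : 0 < S.I (weylVec B) b := by
  have h := two_mul_form (Pi_sub B hb) (weylVec B)
  rw [pr_weylVec hb] at h
  have := norm_pos (Pi_sub B hb)
  rw [S.symm]; linarith

theorem form_nonneg_of_crd {x y : V} (hx : ∀ b ∈ B.Pi, 0 ≤ S.I x b) (hy : ∀ b, 0 ≤ crd B b y) :
    0 ≤ S.I x y := by
  rw [sum_crd B y, map_sum]
  refine Finset.sum_nonneg fun b _ => ?_
  rw [map_smul, smul_eq_mul]
  exact mul_nonneg (hy b) (hx b b.2)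

theorem form_pos_of_crd {x y : V} (hx : ∀ b ∈ B.Pi, 0 < S.I x b) (hy : ∀ b, 0 ≤ crd B b y)
    (hy0 : y ≠ 0) : 0 < S.I x y := by
  obtain ⟨b, hb⟩ : ∃ b, crd B b y ≠ 0 := by
    by_contra h
    push Not at h
    exact hy0 (eq_of_crd B fun b => by simp [h b])
  rw [sum_crd B y, map_sum]
  refine Finset.sum_pos' (fun b _ => ?_) ⟨b, Finset.mem_univ _, ?_⟩
  · rw [map_smul, smul_eq_mul]
    exact mul_nonneg (hy b) (hx b b.2).le
  · rw [map_smul, smul_eq_mul]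
    exact mul_pos (lt_of_le_of_ne (hy b) (Ne.symm hb)) (hx b b.2)

theorem form_weylVec_pos {a : V} (ha : a ∈ B.Pos) : 0 < S.I (weylVec B) a :=
  form_pos_of_crd (fun _ => form_weylVec_simple) (crd_nonneg ha) (ne_zero_of_mem (B.pos_sub ha))

theorem exists_simple_form_pos {a : V} (ha : a ∈ B.Pos) : ∃ b ∈ B.Pi, 0 < S.I a b := by
  by_contra h
  push Not at h
  have h1 : 0 ≤ S.I (-a) a := form_nonneg_of_crd
    (fun b hb => by simpa using h b hb) (crd_nonneg ha)
  have := norm_pos (B.pos_sub ha)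
  simp at h1; linarith

theorem sum_R (f : V → ℝ) : ∑ a ∈ S.R, f a = ∑ a ∈ B.Pos, (f a + f (-a)) := by
  rw [Finset.sum_add_distrib]
  have e : S.R = B.Pos ∪ B.Pos.image (fun a => -a) := by
    ext a
    simp only [Finset.mem_union, Finset.mem_image]
    constructor
    · intro ha
      by_cases h : a ∈ B.Pos
      · exact Or.inl h
      · exact Or.inr ⟨-a, pos_or_neg ha h, neg_neg a⟩
    · rintro (h | ⟨x, hx, rfl⟩)
      · exact B.pos_sub h
      · exact neg_mem (B.pos_sub hx)
  rw [e, Finset.sum_union, Finset.sum_image]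
  · intro x _ y _ h; simpa using h
  · rw [Finset.disjoint_left]
    intro a ha h
    obtain ⟨x, hx, rfl⟩ := Finset.mem_image.mp h
    exact B.not_both x hx ha

/-- The height, i.e. the sum of the coordinates on the simple roots. -/
noncomputable def hgt (B : Base S) : V →ₗ[ℝ] ℝ := ∑ b, crd B b

theorem hgt_apply (x : V) : hgt B x = ∑ b, crd B b x := by simp [hgt]

theorem hgt_simple {b : V} (hb : b ∈ B.Pi) : hgt B b = 1 := by
  rw [hgt_apply, Finset.sum_eq_single ⟨b, hb⟩]
  · rw [crd_simple_of_mem B hb, if_pos rfl]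
  · intro j _ hj
    rw [crd_simple_of_mem B hb, if_neg fun h => hj (Subtype.ext h.symm)]
  · simp

theorem one_le_hgt {a : V} (ha : a ∈ B.Pos) : 1 ≤ hgt B a := by
  obtain ⟨b, hb⟩ : ∃ b, crd B b a ≠ 0 := by
    by_contra h
    push Not at h
    exact ne_zero_of_mem (B.pos_sub ha) (eq_of_crd B fun b => by simp [h b])
  obtain ⟨n, hn⟩ := crd_nat_of_pos ha b
  have : (1 : ℝ) ≤ crd B b a := by
    rw [hn] at hb ⊢
    have : n ≠ 0 := by exact_mod_cast hb
    exact_mod_cast Nat.one_le_iff_ne_zero.mpr this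
  rw [hgt_apply]
  exact this.trans (Finset.single_le_sum (f := fun b => crd B b a)
    (fun b _ => crd_nonneg ha b) (Finset.mem_univ b))

end Roots

end TwistedMacdonald

namespace TwistedMacdonald

section WeylGroup

variable {V : Type} [AddCommGroup V] [Module ℝ V] {S : RootSys V}

/-- The reflection in a root as a linear automorphism. -/
noncomputable def rfE {a : V} (ha : a ∈ S.R) : V ≃ₗ[ℝ] V :=
  LinearEquiv.ofInvolutive (rf S a) (rf_rf ha)

theorem rfE_apply {a : V} (ha : a ∈ S.R) (x : V) : rfE ha x = rf S a x := rfl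

theorem rfE_mul_self {a : V} (ha : a ∈ S.R) : rfE ha * rfE ha = 1 := by
  ext x; exact rf_rf ha x

theorem rfE_mem {a : V} (ha : a ∈ S.R) : rfE ha ∈ Weyl S :=
  Subgroup.subset_closure ⟨a, ha, fun x => by rw [rfE_apply, rf_apply, pr_apply]⟩

theorem det_rfE [FiniteDimensional ℝ V] {a : V} (ha : a ∈ S.R) :
    LinearMap.det ((rfE ha : V ≃ₗ[ℝ] V) : V →ₗ[ℝ] V) = -1 := by
  have h : ((rfE ha : V ≃ₗ[ℝ] V) : V →ₗ[ℝ] V) = LinearMap.transvection (pr S a) (-a) := by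
    ext x
    simp [LinearMap.transvection.apply, rfE_apply, rf_apply, sub_eq_add_neg]
  rw [h, LinearMap.transvection.det, map_neg, pr_self ha]
  norm_num

theorem weyl_induction {p : (V ≃ₗ[ℝ] V) → Prop} (h1 : p 1)
    (hs : ∀ (a : V) (ha : a ∈ S.R) (u : V ≃ₗ[ℝ] V), u ∈ Weyl S → p u → p (rfE ha * u))
    {u : V ≃ₗ[ℝ] V} (hu : u ∈ Weyl S) : p u := by
  have gen : ∀ x : V ≃ₗ[ℝ] V, (∃ α ∈ S.R, ∀ y : V, x y = y - (2 * S.I α y / S.I α α) • α) →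
      ∃ a, ∃ ha : a ∈ S.R, x = rfE ha := by
    rintro x ⟨a, ha, hx⟩
    refine ⟨a, ha, ?_⟩
    ext y
    rw [hx, rfE_apply, rf_apply, pr_apply]
  induction hu using Subgroup.closure_induction_left with
  | one => exact h1
  | mul_left x hx y hy ih =>
    obtain ⟨a, ha, rfl⟩ := gen x hx
    exact hs a ha y hy ih
  | inv_mul_cancel x hx y hy ih =>
    obtain ⟨a, ha, rfl⟩ := gen x hx
    rw [inv_eq_of_mul_eq_one_left (rfE_mul_self ha)]
    exact hs a ha y hy ih

theorem weyl_mem_R {u : V ≃ₗ[ℝ] V} (hu : u ∈ Weyl S) {b : V} (hb : b ∈ S.R) : u b ∈ S.R := by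
  exact weyl_induction (p := fun u => u b ∈ S.R) hb (fun a ha u _ ih => rf_mem ha ih) hu

theorem weyl_form {u : V ≃ₗ[ℝ] V} (hu : u ∈ Weyl S) (x y : V) : S.I (u x) (u y) = S.I x y := by
  refine weyl_induction (p := fun u => S.I (u x) (u y) = S.I x y) rfl (fun a ha u _ ih => ?_) hu
  rw [LinearEquiv.mul_apply, LinearEquiv.mul_apply, rfE_apply, rfE_apply, form_rf_rf ha, ih]

theorem weyl_lat {u : V ≃ₗ[ℝ] V} (hu : u ∈ Weyl S) {y : V} (hy : y ∈ rootLat S) :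
    u y ∈ rootLat S := by
  induction hy using AddSubgroup.closure_induction with
  | mem y hy => exact AddSubgroup.subset_closure (weyl_mem_R hu hy)
  | zero => rw [map_zero]; exact AddSubgroup.zero_mem _
  | add x y _ _ hx hy => rw [map_add]; exact AddSubgroup.add_mem _ hx hy
  | neg x _ hx => rw [map_neg]; exact AddSubgroup.neg_mem _ hx

theorem weyl_conj {u : V ≃ₗ[ℝ] V} (hu : u ∈ Weyl S) {a : V} (ha : a ∈ S.R) :
    u * rfE ha = rfE (weyl_mem_R hu ha) * u := by
  ext x
  simp only [LinearEquiv.mul_apply, rfE_apply, rf_apply, map_sub, map_smul, pr_apply,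
    weyl_form hu]

theorem rfE_congr {a b : V} (h : a = b) (ha : a ∈ S.R) (hb : b ∈ S.R) : rfE ha = rfE hb := by
  subst h; rfl

theorem rfE_neg {a : V} (ha : a ∈ S.R) : rfE (neg_mem ha) = rfE ha := by
  ext x
  simp [rfE_apply, rf_apply, pr_neg_left]

variable {B : Base S}

/-- The product of the simple reflections in a word. -/
noncomputable def wprod (L : List {x // x ∈ B.Pi}) : V ≃ₗ[ℝ] V :=
  (L.map fun b => rfE (Pi_sub B b.2)).prod

theorem wprod_nil : wprod ([] : List {x // x ∈ B.Pi}) = 1 := rfl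

theorem wprod_cons (b : {x // x ∈ B.Pi}) (L : List {x // x ∈ B.Pi}) :
    wprod (b :: L) = rfE (Pi_sub B b.2) * wprod L := by simp [wprod]

theorem wprod_append (L M : List {x // x ∈ B.Pi}) : wprod (L ++ M) = wprod L * wprod M := by
  simp [wprod]

theorem wprod_mem (L : List {x // x ∈ B.Pi}) : wprod L ∈ Weyl S := by
  induction L with
  | nil => exact one_mem _
  | cons b L ih => rw [wprod_cons]; exact mul_mem (rfE_mem _) ih

theorem wprod_reverse (L : List {x // x ∈ B.Pi}) : wprod L * wprod L.reverse = 1 := by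
  induction L with
  | nil => rfl
  | cons b L ih =>
    rw [List.reverse_cons, wprod_append, wprod_cons, mul_assoc, ← mul_assoc (wprod L), ih, one_mul,
      wprod_cons, wprod_nil, mul_one, rfE_mul_self]

theorem exists_word_root (n : ℕ) : ∀ a ∈ B.Pos, hgt B a ≤ n →
    ∃ (L : List {x // x ∈ B.Pi}) (b : {x // x ∈ B.Pi}), a = wprod L b := by
  induction n with
  | zero =>
    intro a ha h
    have := one_le_hgt ha
    norm_num at h; linarith
  | succ n ih =>
    intro a ha h
    by_cases haP : a ∈ B.Pi
    · exact ⟨[], ⟨a, haP⟩, rfl⟩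
    obtain ⟨b, hb, hab⟩ := exists_simple_form_pos ha
    have hne : a ≠ b := fun e => haP (e ▸ hb)
    have hbR := Pi_sub B hb
    obtain ⟨k, hk⟩ := pr_int hbR (B.pos_sub ha)
    have hk1 : (1 : ℝ) ≤ pr S b a := by
      have h1 := two_mul_form hbR a
      rw [S.symm b a] at h1
      have h2 : 0 < pr S b a := by
        by_contra h3
        have := norm_pos hbR
        nlinarith
      rw [hk] at h2 ⊢
      exact_mod_cast h2
    obtain ⟨L, b', hL⟩ := ih (rf S b a) (rf_simple_pos ha hb hne) (by
      rw [rf_apply, map_sub, map_smul, hgt_simple hb]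
      push_cast at h
      simp only [smul_eq_mul]; linarith)
    refine ⟨⟨b, hb⟩ :: L, b', ?_⟩
    rw [wprod_cons, LinearEquiv.mul_apply, ← hL, rfE_apply, rf_rf hbR]

theorem exists_word {u : V ≃ₗ[ℝ] V} (hu : u ∈ Weyl S) :
    ∃ L : List {x // x ∈ B.Pi}, wprod L = u := by
  have hpos : ∀ a (ha : a ∈ B.Pos), ∃ L : List {x // x ∈ B.Pi}, wprod L = rfE (B.pos_sub ha) := by
    intro a ha
    obtain ⟨L, b, rfl⟩ := exists_word_root ⌈hgt B a⌉₊ a ha (Nat.le_ceil _)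
    refine ⟨L ++ b :: L.reverse, ?_⟩
    rw [wprod_append, wprod_cons, ← mul_assoc, weyl_conj (wprod_mem L), mul_assoc, wprod_reverse,
      mul_one]
  refine weyl_induction (p := fun u => ∃ L : List {x // x ∈ B.Pi}, wprod L = u) ⟨[], rfl⟩
    (fun a ha u _ ih => ?_) hu
  obtain ⟨L, hL⟩ := ih
  obtain ⟨M, hM⟩ : ∃ M : List {x // x ∈ B.Pi}, wprod M = rfE ha := by
    rcases B.mem_or_neg a ha with h | h
    · exact hpos a h
    · obtain ⟨M, hM⟩ := hpos _ h
      exact ⟨M, hM.trans (rfE_neg ha)⟩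
  exact ⟨M ++ L, by rw [wprod_append, hL, hM]⟩

theorem exchange (L : List {x // x ∈ B.Pi}) (b : {x // x ∈ B.Pi})
    (h : wprod L (b : V) ∉ B.Pos) :
    ∃ L' : List {x // x ∈ B.Pi}, L'.length + 1 = L.length ∧
      wprod L' = wprod L * rfE (Pi_sub B b.2) := by
  induction L with
  | nil => exact absurd (B.pi_sub b.2) h
  | cons c L ih =>
    by_cases hv : wprod L (b : V) ∈ B.Pos
    · have hc : wprod L (b : V) = c := by
        by_contra hne
        apply h
        rw [wprod_cons, LinearEquiv.mul_apply, rfE_apply]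
        exact rf_simple_pos hv c.2 hne
      refine ⟨L, rfl, ?_⟩
      rw [wprod_cons, mul_assoc, weyl_conj (wprod_mem L), ← mul_assoc,
        rfE_congr hc _ (Pi_sub B c.2), rfE_mul_self, one_mul]
    · obtain ⟨L', hl, hL'⟩ := ih hv
      exact ⟨c :: L', by simp [hl], by rw [wprod_cons, hL', wprod_cons, mul_assoc]⟩

/-- An element of the Weyl group preserving the positive roots is trivial. -/
theorem weyl_eq_one {u : V ≃ₗ[ℝ] V} (hu : u ∈ Weyl S) (h : ∀ a ∈ B.Pos, u a ∈ B.Pos) :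
    u = 1 := by
  have key : ∀ n : ℕ, ∀ L : List {x // x ∈ B.Pi}, L.length ≤ n →
      (∀ a ∈ B.Pos, wprod L a ∈ B.Pos) → wprod L = 1 := by
    intro n
    induction n with
    | zero =>
      intro L hL _
      rw [List.length_eq_zero_iff.mp (Nat.le_zero.mp hL), wprod_nil]
    | succ n ih =>
      intro L hL hp
      rcases List.eq_nil_or_concat L with rfl | ⟨M, b, rfl⟩
      · exact wprod_nil
      have hpb := hp b (B.pi_sub b.2)
      have hM : wprod M (b : V) ∉ B.Pos := by
        intro h'
        rw [List.concat_eq_append, wprod_append, LinearEquiv.mul_apply, wprod_cons, wprod_nil,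
          mul_one, rfE_apply, rf_self (Pi_sub B b.2), map_neg] at hpb
        exact B.not_both _ h' hpb
      obtain ⟨L', hl, hL'⟩ := exchange M b hM
      have e : wprod (M.concat b) = wprod L' := by
        rw [hL', List.concat_eq_append, wprod_append, wprod_cons, wprod_nil, mul_one]
      rw [e] at hp ⊢
      refine ih L' ?_ hp
      rw [List.length_concat] at hL
      omega
  obtain ⟨L, rfl⟩ := exists_word (B := B) hu
  exact key _ L le_rfl h

theorem weyl_eq_one_of_weylVec {u : V ≃ₗ[ℝ] V} (hu : u ∈ Weyl S)
    (h : u (weylVec B) = weylVec B) : u = 1 := by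
  refine weyl_eq_one (B := B) hu fun a ha => ?_
  by_contra hn
  have h1 := form_weylVec_pos (pos_or_neg (weyl_mem_R hu (B.pos_sub ha)) hn)
  have h2 := form_weylVec_pos ha
  rw [← weyl_form hu, h] at h2
  simp at h1; linarith

end WeylGroup

end TwistedMacdonald

namespace TwistedMacdonald

/-- The highest short root together with the ratios `d a = I(a,a)/I(θs,θs)`, which take the
values `1` and `t` only. -/
structure Datum {V : Type} [AddCommGroup V] [Module ℝ V] {S : RootSys V} (B : Base S) where
  θs : V
  mem : θs ∈ S.R
  d : V → ℕ
  t : ℕ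
  two_le : 2 ≤ t
  d_or : ∀ a ∈ S.R, d a = 1 ∨ d a = t
  norm : ∀ a ∈ S.R, S.I a a = d a * S.I θs θs
  high : ∀ a ∈ S.R, d a = 1 → ∃ cf : V → ℕ, θs - a = ∑ b ∈ B.Pi, (cf b : ℝ) • b

section Lattice

variable {V : Type} [AddCommGroup V] [Module ℝ V] {S : RootSys V}

theorem pr_int_lat {a y : V} (ha : a ∈ S.R) (hy : y ∈ rootLat S) : ∃ n : ℤ, pr S a y = n := by
  induction hy using AddSubgroup.closure_induction with
  | mem y hy => exact pr_int ha hy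
  | zero => exact ⟨0, by simp⟩
  | add x y _ _ hx hy =>
    obtain ⟨m, hm⟩ := hx
    obtain ⟨n, hn⟩ := hy
    exact ⟨m + n, by simp [hm, hn]⟩
  | neg x _ hx =>
    obtain ⟨m, hm⟩ := hx
    exact ⟨-m, by simp [hm]⟩

theorem add_mem_of_pr_neg {a b : V} (ha : a ∈ S.R) (hb : b ∈ S.R) (h : S.I a b < 0) :
    a + b = 0 ∨ a + b ∈ S.R := by
  wlog hab : S.I b b ≤ S.I a a generalizing a b
  · rw [add_comm]
    exact this hb ha (by rwa [S.symm]) (le_of_not_ge hab)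
  by_cases h1 : b = -a
  · left; rw [h1]; simp
  right
  have h2 : b ≠ a := by
    rintro rfl
    exact lt_asymm h (norm_pos hb)
  have h3 := pr_abs_lt_two ha hab h2 h1
  obtain ⟨n, hn⟩ := pr_int ha hb
  have h4 := two_mul_form ha b
  have h5 : pr S a b < 0 := by
    by_contra hc
    have := norm_pos ha
    nlinarith
  have h6 : n = -1 := by
    rw [hn, abs_lt] at h3
    rw [hn] at h5
    have h3' : (-2 : ℤ) < n := by exact_mod_cast h3.1
    have h5' : n < 0 := by exact_mod_cast h5
    omega
  have := rf_mem ha hb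
  rwa [rf_apply, hn, h6, Int.cast_neg, Int.cast_one, neg_one_smul, sub_neg_eq_add, add_comm] at this

/-- A vector of the root lattice pairing to `0`, `1` or `-1` with every coroot vanishes. -/
theorem eq_zero_of_minuscule {y : V} (hy : y ∈ rootLat S) (h : ∀ a ∈ S.R, |pr S a y| ≤ 1) :
    y = 0 := by
  have hex : ∃ n : ℕ, ∃ L : List V, L.length = n ∧ (∀ a ∈ L, a ∈ S.R) ∧ L.sum = y := by
    have hy' : y ∈ AddSubmonoid.closure (S.R : Set V) := by
      have h1 := (AddSubgroup.mem_toAddSubmonoid _ _).mpr hy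
      rw [rootLat, AddSubgroup.closure_toAddSubmonoid] at h1
      convert h1 using 2
      refine (Set.union_eq_self_of_subset_right fun a ha => ?_).symm
      simpa using neg_mem (S := S) ha
    obtain ⟨L, hL, hs⟩ := AddSubmonoid.exists_list_of_mem_closure hy'
    exact ⟨_, L, rfl, hL, hs⟩
  obtain ⟨L, hl, hL, hs⟩ := Nat.find_spec hex
  cases L with
  | nil => simpa using hs.symm
  | cons b L =>
    exfalso
    have hb := hL b (by simp)
    by_cases hc : ∀ c ∈ L, 0 ≤ pr S b c
    · have h1 := (abs_le.mp (h b hb)).2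
      rw [← hs, List.sum_cons, map_add, pr_self hb, map_list_sum] at h1
      have : 0 ≤ (L.map (pr S b)).sum := List.sum_nonneg (by simpa using hc)
      linarith
    · push Not at hc
      obtain ⟨c, hcL, hc⟩ := hc
      have hc' : S.I b c < 0 := by
        have := two_mul_form hb c
        have := norm_pos hb
        nlinarith
      have hsum : L.sum = c + (L.erase c).sum := (List.sum_erase hcL).symm
      have hlen := List.length_erase_add_one hcL
      rw [List.length_cons] at hl
      rw [List.sum_cons] at hs
      rcases add_mem_of_pr_neg hb (hL c (by simp [hcL])) hc' with h0 | h0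
      · refine Nat.find_min hex (m := (L.erase c).length) (by omega) ⟨_, rfl, fun a ha => ?_, ?_⟩
        · exact hL a (List.mem_cons_of_mem _ (List.mem_of_mem_erase ha))
        · rw [← hs, hsum, ← add_assoc, h0, zero_add]
      · refine Nat.find_min hex (m := ((b + c) :: L.erase c).length)
          (by rw [List.length_cons]; omega) ⟨_, rfl, fun a ha => ?_, ?_⟩
        · rcases List.mem_cons.mp ha with rfl | ha
          · exact h0
          · exact hL a (List.mem_cons_of_mem _ (List.mem_of_mem_erase ha))
        · rw [← hs, hsum, List.sum_cons, add_assoc]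

variable {B : Base S}

theorem weyl_weylVec_sub {u : V ≃ₗ[ℝ] V} (hu : u ∈ Weyl S) :
    u (weylVec B) - weylVec B ∈ rootLat S := by
  obtain ⟨L, rfl⟩ := exists_word (B := B) hu
  induction L with
  | nil => rw [wprod_nil]; simp
  | cons b L ih =>
    have hb := Pi_sub B b.2
    have e : wprod (b :: L) (weylVec B) - weylVec B =
        rfE hb (wprod L (weylVec B) - weylVec B) - b := by
      rw [wprod_cons, LinearEquiv.mul_apply, map_sub, rfE_apply hb (weylVec B),
        rf_apply (S := S) b (weylVec B), pr_weylVec b.2]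
      module
    rw [e]
    exact AddSubgroup.sub_mem _ (weyl_lat (rfE_mem hb) (ih (wprod_mem L)))
      (AddSubgroup.subset_closure hb)

theorem pr_weylVec_int {a : V} (ha : a ∈ B.Pos) : ∃ n : ℤ, pr S a (weylVec B) = n := by
  obtain ⟨L, b, hL⟩ := exists_word_root ⌈hgt B a⌉₊ a ha (Nat.le_ceil _)
  have hw := inv_mem (wprod_mem L)
  obtain ⟨n, hn⟩ := pr_int_lat (Pi_sub B b.2) (weyl_weylVec_sub (B := B) hw)
  have e : pr S a (weylVec B) = pr S b ((wprod L)⁻¹ (weylVec B)) := by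
    rw [pr_apply, pr_apply, ← weyl_form hw, ← weyl_form hw a a, hL, ← LinearEquiv.mul_apply,
      inv_mul_cancel]
    rfl
  rw [map_sub, pr_weylVec b.2] at hn
  exact ⟨n + 1, by rw [e]; push_cast; linarith⟩

end Lattice

namespace Datum

variable {V : Type} [AddCommGroup V] [Module ℝ V] {S : RootSys V} {B : Base S} (D : Datum B)

theorem d_congr {a b : V} (ha : a ∈ S.R) (hb : b ∈ S.R) (h : S.I a a = S.I b b) :
    D.d a = D.d b := by
  rw [D.norm a ha, D.norm b hb] at h
  exact_mod_cast mul_right_cancel₀ (norm_pos D.mem).ne' h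

theorem d_θs : D.d D.θs = 1 := by
  have h := D.norm _ D.mem
  have hp := norm_pos D.mem
  have : (D.d D.θs : ℝ) = 1 := mul_right_cancel₀ hp.ne' (by rw [one_mul]; exact h.symm)
  exact_mod_cast this

theorem d_pos {a : V} (ha : a ∈ S.R) : 1 ≤ D.d a := by
  have := D.two_le
  rcases D.d_or a ha with h | h <;> omega

theorem norm_le {a : V} (ha : a ∈ S.R) : S.I D.θs D.θs ≤ S.I a a := by
  rw [D.norm a ha]
  have : (1 : ℝ) ≤ D.d a := by exact_mod_cast D.d_pos ha
  nlinarith [norm_pos D.mem]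

theorem d_neg {a : V} (ha : a ∈ S.R) : D.d (-a) = D.d a :=
  D.d_congr (neg_mem ha) ha (form_neg_neg a)

theorem d_rf {a b : V} (ha : a ∈ S.R) (hb : b ∈ S.R) : D.d (rf S b a) = D.d a :=
  D.d_congr (rf_mem hb ha) ha (form_rf_rf hb a a)

theorem crd_high {a : V} (ha : a ∈ S.R) (h1 : D.d a = 1) (b) : 0 ≤ crd B b (D.θs - a) := by
  obtain ⟨c, hc⟩ := D.high a ha h1
  rw [hc, crd_sum B fun b => (c b : ℝ)]
  positivity

theorem θs_simple {b : V} (hb : b ∈ B.Pi) : 0 ≤ S.I D.θs b := by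
  have hbR := Pi_sub B hb
  have h := D.crd_high (rf_mem hbR D.mem) (by rw [D.d_rf D.mem hbR, D.d_θs]) ⟨b, hb⟩
  rw [rf_apply, sub_sub_cancel, map_smul, crd_simple_of_mem B hb, if_pos rfl, smul_eq_mul,
    mul_one] at h
  have := two_mul_form hbR D.θs
  have := norm_pos hbR
  rw [S.symm]
  nlinarith

theorem θs_pos : D.θs ∈ B.Pos := by
  by_contra hc
  have h1 := pos_or_neg D.mem hc
  refine ne_zero_of_mem D.mem (eq_of_crd B fun b => ?_)
  have h2 := D.crd_high (neg_mem D.mem) (by rw [D.d_neg D.mem, D.d_θs]) b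
  have h3 := crd_nonneg h1 b
  simp only [map_sub, map_neg, map_zero] at *
  linarith

theorem θs_form_nonneg {a : V} (ha : a ∈ B.Pos) : 0 ≤ S.I D.θs a :=
  form_nonneg_of_crd (fun _ => D.θs_simple) (crd_nonneg ha)

theorem pos_of_form_pos {a : V} (ha : a ∈ S.R) (h : 0 < S.I D.θs a) : a ∈ B.Pos := by
  by_contra hc
  have := D.θs_form_nonneg (pos_or_neg ha hc)
  simp at this; linarith

theorem pr_θs {a : V} (ha : a ∈ S.R) (h1 : a ≠ D.θs) (h2 : a ≠ -D.θs) :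
    ∃ n : ℤ, pr S a D.θs = n ∧ -1 ≤ n ∧ n ≤ 1 := by
  obtain ⟨n, hn⟩ := pr_int ha D.mem
  have h := pr_abs_lt_two ha (D.norm_le ha) (Ne.symm h1) (fun e => h2 (by rw [e, neg_neg]))
  rw [hn, abs_lt] at h
  have h3 : (-2 : ℤ) < n := by exact_mod_cast h.1
  have h4 : n < (2 : ℤ) := by exact_mod_cast h.2
  exact ⟨n, hn, by omega, by omega⟩

/-- The dual Coxeter-like number `h = 1 + (ρ, θs^∨)`. -/
noncomputable def h : ℝ := 1 + pr S D.θs (weylVec B)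

theorem h_pos : 0 < D.h := by
  have h1 := form_weylVec_pos D.θs_pos
  rw [S.symm] at h1
  have h2 := two_mul_form D.mem (weylVec B)
  have h3 := norm_pos D.mem
  have : 0 < pr S D.θs (weylVec B) := by
    by_contra hc
    nlinarith
  rw [h]; linarith

theorem h_int : ∃ n : ℤ, D.h = n := by
  obtain ⟨n, hn⟩ := pr_weylVec_int D.θs_pos
  exact ⟨1 + n, by rw [h, hn]; push_cast; ring⟩

/-- The form `Σ_{a ∈ R} (a,y)(a^∨,z)`. -/
noncomputable def casimir (S : RootSys V) : V →ₗ[ℝ] V →ₗ[ℝ] ℝ :=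
  ∑ a ∈ S.R, (S.I a).smulRight (pr S a)

theorem casimir_apply (y z : V) : casimir S y z = ∑ a ∈ S.R, S.I a y * pr S a z := by
  simp [casimir, LinearMap.sum_apply]

theorem casimir_symm (y z : V) : casimir S y z = casimir S z y := by
  rw [casimir_apply, casimir_apply]
  refine Finset.sum_congr rfl fun a _ => ?_
  rw [pr_apply, pr_apply]; ring

theorem casimir_rf {b : V} (hb : b ∈ S.R) (y z : V) :
    casimir S (rf S b y) (rf S b z) = casimir S y z := by
  rw [casimir_apply, casimir_apply]
  refine Finset.sum_bij' (fun a _ => rf S b a) (fun a _ => rf S b a) (fun a => rf_mem hb)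
      (fun a => rf_mem hb) (fun a _ => rf_rf hb a) (fun a _ => rf_rf hb a) (fun a _ => ?_)
  rw [← pr_rf_rf hb a, ← form_rf_rf hb a, rf_rf hb, rf_rf hb]

theorem casimir_root {b : V} (hb : b ∈ S.R) (z : V) :
    casimir S b z * S.I b b = casimir S b b * S.I b z := by
  have h1 : casimir S b (z - (pr S b z / 2) • b) = 0 := by
    have e := casimir_rf hb b (z - (pr S b z / 2) • b)
    have e2 : rf S b (z - (pr S b z / 2) • b) = z - (pr S b z / 2) • b := by
      rw [map_sub, map_smul, rf_self hb, rf_apply]; module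
    rw [e2, rf_self hb, map_neg, LinearMap.neg_apply] at e
    linarith
  rw [map_sub, map_smul, smul_eq_mul] at h1
  have := two_mul_form hb z
  linear_combination S.I b b * h1 - casimir S b b / 2 * this

theorem casimir_θs : casimir S D.θs D.θs = 2 * D.h * S.I D.θs D.θs := by
  have h1 : ∀ a ∈ B.Pos, S.I a D.θs * pr S a D.θs =
      S.I a D.θs + if a = D.θs then S.I D.θs D.θs else 0 := by
    intro a ha
    split_ifs with h
    · subst h
      rw [pr_self (B.pos_sub ha)]; ring
    · have h2 : a ≠ -D.θs := fun e => B.not_both _ D.θs_pos (e ▸ ha)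
      obtain ⟨n, hn, h3, h4⟩ := D.pr_θs (B.pos_sub ha) h h2
      have h5 := D.θs_form_nonneg ha
      rw [S.symm] at h5
      have h6 := two_mul_form (B.pos_sub ha) D.θs
      have h7 := norm_pos (B.pos_sub ha)
      have h8 : n = 0 ∨ n = 1 := by
        have : 0 ≤ n := by
          by_contra hc
          have : (n : ℝ) ≤ -1 := by exact_mod_cast (by omega : n ≤ -1)
          rw [hn] at h6
          nlinarith
        omega
      rcases h8 with rfl | rfl
      · rw [hn] at h6 ⊢
        norm_num at h6 ⊢
        linarith
      · rw [hn]; norm_num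
  rw [casimir_apply, sum_R (B := B)]
  have h2 : ∀ a ∈ B.Pos, S.I a D.θs * pr S a D.θs + S.I (-a) D.θs * pr S (-a) D.θs =
      2 * (S.I a D.θs + if a = D.θs then S.I D.θs D.θs else 0) := by
    intro a ha
    rw [← h1 a ha, pr_neg_left]; simp; ring
  rw [Finset.sum_congr rfl h2, ← Finset.mul_sum, Finset.sum_add_distrib, Finset.sum_ite_eq',
    if_pos D.θs_pos]
  have h3 : ∑ a ∈ B.Pos, S.I a D.θs = 2 * S.I D.θs (weylVec B) := by
    rw [S.symm D.θs, weylVec]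
    simp [LinearMap.sum_apply]
  rw [h3, two_mul_form D.mem, h]; ring

theorem casimir_eq (y z : V) : casimir S y z = 2 * D.h * S.I y z := by
  have hroot : ∀ b ∈ S.R, casimir S b b = 2 * D.h * S.I b b := by
    intro b hb
    refine irred_pred (S := S) (fun b => casimir S b b = 2 * D.h * S.I b b) ?_ D.mem D.casimir_θs hb
    intro a ha b hb h1 h2
    by_contra h3
    apply h2
    have e1 := casimir_root ha b
    have e2 := casimir_root hb a
    rw [casimir_symm b a, S.symm b a] at e2
    rw [h1] at e1
    have e3 : casimir S a b = 2 * D.h * S.I a b :=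
      mul_right_cancel₀ (norm_pos ha).ne' (by rw [e1]; ring)
    rw [e3] at e2
    exact mul_right_cancel₀ h3 (by rw [← e2]; ring)
  have hy : y ∈ Submodule.span ℝ (S.R : Set V) := by rw [S.spanning]; trivial
  induction hy using Submodule.span_induction with
  | mem b hb =>
    have := casimir_root hb z
    rw [hroot b hb] at this
    exact mul_right_cancel₀ (norm_pos hb).ne' (by rw [this]; ring)
  | zero => simp
  | add y w _ _ hy hz => rw [map_add, LinearMap.add_apply, hy, hz, map_add, LinearMap.add_apply]; ring
  | smul c y _ hy => rw [map_smul, LinearMap.smul_apply, hy, map_smul, LinearMap.smul_apply]; simp; ring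

theorem sum_pos_form (y z : V) : ∑ a ∈ B.Pos, S.I a y * pr S a z = D.h * S.I y z := by
  have h1 := D.casimir_eq y z
  rw [casimir_apply, sum_R (B := B)] at h1
  have h2 : ∀ a ∈ B.Pos, S.I a y * pr S a z + S.I (-a) y * pr S (-a) z =
      2 * (S.I a y * pr S a z) := by
    intro a _
    rw [pr_neg_left]; simp; ring
  rw [Finset.sum_congr rfl h2, ← Finset.mul_sum] at h1
  linarith

theorem card_R [FiniteDimensional ℝ V] : (S.R.card : ℝ) = D.h * B.Pi.card := by
  have hT : ∑ a ∈ S.R, (pr S a).smulRight a = (2 * D.h) • (LinearMap.id : V →ₗ[ℝ] V) := by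
    ext y
    rw [← sub_eq_zero]
    apply eq_zero_of_orthogonal (S := S)
    intro z _
    have h1 := D.casimir_eq z y
    rw [casimir_apply] at h1
    simp only [LinearMap.sum_apply, LinearMap.smulRight_apply, LinearMap.smul_apply,
      LinearMap.id_apply, map_sub, map_sum, map_smul, LinearMap.sub_apply, smul_eq_mul]
    rw [S.symm y z, ← h1, sub_eq_zero]
    exact Finset.sum_congr rfl fun a _ => by ring
  have h2 := congrArg (LinearMap.trace ℝ V) hT
  rw [map_sum, map_smul, LinearMap.trace_id, Finset.sum_congr rfl fun a ha => by
    rw [LinearMap.trace_smulRight, pr_self ha], Finset.sum_const,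
    Module.finrank_eq_card_basis (simpleBasis B)] at h2
  simp at h2
  linarith

theorem eq_zero_of_form {x : V} (h1 : ∀ b ∈ B.Pi, 0 ≤ S.I x b) (h2 : S.I x D.θs ≤ 0) : x = 0 := by
  have hs : ∀ a ∈ S.R, D.d a = 1 → S.I x a = 0 := by
    have hle : ∀ a ∈ S.R, D.d a = 1 → S.I x a ≤ 0 := by
      intro a ha h
      have h3 := form_nonneg_of_crd h1 (D.crd_high ha h)
      rw [map_sub] at h3; linarith
    intro a ha h
    have h4 := hle _ (neg_mem ha) (by rw [D.d_neg ha, h])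
    rw [map_neg] at h4
    linarith [hle a ha h]
  apply eq_zero_of_orthogonal (S := S)
  intro a ha
  have hnon : ∃ c ∈ S.R, D.d c = 1 ∧ S.I a c ≠ 0 := by
    refine irred_pred (S := S) (fun a => ∃ c ∈ S.R, D.d c = 1 ∧ S.I a c ≠ 0) ?_ D.mem
      ⟨D.θs, D.mem, D.d_θs, (norm_pos D.mem).ne'⟩ ha
    rintro a ha b hb ⟨c, hc, hc1, hac⟩ h
    push Not at h
    have e1 := h _ (rf_mem ha hc) (by rw [D.d_rf hc ha, hc1])
    rw [rf_apply, map_sub, map_smul, h c hc hc1, smul_eq_mul, zero_sub, neg_eq_zero,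
      mul_eq_zero] at e1
    rcases e1 with e1 | e1
    · have := two_mul_form ha c
      rw [e1] at this
      exact absurd (by linarith) hac
    · rw [S.symm, e1]
  obtain ⟨c, hc, hc1, hac⟩ := hnon
  have e1 := hs _ (rf_mem ha hc) (by rw [D.d_rf hc ha, hc1])
  rw [rf_apply, map_sub, map_smul, hs c hc hc1, smul_eq_mul, zero_sub, neg_eq_zero,
    mul_eq_zero] at e1
  refine e1.resolve_left fun e1 => hac ?_
  have := two_mul_form ha c
  rw [e1] at this
  linarith

theorem norm_shift (y : V) : S.I (weylVec B + D.h • y) (weylVec B + D.h • y) -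
    S.I (weylVec B) (weylVec B) = D.h * ∑ a ∈ B.Pos, S.I a y * (1 + pr S a y) := by
  have h1 := D.sum_pos_form y y
  have h2 : ∑ a ∈ B.Pos, S.I a y = 2 * S.I (weylVec B) y := by
    rw [weylVec]
    simp [LinearMap.sum_apply]
  have h3 : ∑ a ∈ B.Pos, S.I a y * (1 + pr S a y) =
      ∑ a ∈ B.Pos, S.I a y + ∑ a ∈ B.Pos, S.I a y * pr S a y := by
    rw [← Finset.sum_add_distrib]
    exact Finset.sum_congr rfl fun a _ => by ring
  rw [h3, h1, h2]
  simp only [map_add, map_smul, LinearMap.add_apply, LinearMap.smul_apply, smul_eq_mul]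
  rw [S.symm y (weylVec B)]
  ring

theorem term_nat {a y : V} (ha : a ∈ S.R) (hy : y ∈ rootLat S) :
    ∃ k : ℕ, S.I a y * (1 + pr S a y) = S.I D.θs D.θs * k ∧ (k = 0 → |pr S a y| ≤ 1) := by
  obtain ⟨n, hn⟩ := pr_int_lat ha hy
  have h1 := two_mul_form ha y
  obtain ⟨m, hm⟩ : ∃ m : ℕ, n * (n + 1) = 2 * m := by
    obtain ⟨m, hm⟩ := Int.even_mul_succ_self n
    have h0 : 0 ≤ m := by
      by_contra hc
      rcases le_or_gt 0 n with h | h <;> nlinarith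
    obtain ⟨k, rfl⟩ := Int.eq_ofNat_of_zero_le h0
    exact ⟨k, by rw [hm]; ring⟩
  refine ⟨D.d a * m, ?_, ?_⟩
  · have hm' : (n : ℝ) * (n + 1) = 2 * m := by exact_mod_cast hm
    rw [hn] at h1 ⊢
    rw [D.norm a ha] at h1
    push_cast
    linear_combination (1 + (n : ℝ)) / 2 * h1 + D.d a * S.I D.θs D.θs / 2 * hm'
  · intro h0
    have h2 := D.d_pos ha
    have hm0 : m = 0 := by
      rcases Nat.mul_eq_zero.mp h0 with h | h <;> omega
    subst hm0
    rw [hn, abs_le]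
    have : n = 0 ∨ n = -1 := by
      rcases (by simpa using hm : n = 0 ∨ n + 1 = 0) with h | h
      · exact Or.inl h
      · right; omega
    rcases this with rfl | rfl <;> norm_num

theorem norm_shift_nat {y : V} (hy : y ∈ rootLat S) : ∃ k : ℕ,
    S.I (weylVec B + D.h • y) (weylVec B + D.h • y) - S.I (weylVec B) (weylVec B) =
      D.h * S.I D.θs D.θs * k := by
  rw [D.norm_shift]
  choose! k hk _ using fun a (ha : a ∈ B.Pos) => D.term_nat (B.pos_sub ha) hy
  refine ⟨∑ a ∈ B.Pos, k a, ?_⟩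
  rw [Finset.sum_congr rfl hk, ← Finset.mul_sum]
  push_cast; ring

theorem eq_zero_of_norm_shift {y : V} (hy : y ∈ rootLat S)
    (h : S.I (weylVec B + D.h • y) (weylVec B + D.h • y) = S.I (weylVec B) (weylVec B)) :
    y = 0 := by
  have h0 := D.norm_shift y
  choose! k hk hk' using fun a (ha : a ∈ B.Pos) => D.term_nat (B.pos_sub ha) hy
  rw [h, sub_self, Finset.sum_congr rfl hk, ← Finset.mul_sum, eq_comm, mul_eq_zero,
    or_iff_right D.h_pos.ne', mul_eq_zero, or_iff_right (norm_pos D.mem).ne',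
    Finset.sum_eq_zero_iff_of_nonneg fun a _ => Nat.cast_nonneg _] at h0
  refine eq_zero_of_minuscule hy fun a ha => ?_
  rcases B.mem_or_neg a ha with hp | hp
  · exact hk' a hp (by exact_mod_cast h0 a hp)
  · have := hk' _ hp (by exact_mod_cast h0 _ hp)
    rwa [pr_neg_left, abs_neg] at this

theorem weyl_free {u : V ≃ₗ[ℝ] V} (hu : u ∈ Weyl S) {y : V} (hy : y ∈ rootLat S)
    (h : u (weylVec B) = weylVec B + D.h • y) : u = 1 := by
  have h0 : y = 0 := D.eq_zero_of_norm_shift hy (by rw [← h, weyl_form hu])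
  refine weyl_eq_one_of_weylVec (B := B) hu ?_
  rw [h, h0]; simp

end Datum

end TwistedMacdonald

namespace TwistedMacdonald

section SignedCount

variable {J G : Type*} [AddCommGroup G]

/-- The number of finite subsets of `J` with `v`-sum `x`, counted with sign: the coefficient at `x`
of the formal product of the factors `1 - e^(v i)`. -/
noncomputable def cnt (v : J → G) (x : G) : ℝ :=
  ∑' T : {T : Finset J // ∑ i ∈ T, v i = x}, (-1 : ℝ) ^ T.1.card

variable {v : J → G} {i₀ : J} {e : Equiv.Perm J}

theorem symmDiff_singleton_of_mem {T : Finset J} (h : i₀ ∈ T) :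
    symmDiff T {i₀} = T.erase i₀ := by
  ext j
  simp only [Finset.mem_symmDiff, Finset.mem_singleton, Finset.mem_erase]
  by_cases hj : j = i₀
  · subst hj; tauto
  · tauto

theorem symmDiff_singleton_of_notMem {T : Finset J} (h : i₀ ∉ T) :
    symmDiff T {i₀} = insert i₀ T := by
  ext j
  simp only [Finset.mem_symmDiff, Finset.mem_singleton, Finset.mem_insert]
  by_cases hj : j = i₀
  · subst hj; tauto
  · tauto

theorem neg_one_pow_symmDiff (T : Finset J) (i₀ : J) :
    (-1 : ℝ) ^ (symmDiff T {i₀}).card = -(-1 : ℝ) ^ T.card := by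
  by_cases h : i₀ ∈ T
  · rw [symmDiff_singleton_of_mem h, ← Finset.card_erase_add_one h, pow_succ]
    ring
  · rw [symmDiff_singleton_of_notMem h, Finset.card_insert_of_notMem h, pow_succ]
    ring

theorem sum_symmDiff_map (he : e i₀ = i₀) (s : G →+ G) (hv : ∀ i, i ≠ i₀ → v (e i) = s (v i))
    (h0 : s (v i₀) = -v i₀) (T : Finset J) :
    ∑ i ∈ symmDiff (T.map e.toEmbedding) {i₀}, v i = s (∑ i ∈ T, v i) + v i₀ := by
  have hmem : i₀ ∈ T.map e.toEmbedding ↔ i₀ ∈ T := by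
    rw [Finset.mem_map_equiv, (Equiv.symm_apply_eq e).mpr he.symm]
  have key : ∀ U : Finset J, i₀ ∉ U → ∑ i ∈ U.map e.toEmbedding, v i = s (∑ i ∈ U, v i) := by
    intro U hU
    rw [Finset.sum_map, map_sum]
    exact Finset.sum_congr rfl fun i hi => hv i fun h => hU (h ▸ hi)
  by_cases h : i₀ ∈ T
  · have e1 : (T.map e.toEmbedding).erase i₀ = (T.erase i₀).map e.toEmbedding := by
      rw [Finset.map_erase]; simp [he]
    rw [symmDiff_singleton_of_mem (hmem.mpr h), e1, key _ (Finset.notMem_erase _ _),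
      ← Finset.add_sum_erase T v h, map_add, h0]
    abel
  · rw [symmDiff_singleton_of_notMem (hmem.not.mpr h), Finset.sum_insert (hmem.not.mpr h),
      key _ h, add_comm]

theorem cnt_anti (he : e i₀ = i₀) (s : G →+ G) (hs : Function.Injective s)
    (hv : ∀ i, i ≠ i₀ → v (e i) = s (v i)) (h0 : s (v i₀) = -v i₀) (x : G) :
    cnt v (s x + v i₀) = - cnt v x := by
  let E : Finset J ≃ Finset J :=
    e.finsetCongr.trans (Function.Involutive.toPerm (fun T => symmDiff T {i₀})
      fun T => symmDiff_symmDiff_cancel_right _ _)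
  have hE : ∀ T, E T = symmDiff (T.map e.toEmbedding) {i₀} := fun T => rfl
  have hiff : ∀ T : Finset J, ∑ i ∈ T, v i = x ↔ ∑ i ∈ E T, v i = s x + v i₀ := fun T => by
    rw [hE, sum_symmDiff_map he s hv h0, add_left_inj, hs.eq_iff]
  rw [cnt, cnt, ← (E.subtypeEquiv hiff).tsum_eq, ← tsum_neg]
  refine tsum_congr fun T => ?_
  rw [Equiv.subtypeEquiv_apply]
  simp only [hE]
  rw [neg_one_pow_symmDiff, Finset.card_map]

end SignedCount

namespace Datum

variable {V : Type} [AddCommGroup V] [Module ℝ V] {S : RootSys V} {B : Base S} (D : Datum B)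

/-- `0` for positive roots and `1` for negative roots. -/
noncomputable def eps (B : Base S) (a : V) : ℕ := if a ∈ B.Pos then 0 else 1

theorem eps_pos {a : V} (h : a ∈ B.Pos) : eps B a = 0 := if_pos h

theorem eps_neg {a : V} (h : a ∉ B.Pos) : eps B a = 1 := if_neg h

theorem eps_le (a : V) : eps B a ≤ 1 := by
  unfold eps; split_ifs <;> simp

/-- Index type of the positive affine roots, imaginary ones counted with multiplicity. -/
abbrev Idx (B : Base S) : Type := ({a // a ∈ S.R} × ℕ) ⊕ ({b // b ∈ B.Pi} × ℕ)

/-- The positive affine roots, as pairs of a finite part and a coefficient of `δ`. -/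
noncomputable def vec : Idx B → V × ℝ :=
  Sum.elim (fun i => (i.1, D.d i.1 * (i.2 + eps B i.1))) (fun i => (0, D.d i.1 * (i.2 + 1)))

theorem vec_inl (a : {a // a ∈ S.R}) (n : ℕ) :
    D.vec (Sum.inl (a, n)) = ((a : V), (D.d a * (n + eps B a) : ℝ)) := rfl

theorem vec_inr (b : {b // b ∈ B.Pi}) (n : ℕ) :
    D.vec (Sum.inr (b, n)) = ((0 : V), (D.d b * (n + 1) : ℝ)) := rfl

section Perm

variable (g : {a // a ∈ S.R} → {a // a ∈ S.R}) (k : {a // a ∈ S.R} → ℤ) (i₀ : {a // a ∈ S.R} × ℕ)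

/-- The affine reflection with finite part `g` and shift `k` acting on the positive real affine
roots different from `i₀`. -/
noncomputable def moveRe (i : {a // a ∈ S.R} × ℕ) : {a // a ∈ S.R} × ℕ :=
  if i = i₀ then i₀ else (g i.1, (i.2 + eps B i.1 + k i.1 - eps B (g i.1) : ℤ).toNat)

theorem moveRe_invol (hg : ∀ a, g (g a) = a) (hk : ∀ a, k (g a) = - k a)
    (h1 : ∀ i : {a // a ∈ S.R} × ℕ, i ≠ i₀ → 0 ≤ (i.2 + eps B i.1 + k i.1 - eps B (g i.1) : ℤ))
    (h2 : (i₀.2 + eps B i₀.1 + k i₀.1 - eps B (g i₀.1) : ℤ) < 0) :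
    Function.Involutive (moveRe (B := B) g k i₀) := by
  intro i
  by_cases h : i = i₀
  · simp [moveRe, h]
  have h3 := h1 i h
  have h4 : (((i.2 + eps B i.1 + k i.1 - eps B (g i.1) : ℤ).toNat : ℕ) : ℤ) = _ :=
    Int.toNat_of_nonneg h3
  have hne : (g i.1, (i.2 + eps B i.1 + k i.1 - eps B (g i.1) : ℤ).toNat) ≠ i₀ := by
    intro h5
    rw [← h5] at h2
    simp only [hg, hk, h4] at h2
    have : (0 : ℤ) ≤ i.2 := Int.natCast_nonneg _
    linarith
  rw [moveRe, moveRe, if_neg h, if_neg hne]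
  ext1
  · exact hg _
  · simp only [hg, hk, h4]
    omega

/-- The permutation of the index set given by an affine simple reflection. -/
noncomputable def movePerm (h : Function.Involutive (moveRe (B := B) g k i₀)) :
    Equiv.Perm (Idx B) :=
  (h.toPerm _).sumCongr (Equiv.refl _)

variable {g k i₀}

theorem cnt_vec_anti (hg : ∀ a, g (g a) = a) (hk : ∀ a, k (g a) = - k a)
    (h1 : ∀ i : {a // a ∈ S.R} × ℕ, i ≠ i₀ → 0 ≤ (i.2 + eps B i.1 + k i.1 - eps B (g i.1) : ℤ))
    (h2 : (i₀.2 + eps B i₀.1 + k i₀.1 - eps B (g i₀.1) : ℤ) < 0)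
    (s : V × ℝ →+ V × ℝ) (hs : Function.Injective s)
    (hd : ∀ a, D.d (g a) = D.d a) (him : ∀ m : ℝ, s (0, m) = (0, m))
    (hre : ∀ (a : {a // a ∈ S.R}) (m : ℝ), s (a, m) = (↑(g a), m + D.d a * k a))
    (h0 : s (D.vec (Sum.inl i₀)) = - D.vec (Sum.inl i₀)) (x : V × ℝ) :
    cnt D.vec (s x + D.vec (Sum.inl i₀)) = - cnt D.vec x := by
  have hinv := moveRe_invol (B := B) g k i₀ hg hk h1 h2
  refine cnt_anti (e := movePerm g k i₀ hinv) (i₀ := Sum.inl i₀) ?_ s hs ?_ h0 x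
  · simp [movePerm, moveRe]
  · rintro (⟨a, n⟩ | ⟨b, n⟩) hi
    · have hi' : (a, n) ≠ i₀ := fun h => hi (by rw [h])
      have e1 : movePerm g k i₀ hinv (Sum.inl (a, n)) =
          Sum.inl (g a, (n + eps B a + k a - eps B (g a) : ℤ).toNat) := by
        simp [movePerm, moveRe, hi']
      have h4 : (((n + eps B a + k a - eps B (g a) : ℤ).toNat : ℕ) : ℝ) =
          n + eps B a + k a - eps B (g a) := by
        exact_mod_cast Int.toNat_of_nonneg (h1 _ hi')
      rw [e1, vec_inl, vec_inl, hre, hd, h4]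
      ext1
      · rfl
      · simp only; ring
    · have e1 : movePerm g k i₀ hinv (Sum.inr (b, n)) = Sum.inr (b, n) := by
        simp [movePerm]
      rw [e1, vec_inr, him]

end Perm

theorem cnt_simple {b : V} (hb : b ∈ B.Pi) (μ : V) (m : ℝ) :
    cnt D.vec (rf S b μ + b, m) = - cnt D.vec (μ, m) := by
  have hbR := Pi_sub B hb
  have hbP := B.pi_sub hb
  have e0 : D.vec (Sum.inl (⟨b, hbR⟩, 0)) = (b, 0) := by
    rw [vec_inl]; simp [eps_pos hbP]
  have := D.cnt_vec_anti (g := fun a => ⟨rf S b a, rf_mem hbR a.2⟩) (k := fun _ => 0)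
    (i₀ := (⟨b, hbR⟩, 0)) (fun a => Subtype.ext (rf_rf hbR _)) (by simp) ?_ ?_
    ((rf S b).toAddMonoidHom.prodMap (AddMonoidHom.id ℝ)) ?_ ?_ ?_ ?_ ?_ (μ, m)
  · rw [e0] at this
    simpa using this
  · rintro ⟨⟨a, ha⟩, n⟩ hi
    simp only
    by_cases hp : a ∈ B.Pos
    · by_cases hab : a = b
      · subst hab
        have : n ≠ 0 := by rintro rfl; exact hi rfl
        have := eps_le (B := B) (rf S a a)
        omega
      · rw [eps_pos (rf_simple_pos hp hb hab)]
        omega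
    · rw [eps_neg hp]
      have := eps_le (B := B) (rf S b a)
      omega
  · simp only
    rw [eps_pos hbP, rf_self hbR, eps_neg (neg_notMem_pos hbP)]
    norm_num
  · rintro ⟨x, m⟩ ⟨y, n⟩ h
    simp only [AddMonoidHom.coe_prodMap, Prod.map_apply, Prod.mk.injEq] at h
    ext1
    · have := congrArg (rf S b) h.1
      simpa [rf_rf hbR] using this
    · simpa using h.2
  · exact fun a => D.d_rf a.2 hbR
  · intro m; simp
  · intro a m; simp
  · rw [e0]; simp [rf_self hbR]

/-- The affine reflection in the short highest root. -/
noncomputable def affHom : V × ℝ →+ V × ℝ where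
  toFun x := (rf S D.θs x.1, x.2 + pr S D.θs x.1)
  map_zero' := by simp
  map_add' x y := by
    ext1
    · simp
    · simp; ring

theorem affHom_apply (x : V × ℝ) : D.affHom x = (rf S D.θs x.1, x.2 + pr S D.θs x.1) := rfl

theorem d_mul_pr {a : V} (ha : a ∈ S.R) : D.d a * pr S a D.θs = pr S D.θs a := by
  have h1 := two_mul_form ha D.θs
  have h2 := two_mul_form D.mem a
  rw [D.norm a ha] at h1
  rw [S.symm, h1] at h2
  have := (norm_pos D.mem).ne'
  field_simp at h2
  linarith

theorem cnt_affine (μ : V) (m : ℝ) :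
    cnt D.vec (rf S D.θs μ - D.θs, m + pr S D.θs μ + 1) = - cnt D.vec (μ, m) := by
  have hθP := D.θs_pos
  have hnP := neg_notMem_pos hθP
  have hn := neg_mem D.mem
  choose! k hk using fun a (ha : a ∈ S.R) => pr_int ha D.mem
  have e0 : D.vec (Sum.inl (⟨-D.θs, hn⟩, 0)) = (-D.θs, 1) := by
    rw [vec_inl]; simp [eps_neg hnP, D.d_neg D.mem, D.d_θs]
  have hrr : ∀ x, pr S D.θs (rf S D.θs x) = - pr S D.θs x := fun x => by
    rw [rf_apply]; simp [pr_self D.mem]; ring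
  have hrm := fun {a : V} (ha : a ∈ S.R) => rf_mem D.mem ha
  have := D.cnt_vec_anti (g := fun a => ⟨rf S D.θs a, rf_mem D.mem a.2⟩) (k := fun a => k a)
    (i₀ := (⟨-D.θs, hn⟩, 0)) (fun a => Subtype.ext (rf_rf D.mem _)) ?_ ?_ ?_
    D.affHom ?_ ?_ ?_ ?_ ?_ (μ, m)
  · rw [e0, affHom_apply] at this
    simpa [sub_eq_add_neg] using this
  · rintro ⟨a, ha⟩
    have h1 : D.d a * pr S (rf S D.θs a) D.θs = - (D.d a * pr S a D.θs) := by
      rw [D.d_mul_pr ha, ← hrr a, ← D.d_mul_pr (hrm ha), D.d_rf ha D.mem]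
    have h2 : (D.d a : ℝ) ≠ 0 := by
      have := D.d_pos ha
      positivity
    have h3 : pr S (rf S D.θs a) D.θs = - pr S a D.θs := by
      apply mul_left_cancel₀ h2; linarith
    rw [hk _ (hrm ha), hk _ ha] at h3
    exact_mod_cast h3
  · rintro ⟨⟨a, ha⟩, n⟩ hi
    simp only
    have hka := hk a ha
    have hle := eps_le (B := B) (rf S D.θs a)
    by_cases h1 : a = D.θs
    · subst h1
      rw [pr_self ha] at hka
      have : k D.θs = 2 := by exact_mod_cast hka.symm
      omega
    by_cases h2 : a = -D.θs
    · subst h2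
      rw [pr_neg_left, pr_self D.mem] at hka
      have : k (-D.θs) = -2 := by
        have : (k (-D.θs) : ℝ) = -2 := hka.symm
        exact_mod_cast this
      have hn0 : n ≠ 0 := by rintro rfl; exact hi rfl
      have : rf S D.θs (-D.θs) = D.θs := by rw [map_neg, rf_self D.mem, neg_neg]
      rw [this, eps_pos hθP, eps_neg hnP]
      omega
    have hdk := D.d_mul_pr ha
    have hd0 : (0 : ℝ) < D.d a := by exact_mod_cast D.d_pos ha
    obtain ⟨j, hj', hj1, hj2⟩ := D.pr_θs ha h1 h2
    have hj : j = -1 ∨ j = 0 ∨ j = 1 := by omega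
    have hkj : k a = j := by rw [hka] at hj'; exact_mod_cast hj'
    rw [hkj]
    have hform := two_mul_form D.mem a
    have hnp := norm_pos D.mem
    rw [← hdk, hj'] at hform
    rcases hj with rfl | rfl | rfl
    · have h3 : S.I D.θs a < 0 := by
        push_cast at hform
        nlinarith [mul_pos hd0 hnp]
      have h4 : a ∉ B.Pos := fun hp => absurd (D.θs_form_nonneg hp) (not_le.mpr h3)
      have h5 : rf S D.θs a ∈ B.Pos := by
        refine D.pos_of_form_pos (hrm ha) ?_
        have h6 := two_mul_form D.mem (rf S D.θs a)
        rw [hrr] at h6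
        have h7 := two_mul_form D.mem a
        nlinarith
      rw [eps_neg h4, eps_pos h5]
      omega
    · have h3 : rf S D.θs a = a := by
        rw [rf_apply, ← hdk, hj']; simp
      rw [h3]; omega
    · omega
  · have h1 : k (-D.θs) = -2 := by
      have h2 := hk _ hn
      rw [pr_neg_left, pr_self D.mem] at h2
      have : (k (-D.θs) : ℝ) = -2 := h2.symm
      exact_mod_cast this
    have : rf S D.θs (-D.θs) = D.θs := by rw [map_neg, rf_self D.mem, neg_neg]
    simp only
    rw [this, eps_pos hθP, eps_neg hnP, h1]
    norm_num
  · intro x y h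
    have h1 := congrArg D.affHom h
    simp only [affHom_apply, rf_rf D.mem, hrr] at h1
    simpa [Prod.ext_iff] using h1
  · exact fun a => D.d_rf a.2 D.mem
  · intro m; simp [affHom_apply]
  · intro a m
    rw [affHom_apply, ← hk _ a.2, D.d_mul_pr a.2]
  · rw [e0, affHom_apply]
    ext1
    · simp [rf_self D.mem]
    · simp [pr_self D.mem]; norm_num

end Datum

end TwistedMacdonald

namespace TwistedMacdonald

namespace Datum

variable {V : Type} [AddCommGroup V] [Module ℝ V] {S : RootSys V} {B : Base S} (D : Datum B)

theorem eq_zero_of_pr_simple {x : V} (h : ∀ b ∈ B.Pi, pr S b x = 0) : x = 0 := by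
  by_contra hx
  have h1 := S.posdef x hx
  have h2 : S.I x x = 0 := by
    conv_lhs => enter [1]; rw [sum_crd B x]
    rw [map_sum, LinearMap.sum_apply]
    refine Finset.sum_eq_zero fun b _ => ?_
    have := two_mul_form (Pi_sub B b.2) x
    rw [h b b.2] at this
    rw [map_smul, LinearMap.smul_apply, smul_eq_mul]
    have : S.I (b : V) x = 0 := by linarith
    rw [this, mul_zero]
  exact h1.ne' h2

include D in
theorem pr_sq_le {a : V} (ha : a ∈ S.R) (x : V) : pr S a x ^ 2 * S.I a a ≤ 4 * D.h * S.I x x := by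
  have h1 := D.casimir_eq x x
  rw [casimir_apply] at h1
  have h2 : ∀ a ∈ S.R, S.I a x * pr S a x = pr S a x ^ 2 * S.I a a / 2 := fun a ha => by
    have := two_mul_form ha x
    linear_combination (pr S a x) / 2 * this
  have h3 := Finset.single_le_sum (f := fun a => S.I a x * pr S a x) (fun a ha => by
    have := norm_pos ha
    simp only [h2 a ha]
    positivity) ha
  simp only [h2 a ha] at h3
  linarith

include D in
theorem finite_norm (K : ℝ) :
    {x : V | x - weylVec B ∈ rootLat S ∧ S.I x x = K}.Finite := by
  obtain ⟨X, hX⟩ : ∃ X : ℕ, ∀ b : {b // b ∈ B.Pi}, 4 * D.h * K / S.I (b : V) b ≤ X := by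
    refine ⟨∑ b : {b // b ∈ B.Pi}, ⌈4 * D.h * K / S.I (b : V) b⌉₊, fun b => ?_⟩
    refine (Nat.le_ceil _).trans ?_
    exact_mod_cast Finset.single_le_sum
      (f := fun b : {b // b ∈ B.Pi} => ⌈4 * D.h * K / S.I (b : V) b⌉₊)
      (fun _ _ => Nat.zero_le _) (Finset.mem_univ b)
  let F : V → {b // b ∈ B.Pi} → ℝ := fun x b => pr S b x
  have hF : Function.Injective F := fun x y h => by
    refine sub_eq_zero.mp (eq_zero_of_pr_simple (S := S) (B := B) fun b hb => ?_)
    rw [map_sub, sub_eq_zero]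
    exact congrFun h ⟨b, hb⟩
  refine Set.Finite.of_finite_image (f := F) ?_ hF.injOn
  refine (Set.Finite.pi' (t := fun _ => (fun z : ℤ => (z : ℝ)) '' Set.Icc (-X : ℤ) X)
    fun _ => (Set.finite_Icc _ _).image _).subset ?_
  rintro _ ⟨x, ⟨hx, hK⟩, rfl⟩ b
  obtain ⟨n, hn⟩ := pr_int_lat (Pi_sub B b.2) hx
  rw [map_sub, pr_weylVec b.2, sub_eq_iff_eq_add] at hn
  have e : F x b = ((n + 1 : ℤ) : ℝ) := by push_cast; exact hn
  refine ⟨n + 1, ?_, e.symm⟩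
  have h1 := D.pr_sq_le (Pi_sub B b.2) x
  have h2 := norm_pos (Pi_sub B b.2)
  rw [← le_div_iff₀ h2, hK] at h1
  have h3 : ((n + 1 : ℤ) : ℝ) ^ 2 ≤ X := by rw [← e]; exact h1.trans (hX b)
  have h4 : (n + 1) ^ 2 ≤ (X : ℤ) := by exact_mod_cast h3
  rw [Set.mem_Icc]
  constructor <;> nlinarith [Int.natCast_nonneg X]

/-- Functions anti-invariant under the affine simple reflections and supported on finitely many
points of each nonnegative integral degree. -/
structure Anti (g : V → ℝ → ℝ) : Prop where
  simple : ∀ b ∈ B.Pi, ∀ l m, g (rf S b l) m = - g l m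
  affine : ∀ l m, g (rf S D.θs l + D.h • D.θs) (m + D.h - pr S D.θs l) = - g l m
  lat : ∀ l m, g l m ≠ 0 → l - weylVec B ∈ rootLat S
  nat : ∀ l m, g l m ≠ 0 → ∃ n : ℕ, m = n
  fin : ∀ m, {l | g l m ≠ 0}.Finite

namespace Anti

variable {D} {g g' : V → ℝ → ℝ}

theorem add (hg : D.Anti g) (hg' : D.Anti g') : D.Anti (fun l m => g l m + g' l m) := by
  have key : ∀ l m, g l m + g' l m ≠ 0 → g l m ≠ 0 ∨ g' l m ≠ 0 := fun l m h => by
    by_contra hc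
    push Not at hc
    rw [hc.1, hc.2, add_zero] at h
    exact h rfl
  refine ⟨fun b hb l m => ?_, fun l m => ?_, fun l m h => ?_, fun l m h => ?_, fun m => ?_⟩
  · rw [hg.simple b hb, hg'.simple b hb, neg_add]
  · rw [hg.affine, hg'.affine, neg_add]
  · exact (key l m h).elim (hg.lat l m) (hg'.lat l m)
  · exact (key l m h).elim (hg.nat l m) (hg'.nat l m)
  · exact ((hg.fin m).union (hg'.fin m)).subset fun l h => key l m h

theorem smul (hg : D.Anti g) (c : ℝ) : D.Anti (fun l m => c * g l m) := by
  have key : ∀ l m, c * g l m ≠ 0 → g l m ≠ 0 := fun l m h => right_ne_zero_of_mul h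
  refine ⟨fun b hb l m => ?_, fun l m => ?_, fun l m h => ?_, fun l m h => ?_, fun m => ?_⟩
  · rw [hg.simple b hb, mul_neg]
  · rw [hg.affine, mul_neg]
  · exact hg.lat l m (key l m h)
  · exact hg.nat l m (key l m h)
  · exact (hg.fin m).subset fun l h => key l m h

theorem shift (hg : D.Anti g) (k : ℕ) : D.Anti (fun l m => g l (m - k)) := by
  refine ⟨fun b hb l m => ?_, fun l m => ?_, fun l m h => ?_, fun l m h => ?_, fun m => ?_⟩
  · exact hg.simple b hb _ _
  · rw [← hg.affine]; congr 1; ring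
  · exact hg.lat l _ h
  · obtain ⟨n, hn⟩ := hg.nat l _ h
    exact ⟨n + k, by push_cast; linarith⟩
  · exact hg.fin _

theorem eq_zero (hg : D.Anti g) {N : ℕ} (h0 : ∀ n : ℕ, n ≤ N → g (weylVec B) n = 0) (n : ℕ)
    (hn : n ≤ N) (l : V) : g l n = 0 := by
  induction n using Nat.strong_induction_on generalizing l with
  | _ n ih =>
  by_contra hl
  have hnz : ∀ y : ℝ, ¬ (y = -y ∧ y ≠ 0) := fun y hy => hy.2 (by linarith)
  obtain ⟨x, hx, hmax⟩ := Set.exists_max_image _ (fun x => S.I (weylVec B) x) (hg.fin n) ⟨l, hl⟩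
  have hx' : g x n ≠ 0 := hx
  have hlat := hg.lat x n hx'
  have hdom : ∀ b ∈ B.Pi, 0 ≤ S.I (x - weylVec B) b := by
    intro b hb
    have hbR := Pi_sub B hb
    obtain ⟨k, hk⟩ := pr_int_lat hbR hlat
    have hbn := norm_pos hbR
    have h1 := two_mul_form hbR (x - weylVec B)
    have hr := hmax (rf S b x) (by
      change g _ _ ≠ 0
      rw [hg.simple b hb]; exact neg_ne_zero.mpr hx')
    rw [rf_apply, map_sub, map_smul, smul_eq_mul] at hr
    have hρb := form_weylVec_simple hb
    have h2 : 0 ≤ pr S b x := by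
      by_contra hc
      nlinarith
    have h3 : pr S b x ≠ 0 := fun h3 => by
      refine hnz (g x n) ⟨?_, hx'⟩
      rw [← hg.simple b hb, rf_apply, h3, zero_smul, sub_zero]
    rw [map_sub, pr_weylVec hb] at hk
    have h4 : (0 : ℝ) ≤ k := by
      have h5 : ((-1 : ℤ) : ℝ) < k := by
        push_cast
        have := lt_of_le_of_ne h2 h3.symm
        linarith
      have h6 : -1 < k := by exact_mod_cast h5
      exact_mod_cast (by omega : 0 ≤ k)
    rw [map_sub (pr S b), pr_weylVec hb, hk, S.symm] at h1
    nlinarith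
  have hθ : S.I (x - weylVec B) D.θs ≤ 0 := by
    obtain ⟨k, hk⟩ := pr_int_lat D.mem hlat
    have hθn := norm_pos D.mem
    have h1 := two_mul_form D.mem (x - weylVec B)
    have hne := neg_ne_zero.mpr hx'
    rw [← hg.affine] at hne
    obtain ⟨n', hn'⟩ := hg.nat _ _ hne
    have hh : D.h = 1 + pr S D.θs (weylVec B) := rfl
    have hle : n ≤ n' := by
      by_contra hc
      push Not at hc
      rw [hn'] at hne
      exact hne (ih n' hc (by omega) _)
    have hle' : (n : ℝ) ≤ n' := by exact_mod_cast hle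
    have h3 : D.h - pr S D.θs x ≠ 0 := fun h3 => by
      refine hnz (g x n) ⟨?_, hx'⟩
      have e1 : rf S D.θs x + D.h • D.θs = x := by
        rw [rf_apply, sub_eq_zero.mp h3]; simp
      have := hg.affine x n
      rw [e1, add_sub_assoc, h3, add_zero] at this
      exact this
    rw [map_sub] at hk
    have h4 : (k : ℝ) ≤ 0 := by
      have h5 : (k : ℝ) < ((1 : ℤ) : ℝ) := by
        push_cast
        have : 0 < D.h - pr S D.θs x := lt_of_le_of_ne (by linarith) h3.symm
        linarith
      have h6 : k < 1 := by exact_mod_cast h5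
      exact_mod_cast (by omega : k ≤ 0)
    rw [map_sub (pr S D.θs), hk, S.symm] at h1
    nlinarith
  have h0' := D.eq_zero_of_form hdom hθ
  rw [sub_eq_zero.mp h0'] at hx'
  exact hx' (h0 n hn)

end Anti

section Theta

variable (hW : (Weyl S : Set (V ≃ₗ[ℝ] V)).Finite)

/-- The set of `(u, λ, m)` with `λ ∈ u(ρ + hQ)` of norm `|ρ|² + h|θs|²m`. -/
def cond (u : V ≃ₗ[ℝ] V) (l : V) (m : ℝ) : Prop :=
  (∃ y ∈ rootLat S, l = u (weylVec B + D.h • y)) ∧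
    S.I l l = S.I (weylVec B) (weylVec B) + D.h * S.I D.θs D.θs * m

/-- The coefficients of the alternating theta sum. -/
noncomputable def theta (l : V) (m : ℝ) : ℝ :=
  ∑ u ∈ hW.toFinset, LinearMap.det ((u : V ≃ₗ[ℝ] V) : V →ₗ[ℝ] V) * if D.cond u l m then 1 else 0

theorem cond_simple {u : V ≃ₗ[ℝ] V} {a : V} (ha : a ∈ S.R) {l : V} {m : ℝ} (h : D.cond u l m) :
    D.cond (rfE ha * u) (rf S a l) m := by
  obtain ⟨⟨y, hy, rfl⟩, h2⟩ := h
  exact ⟨⟨y, hy, by rw [LinearEquiv.mul_apply, rfE_apply]⟩, by rw [form_rf_rf ha, h2]⟩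

theorem cond_simple_iff {u : V ≃ₗ[ℝ] V} {a : V} (ha : a ∈ S.R) {l : V} {m : ℝ} :
    D.cond (rfE ha * u) (rf S a l) m ↔ D.cond u l m := by
  refine ⟨fun h => ?_, D.cond_simple ha⟩
  have := D.cond_simple ha h
  rwa [rf_rf ha, ← mul_assoc, rfE_mul_self, one_mul] at this

theorem cond_affine {u : V ≃ₗ[ℝ] V} (hu : u ∈ Weyl S) {l : V} {m : ℝ} (h : D.cond u l m) :
    D.cond (rfE D.mem * u) (rf S D.θs l + D.h • D.θs) (m + D.h - pr S D.θs l) := by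
  obtain ⟨⟨y, hy, rfl⟩, h2⟩ := h
  have hθ : u⁻¹ D.θs ∈ rootLat S := AddSubgroup.subset_closure (weyl_mem_R (inv_mem hu) D.mem)
  refine ⟨⟨y - u⁻¹ D.θs, AddSubgroup.sub_mem _ hy hθ, ?_⟩, ?_⟩
  · have e : u (u⁻¹ D.θs) = D.θs := by
      rw [← LinearEquiv.mul_apply, mul_inv_cancel]; rfl
    rw [LinearEquiv.mul_apply, rfE_apply, smul_sub, ← add_sub_assoc, map_sub u, map_smul u, e,
      map_sub (rf S D.θs), map_smul, rf_self D.mem]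
    module
  · have h3 := two_mul_form D.mem (u (weylVec B + D.h • y))
    have h4 := form_rf D.mem (u (weylVec B + D.h • y)) D.θs
    rw [rf_self D.mem] at h4
    have h5 := S.symm (rf S D.θs (u (weylVec B + D.h • y))) D.θs
    have h6 := S.symm (u (weylVec B + D.h • y)) D.θs
    simp only [map_add, LinearMap.add_apply, map_smul, LinearMap.smul_apply, smul_eq_mul,
      map_neg] at *
    have h7 := form_rf_rf D.mem (u (weylVec B) + D.h • u y) (u (weylVec B) + D.h • u y)
    simp only [map_add, LinearMap.add_apply, map_smul, LinearMap.smul_apply, smul_eq_mul] at h7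
    linear_combination h7 + h2 - D.h * h3 + 2 * D.h * h4 - 2 * D.h * h6 - D.h * h5

theorem cond_affine_iff {u : V ≃ₗ[ℝ] V} (hu : u ∈ Weyl S) {l : V} {m : ℝ} :
    D.cond (rfE D.mem * u) (rf S D.θs l + D.h • D.θs) (m + D.h - pr S D.θs l) ↔ D.cond u l m := by
  refine ⟨fun h => ?_, D.cond_affine hu⟩
  have := D.cond_affine (mul_mem (rfE_mem D.mem) hu) h
  rw [← mul_assoc, rfE_mul_self, one_mul] at this
  convert this using 1
  · rw [map_add, rf_rf D.mem, map_smul, rf_self D.mem]; module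
  · rw [map_add, map_smul, pr_self D.mem, rf_apply, map_sub, map_smul, pr_self D.mem, smul_eq_mul,
      smul_eq_mul]
    ring

variable [FiniteDimensional ℝ V]

theorem theta_reflect {a : V} (ha : a ∈ S.R) {l l' : V} {m m' : ℝ}
    (h : ∀ u ∈ Weyl S, D.cond (rfE ha * u) l' m' ↔ D.cond u l m) :
    D.theta hW l' m' = - D.theta hW l m := by
  rw [theta, theta, ← Finset.sum_neg_distrib]
  symm
  refine Finset.sum_nbij' (fun u => rfE ha * u) (fun u => rfE ha * u) ?_ ?_ ?_ ?_ ?_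
  · intro u hu
    simp only [Set.Finite.mem_toFinset, SetLike.mem_coe] at hu ⊢
    exact mul_mem (rfE_mem ha) hu
  · intro u hu
    simp only [Set.Finite.mem_toFinset, SetLike.mem_coe] at hu ⊢
    exact mul_mem (rfE_mem ha) hu
  · intro u _; simp only [← mul_assoc, rfE_mul_self, one_mul]
  · intro u _; simp only [← mul_assoc, rfE_mul_self, one_mul]
  · intro u hu
    simp only [Set.Finite.mem_toFinset, SetLike.mem_coe] at hu
    have e : LinearMap.det (((rfE ha * u : V ≃ₗ[ℝ] V)) : V →ₗ[ℝ] V) =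
        - LinearMap.det (u : V →ₗ[ℝ] V) := by
      have : ((rfE ha * u : V ≃ₗ[ℝ] V) : V →ₗ[ℝ] V) =
        ((rfE ha : V ≃ₗ[ℝ] V) : V →ₗ[ℝ] V) * (u : V →ₗ[ℝ] V) := rfl
      rw [this, map_mul, det_rfE, neg_one_mul]
    rw [e, neg_mul]
    simp only [h u hu]

omit [FiniteDimensional ℝ V] in
theorem exists_cond_of_theta {l : V} {m : ℝ} (h : D.theta hW l m ≠ 0) :
    ∃ u ∈ Weyl S, D.cond u l m := by
  obtain ⟨u, hu, h1⟩ := Finset.exists_ne_zero_of_sum_ne_zero h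
  simp only [Set.Finite.mem_toFinset, SetLike.mem_coe] at hu
  refine ⟨u, hu, ?_⟩
  by_contra hc
  simp [hc] at h1

omit [FiniteDimensional ℝ V] in
theorem cond_lat {u : V ≃ₗ[ℝ] V} (hu : u ∈ Weyl S) {l : V} {m : ℝ} (h : D.cond u l m) :
    l - weylVec B ∈ rootLat S := by
  obtain ⟨⟨y, hy, rfl⟩, -⟩ := h
  obtain ⟨k, hk⟩ := D.h_int
  rw [map_add, map_smul, hk, add_sub_right_comm, Int.cast_smul_eq_zsmul]
  exact AddSubgroup.add_mem _ (weyl_weylVec_sub hu) (AddSubgroup.zsmul_mem _ (weyl_lat hu hy) k)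

theorem anti_theta : D.Anti (D.theta hW) := by
  refine ⟨fun b hb l m => ?_, fun l m => ?_, fun l m h => ?_, fun l m h => ?_, fun m => ?_⟩
  · exact D.theta_reflect hW (Pi_sub B hb) fun u _ => D.cond_simple_iff _
  · exact D.theta_reflect hW D.mem fun u hu => D.cond_affine_iff hu
  · obtain ⟨u, hu, h⟩ := D.exists_cond_of_theta hW h
    exact D.cond_lat hu h
  · obtain ⟨u, hu, ⟨y, hy, rfl⟩, h2⟩ := D.exists_cond_of_theta hW h
    obtain ⟨k, hk⟩ := D.norm_shift_nat hy
    refine ⟨k, ?_⟩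
    rw [weyl_form hu] at h2
    have h3 := D.h_pos
    have h4 := norm_pos D.mem
    have h5 : D.h * S.I D.θs D.θs ≠ 0 := by positivity
    apply mul_left_cancel₀ h5
    linarith
  · refine (D.finite_norm (S.I (weylVec B) (weylVec B) + D.h * S.I D.θs D.θs * m)).subset ?_
    intro l h
    obtain ⟨u, hu, h⟩ := D.exists_cond_of_theta hW h
    exact ⟨D.cond_lat hu h, h.2⟩

omit [FiniteDimensional ℝ V] in
theorem theta_weylVec (m : ℝ) : D.theta hW (weylVec B) m = if m = 0 then 1 else 0 := by
  have h5 : D.h * S.I D.θs D.θs ≠ 0 := (mul_pos D.h_pos (norm_pos D.mem)).ne'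
  rw [theta, Finset.sum_eq_single 1]
  · have : D.cond 1 (weylVec B) m ↔ m = 0 := by
      constructor
      · rintro ⟨-, h2⟩
        have : D.h * S.I D.θs D.θs * m = 0 := by linarith
        exact (mul_eq_zero.mp this).resolve_left h5
      · rintro rfl
        exact ⟨⟨0, AddSubgroup.zero_mem _, by simp⟩, by simp⟩
    have e : ((1 : V ≃ₗ[ℝ] V) : V →ₗ[ℝ] V) = LinearMap.id := rfl
    simp only [this, e, LinearMap.det_id, one_mul]
  · intro u hu hne
    simp only [Set.Finite.mem_toFinset, SetLike.mem_coe] at hu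
    rw [if_neg, mul_zero]
    rintro ⟨⟨y, hy, h⟩, -⟩
    refine hne (inv_eq_one.mp (D.weyl_free (inv_mem hu) hy ?_))
    conv_lhs => rw [h]
    rw [← LinearEquiv.mul_apply, inv_mul_cancel]; rfl
  · intro h
    exact absurd (by simp [one_mem]) h

end Theta

end Datum

end TwistedMacdonald

namespace TwistedMacdonald

section SignedCount

variable {J J' G : Type*} [AddCommGroup G]

theorem cnt_comp_equiv (e : J ≃ J') (v : J' → G) (x : G) : cnt (v ∘ e) x = cnt v x := by
  have hiff : ∀ T : Finset J, ∑ i ∈ T, (v ∘ e) i = x ↔ ∑ i ∈ e.finsetCongr T, v i = x := fun T => by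
    rw [Equiv.finsetCongr_apply, Finset.sum_map]; rfl
  rw [cnt, cnt, ← (e.finsetCongr.subtypeEquiv hiff).tsum_eq]
  refine tsum_congr fun T => ?_
  simp

theorem cnt_eq {v : J → G} {x : G} (F : Finset J) (hF : ∀ T : Finset J, ∑ i ∈ T, v i = x → T ⊆ F) :
    cnt v x = ∑ T ∈ F.powerset, if ∑ i ∈ T, v i = x then (-1 : ℝ) ^ T.card else 0 := by
  have hiff : ∀ T : Finset J, ∑ i ∈ T, v i = x ↔ T ∈ F.powerset.filter fun T => ∑ i ∈ T, v i = x :=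
    fun T => by
      rw [Finset.mem_filter, Finset.mem_powerset]
      exact ⟨fun h => ⟨hF T h, h⟩, fun h => h.2⟩
  rw [cnt, ← Finset.sum_filter, ← Finset.tsum_subtype]
  exact (Equiv.subtypeEquivRight hiff).tsum_eq (fun T => (-1 : ℝ) ^ T.1.card)

theorem exists_of_cnt_ne_zero {v : J → G} {x : G} (h : cnt v x ≠ 0) :
    ∃ T : Finset J, ∑ i ∈ T, v i = x := by
  by_contra hc
  push Not at hc
  have : IsEmpty {T : Finset J // ∑ i ∈ T, v i = x} := ⟨fun T => hc _ T.2⟩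
  exact h (by rw [cnt, tsum_empty])

theorem cnt_sum_elim {A : Type*} [Fintype A] (w : A → G) (v : J → G) (x : G) (F : Finset J)
    (hF : ∀ (U : Finset A) (T : Finset J), ∑ a ∈ U, w a + ∑ i ∈ T, v i = x → T ⊆ F) :
    cnt (Sum.elim w v) x = ∑ U : Finset A, (-1 : ℝ) ^ U.card * cnt v (x - ∑ a ∈ U, w a) := by
  have hs : ∀ (U : Finset A) (T : Finset J), ∑ i ∈ U.disjSum T, Sum.elim w v i =
      ∑ a ∈ U, w a + ∑ i ∈ T, v i := fun U T => by simp [Finset.sum_disjSum]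
  rw [cnt_eq (Finset.univ.disjSum F)]
  · have h2 : ∀ U : Finset A, cnt v (x - ∑ a ∈ U, w a) = _ := fun U => cnt_eq F fun T hT =>
      hF U T (by rw [hT]; abel)
    simp only [h2, Finset.mul_sum]
    rw [← Finset.sum_product' (f := fun (U : Finset A) (T : Finset J) =>
      (-1 : ℝ) ^ U.card * if ∑ i ∈ T, v i = x - ∑ a ∈ U, w a then (-1 : ℝ) ^ T.card else 0)]
    symm
    refine Finset.sum_nbij' (fun p => p.1.disjSum p.2) (fun W => (W.toLeft, W.toRight)) ?_ ?_ ?_ ?_ ?_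
    · rintro ⟨U, T⟩ h
      simp only [Finset.mem_product, Finset.mem_univ, true_and, Finset.mem_powerset] at h ⊢
      exact Finset.disjSum_mono (Finset.subset_univ _) h
    · intro W h
      simp only [Finset.mem_product, Finset.mem_univ, true_and, Finset.mem_powerset] at h ⊢
      intro i hi
      simpa using h (Finset.mem_toRight.mp hi)
    · rintro ⟨U, T⟩ _; simp
    · intro W _; exact Finset.toLeft_disjSum_toRight
    · rintro ⟨U, T⟩ _
      simp only [hs, Finset.card_disjSum, pow_add, eq_sub_iff_add_eq']
      split_ifs <;> simp
  · intro W hW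
    rw [← Finset.toLeft_disjSum_toRight (u := W)] at hW ⊢
    rw [hs] at hW
    exact Finset.disjSum_mono (Finset.subset_univ _) (hF _ _ hW)

theorem subset_of_sum_le {v : J → G} (deg : G →+ ℝ) (hv : ∀ i, 0 ≤ deg (v i)) {N : ℝ}
    {F : Finset J} (hF : ∀ i, deg (v i) ≤ N → i ∈ F) {T : Finset J}
    (hT : deg (∑ i ∈ T, v i) ≤ N) : T ⊆ F := fun i hi => by
  refine hF i (le_trans ?_ hT)
  rw [map_sum]
  exact Finset.single_le_sum (f := fun i => deg (v i)) (fun i _ => hv i) hi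

end SignedCount

namespace Datum

variable {V : Type} [AddCommGroup V] [Module ℝ V] {S : RootSys V} {B : Base S} (D : Datum B)

/-- The positive affine roots of positive degree. -/
noncomputable def vecP : Idx B → V × ℝ :=
  Sum.elim (fun i => (i.1, D.d i.1 * (i.2 + 1))) (fun i => (0, D.d i.1 * (i.2 + 1)))

theorem vecP_inl (a : {a // a ∈ S.R}) (n : ℕ) :
    D.vecP (Sum.inl (a, n)) = ((a : V), (D.d a * (n + 1) : ℝ)) := rfl

theorem vecP_inr (b : {b // b ∈ B.Pi}) (n : ℕ) :
    D.vecP (Sum.inr (b, n)) = ((0 : V), (D.d b * (n + 1) : ℝ)) := rfl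

/-- The indices of level at most `N`. -/
noncomputable def upTo (B : Base S) (N : ℕ) : Finset (Idx B) :=
  (Finset.univ ×ˢ Finset.range (N + 1)).disjSum (Finset.univ ×ˢ Finset.range (N + 1))

theorem inl_mem_upTo {N : ℕ} {a : {a // a ∈ S.R}} {n : ℕ} :
    (Sum.inl (a, n) : Idx B) ∈ upTo B N ↔ n ≤ N := by
  simp [upTo]

theorem inr_mem_upTo {N : ℕ} {b : {b // b ∈ B.Pi}} {n : ℕ} :
    (Sum.inr (b, n) : Idx B) ∈ upTo B N ↔ n ≤ N := by
  simp [upTo]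

theorem one_le_d {a : V} (ha : a ∈ S.R) : (1 : ℝ) ≤ D.d a := by exact_mod_cast D.d_pos ha

theorem vec_deg_nonneg (i : Idx B) : 0 ≤ (D.vec i).2 := by
  rcases i with ⟨a, n⟩ | ⟨b, n⟩
  · rw [vec_inl]; positivity
  · rw [vec_inr]; positivity

theorem one_le_vecP_deg (i : Idx B) : 1 ≤ (D.vecP i).2 := by
  rcases i with ⟨a, n⟩ | ⟨b, n⟩
  · rw [vecP_inl]
    have := D.one_le_d a.2
    have h : (0 : ℝ) ≤ n := n.cast_nonneg
    simp only; nlinarith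
  · rw [vecP_inr]
    have := D.one_le_d (Pi_sub B b.2)
    have h : (0 : ℝ) ≤ n := n.cast_nonneg
    simp only; nlinarith

theorem mem_upTo_of_vec {N : ℕ} (i : Idx B) (h : (D.vec i).2 ≤ N) : i ∈ upTo B N := by
  rcases i with ⟨a, n⟩ | ⟨b, n⟩
  · rw [inl_mem_upTo]
    rw [vec_inl] at h
    have h1 := D.one_le_d a.2
    have h2 : (0 : ℝ) ≤ n + eps B a := by positivity
    have h3 : (0 : ℝ) ≤ eps B a := by positivity
    have : (n : ℝ) ≤ N := by simp only at h; nlinarith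
    exact_mod_cast this
  · rw [inr_mem_upTo]
    rw [vec_inr] at h
    have h1 := D.one_le_d (Pi_sub B b.2)
    have h2 : (0 : ℝ) ≤ n + 1 := by positivity
    have : (n : ℝ) ≤ N := by simp only at h; nlinarith
    exact_mod_cast this

theorem mem_upTo_of_vecP {N : ℕ} (i : Idx B) (h : (D.vecP i).2 ≤ N) : i ∈ upTo B N := by
  rcases i with ⟨a, n⟩ | ⟨b, n⟩
  · rw [inl_mem_upTo]
    rw [vecP_inl] at h
    have h1 := D.one_le_d a.2
    have h2 : (0 : ℝ) ≤ n + 1 := by positivity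
    have : (n : ℝ) ≤ N := by simp only at h; nlinarith
    exact_mod_cast this
  · exact D.mem_upTo_of_vec _ h

theorem subset_upTo {N : ℕ} {T : Finset (Idx B)} (hT : (∑ i ∈ T, D.vec i).2 ≤ N) : T ⊆ upTo B N :=
  subset_of_sum_le (AddMonoidHom.snd V ℝ) D.vec_deg_nonneg D.mem_upTo_of_vec hT

theorem subset_upTo_vecP {N : ℕ} {T : Finset (Idx B)} (hT : (∑ i ∈ T, D.vecP i).2 ≤ N) :
    T ⊆ upTo B N :=
  subset_of_sum_le (AddMonoidHom.snd V ℝ) (fun i => zero_le_one.trans (D.one_le_vecP_deg i))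
    D.mem_upTo_of_vecP hT

theorem vec_mem_lat (i : Idx B) : (D.vec i).1 ∈ rootLat S ∧ ∃ n : ℕ, (D.vec i).2 = n := by
  rcases i with ⟨a, n⟩ | ⟨b, n⟩
  · rw [vec_inl]
    exact ⟨AddSubgroup.subset_closure a.2, D.d a * (n + eps B a), by push_cast; rfl⟩
  · rw [vec_inr]
    exact ⟨AddSubgroup.zero_mem _, D.d b * (n + 1), by push_cast; rfl⟩

theorem sum_vec_lat (T : Finset (Idx B)) :
    (∑ i ∈ T, D.vec i).1 ∈ rootLat S ∧ ∃ n : ℕ, (∑ i ∈ T, D.vec i).2 = n := by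
  rw [Prod.fst_sum, Prod.snd_sum]
  refine ⟨AddSubgroup.sum_mem _ fun i _ => (D.vec_mem_lat i).1, ?_⟩
  choose n hn using fun i => (D.vec_mem_lat i).2
  exact ⟨∑ i ∈ T, n i, by push_cast; exact Finset.sum_congr rfl fun i _ => hn i⟩

/-- The coefficients of the affine denominator. -/
noncomputable def den (l : V) (m : ℝ) : ℝ := cnt D.vec (weylVec B - l, m)

theorem anti_den : D.Anti D.den := by
  refine ⟨fun b hb l m => ?_, fun l m => ?_, fun l m h => ?_, fun l m h => ?_, fun m => ?_⟩
  · rw [den, den, ← D.cnt_simple hb, map_sub, rf_apply (S := S) b (weylVec B), pr_weylVec hb]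
    congr 2; module
  · rw [den, den, ← D.cnt_affine, map_sub, map_sub, rf_apply (S := S) D.θs (weylVec B)]
    have e : pr S D.θs (weylVec B) = D.h - 1 := by rw [h]; ring
    rw [e]
    congr 2
    · module
    · ring
  · obtain ⟨T, hT⟩ := exists_of_cnt_ne_zero h
    have := (D.sum_vec_lat T).1
    rw [hT] at this
    rw [← neg_sub]; exact AddSubgroup.neg_mem _ this
  · obtain ⟨T, hT⟩ := exists_of_cnt_ne_zero h
    have := (D.sum_vec_lat T).2
    rwa [hT] at this
  · obtain ⟨N, hN⟩ := exists_nat_ge m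
    refine (((upTo B N).powerset.image fun T => weylVec B - (∑ i ∈ T, D.vec i).1).finite_toSet).subset
      fun l h => ?_
    obtain ⟨T, hT⟩ := exists_of_cnt_ne_zero h
    rw [Finset.mem_coe, Finset.mem_image]
    exact ⟨T, Finset.mem_powerset.mpr (D.subset_upTo (by rw [hT]; exact hN)), by rw [hT]; simp⟩

/-- Splitting off the positive finite roots from the positive affine roots. -/
noncomputable def split (B : Base S) : {a // a ∈ B.Pos} ⊕ Idx B → Idx B :=
  Sum.elim (fun a => Sum.inl (⟨a, B.pos_sub a.2⟩, 0))
    (Sum.map (fun i => (i.1, i.2 + 1 - eps B i.1)) id)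

theorem split_bijective : Function.Bijective (split B) := by
  constructor
  · rintro (⟨a, ha⟩ | ⟨⟨a, ha⟩, n⟩ | i) (⟨a', ha'⟩ | ⟨⟨a', ha'⟩, n'⟩ | i') h <;>
      simp [split] at h ⊢
    · exact h
    · obtain ⟨rfl, h⟩ := h
      rw [eps_pos ha] at h; omega
    · obtain ⟨rfl, h⟩ := h
      rw [eps_pos ha'] at h; omega
    · obtain ⟨rfl, h⟩ := h
      have := eps_le (B := B) a
      exact ⟨rfl, by omega⟩
    · exact h
  · rintro (⟨⟨a, ha⟩, n⟩ | i)
    · by_cases hp : a ∈ B.Pos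
      · cases n with
        | zero => exact ⟨Sum.inl ⟨a, hp⟩, rfl⟩
        | succ n => exact ⟨Sum.inr (Sum.inl (⟨a, ha⟩, n)), by simp [split, eps_pos hp]⟩
      · exact ⟨Sum.inr (Sum.inl (⟨a, ha⟩, n)), by simp [split, eps_neg hp]⟩
    · exact ⟨Sum.inr (Sum.inr i), rfl⟩

theorem vec_split : D.vec ∘ split B = Sum.elim (fun a : {a // a ∈ B.Pos} => ((a : V), (0 : ℝ))) D.vecP := by
  ext1 i
  rcases i with ⟨a, ha⟩ | ⟨a, n⟩ | ⟨b, n⟩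
  · change D.vec (Sum.inl (⟨a, _⟩, 0)) = (a, 0)
    rw [vec_inl]; simp [eps_pos ha]
  · change D.vec (Sum.inl (a, n + 1 - eps B a)) = D.vecP (Sum.inl (a, n))
    rw [vec_inl, vecP_inl, Nat.cast_sub ((eps_le _).trans (by omega))]
    push_cast
    rw [sub_add_cancel]
  · rfl

theorem cnt_vec_eq (x : V × ℝ) : cnt D.vec x =
    ∑ T ∈ B.Pos.powerset, (-1 : ℝ) ^ T.card * cnt D.vecP (x.1 - ∑ a ∈ T, a, x.2) := by
  rw [← cnt_comp_equiv (Equiv.ofBijective _ split_bijective) D.vec, Equiv.coe_ofBijective,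
    vec_split]
  have hs : ∀ U : Finset {a // a ∈ B.Pos}, ∑ a ∈ U, ((a : V), (0 : ℝ)) = (∑ a ∈ U, (a : V), 0) :=
    fun U => by ext1 <;> simp [Prod.fst_sum, Prod.snd_sum]
  obtain ⟨N, hN⟩ := exists_nat_ge x.2
  rw [cnt_sum_elim _ _ _ (upTo B N)]
  · refine Finset.sum_nbij' (fun U => U.map (Function.Embedding.subtype _))
      (fun T => T.subtype _) ?_ ?_ ?_ ?_ ?_
    · intro U _
      rw [Finset.mem_powerset]
      intro a ha
      obtain ⟨b, -, rfl⟩ := Finset.mem_map.mp ha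
      exact b.2
    · intro T _; exact Finset.mem_univ _
    · intro U _; ext a; simp
    · intro T hT
      rw [Finset.mem_powerset] at hT
      ext a; simpa using fun h => hT h
    · intro U _
      rw [Finset.card_map, Finset.sum_map, hs]
      congr 2
      ext1 <;> simp
  · intro U T h
    refine D.subset_upTo_vecP (le_trans ?_ hN)
    rw [← h, hs]; simp

end Datum

end TwistedMacdonald

namespace TwistedMacdonald

namespace Datum

variable {V : Type} [AddCommGroup V] [Module ℝ V] {S : RootSys V} {B : Base S} (D : Datum B)

theorem sum_vecP_deg (T : Finset (Idx B)) : (T.card : ℝ) ≤ (∑ i ∈ T, D.vecP i).2 := by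
  rw [Prod.snd_sum, ← nsmul_one, ← Finset.sum_const]
  exact Finset.sum_le_sum fun i _ => D.one_le_vecP_deg i

theorem cnt_vecP_zero (x : V) : cnt D.vecP (x, 0) = if x = 0 then 1 else 0 := by
  have h : ∀ T : Finset (Idx B), ∑ i ∈ T, D.vecP i = (x, 0) → T ⊆ ∅ := fun T hT => by
    have := D.sum_vecP_deg T
    rw [hT] at this
    have h2 : T.card = 0 := by
      have h3 : (T.card : ℝ) ≤ (0 : ℕ) := by simpa using this
      exact Nat.le_zero.mp (by exact_mod_cast h3)
    rw [Finset.card_eq_zero.mp h2]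
  rw [cnt_eq ∅ h]
  simp [Prod.ext_iff, eq_comm]

theorem mem_upTo_of_deg_eq_one {i : Idx B} (h4 : (D.vecP i).2 = 1) : i ∈ upTo B 0 := by
  rcases i with ⟨a, n⟩ | ⟨b, n⟩
  · rw [inl_mem_upTo]
    rw [vecP_inl] at h4
    have := D.one_le_d a.2
    have h : (n : ℝ) ≤ (0 : ℕ) := by simp only at h4; push_cast; nlinarith [n.cast_nonneg (α := ℝ)]
    exact_mod_cast h
  · rw [inr_mem_upTo]
    rw [vecP_inr] at h4
    have := D.one_le_d (Pi_sub B b.2)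
    have h : (n : ℝ) ≤ (0 : ℕ) := by simp only at h4; push_cast; nlinarith [n.cast_nonneg (α := ℝ)]
    exact_mod_cast h

theorem cnt_vecP_one (x : V) : cnt D.vecP (x, 1) =
    -∑ i ∈ upTo B 0, if D.vecP i = (x, 1) then 1 else 0 := by
  rw [cnt_eq (upTo B 0)]
  · rw [← Finset.sum_neg_distrib]
    symm
    refine Finset.sum_of_injOn (fun i => {i}) (fun _ _ _ _ h => by simpa using h) ?_ ?_ ?_
    · intro i hi; simpa using hi
    · intro T _ hT'
      rw [if_neg]
      intro hT
      have h1 := D.sum_vecP_deg T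
      rw [hT] at h1
      simp only at h1
      have h2 : T.card ≤ 1 := by exact_mod_cast h1
      rcases Nat.le_one_iff_eq_zero_or_eq_one.mp h2 with h | h
      · rw [Finset.card_eq_zero.mp h] at hT
        simp [Prod.ext_iff] at hT
      · obtain ⟨i, rfl⟩ := Finset.card_eq_one.mp h
        refine hT' ⟨i, ?_, rfl⟩
        rw [Finset.sum_singleton] at hT
        exact Finset.mem_coe.mpr (D.mem_upTo_of_deg_eq_one (by rw [hT]))
    · intro i _
      simp only [Finset.sum_singleton, Finset.card_singleton, pow_one]
      split_ifs <;> simp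
  · intro T hT
    refine fun i hi => ?_
    have h1 := D.sum_vecP_deg T
    rw [hT] at h1
    simp only at h1
    have h2 : T.card ≤ 1 := by exact_mod_cast h1
    have h3 : T = {i} := by
      refine (Finset.eq_of_subset_of_card_le (Finset.singleton_subset_iff.mpr hi) ?_).symm
      simpa using h2
    rw [h3, Finset.sum_singleton] at hT
    have h4 : (D.vecP i).2 = 1 := by rw [hT]
    exact D.mem_upTo_of_deg_eq_one h4

theorem cnt_vec_zero_deg (x : V) : cnt D.vec (x, 0) =
    ∑ T ∈ B.Pos.powerset, (-1 : ℝ) ^ T.card * if x = ∑ a ∈ T, a then 1 else 0 := by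
  rw [cnt_vec_eq]
  simp only [cnt_vecP_zero, sub_eq_zero]

theorem hgt_sum_nonneg {T : Finset V} (hT : T ⊆ B.Pos) : 0 ≤ hgt B (∑ a ∈ T, a) := by
  rw [map_sum]
  exact Finset.sum_nonneg fun a ha => zero_le_one.trans (one_le_hgt (hT ha))

theorem cnt_vec_zero : cnt D.vec (0, 0) = 1 := by
  rw [cnt_vec_zero_deg, Finset.sum_eq_single ∅]
  · simp
  · intro T hT hne
    rw [Finset.mem_powerset] at hT
    rw [if_neg, mul_zero]
    intro h
    obtain ⟨a, ha⟩ := Finset.nonempty_iff_ne_empty.mpr hne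
    have h1 := Finset.single_le_sum (f := fun a => hgt B a)
      (fun a ha => zero_le_one.trans (one_le_hgt (hT ha))) ha
    rw [← map_sum, ← h, map_zero] at h1
    have := one_le_hgt (hT ha)
    linarith
  · simp

theorem cnt_vec_of_neg {x : V} (hx : hgt B x < 0) : cnt D.vec (x, 0) = 0 := by
  rw [cnt_vec_zero_deg]
  refine Finset.sum_eq_zero fun T hT => ?_
  rw [if_neg, mul_zero]
  rintro rfl
  exact absurd hx (not_lt.mpr (hgt_sum_nonneg (Finset.mem_powerset.mp hT)))

theorem cnt_vec_short {a : V} (ha : a ∈ S.R) (h1 : D.d a = 1) :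
    cnt D.vec (a, 0) = if a ∈ B.Pi then -1 else 0 := by
  by_cases hPi : a ∈ B.Pi
  · have := D.cnt_simple hPi 0 0
    rw [map_zero, zero_add, cnt_vec_zero] at this
    rw [this, if_pos hPi]
  rw [if_neg hPi]
  by_cases hp : a ∈ B.Pos
  · obtain ⟨b, hb, hab⟩ := exists_simple_form_pos hp
    have hbR := Pi_sub B hb
    have hne : a ≠ b := by rintro rfl; exact hPi hb
    have hne' : a ≠ -b := by
      rintro rfl
      exact neg_notMem_pos (B.pi_sub hb) hp
    have hle : S.I a a ≤ S.I b b := by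
      rw [D.norm a ha, h1]; simpa using D.norm_le hbR
    have h2 := pr_abs_lt_two hbR hle hne hne'
    obtain ⟨n, hn⟩ := pr_int hbR ha
    have h3 := two_mul_form hbR a
    have h4 := norm_pos hbR
    rw [S.symm] at hab
    rw [hn] at h2 h3
    have h5 : n < 2 := by
      have := (abs_lt.mp h2).2
      exact_mod_cast this
    have h6 : 0 < n := by
      have : (0 : ℝ) < n := by
        by_contra hc
        nlinarith
      exact_mod_cast this
    have h7 : n = 1 := by omega
    have h8 := D.cnt_simple hb a 0
    rw [rf_apply, hn, h7] at h8
    simp only [Int.cast_one, one_smul, sub_add_cancel] at h8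
    linarith
  · refine D.cnt_vec_of_neg ?_
    have := one_le_hgt (pos_or_neg ha hp)
    rw [map_neg] at this
    linarith

theorem den_weylVec_one : D.den (weylVec B) 1 = 0 := by
  rw [den, sub_self, cnt_vec_eq]
  simp only [cnt_vecP_one, upTo, Finset.sum_disjSum, zero_add, Finset.range_one,
    Finset.sum_product, Finset.sum_singleton, vecP_inl, vecP_inr, zero_sub, mul_neg, mul_add,
    Finset.mul_sum, Finset.sum_neg_distrib, Finset.sum_add_distrib]
  rw [Finset.sum_comm, Finset.sum_comm (s := B.Pos.powerset)]
  have e1 : ∀ a : {a // a ∈ S.R}, ∑ T ∈ B.Pos.powerset, (-1 : ℝ) ^ T.card *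
      (if ((a : V), (D.d a * (0 : ℕ) + D.d a * 1 : ℝ)) = (-∑ a ∈ T, a, 1) then 1 else 0) =
      if D.d a = 1 then (if -(a : V) ∈ B.Pi then -1 else 0) else 0 := fun a => by
    split_ifs with h1 h2
    · have := D.cnt_vec_short (neg_mem a.2) (by rw [D.d_neg a.2, h1])
      rw [if_pos h2, cnt_vec_zero_deg] at this
      refine Eq.trans ?_ this
      refine Finset.sum_congr rfl fun T _ => ?_
      simp [h1, neg_eq_iff_eq_neg]
    · have := D.cnt_vec_short (neg_mem a.2) (by rw [D.d_neg a.2, h1])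
      rw [if_neg h2, cnt_vec_zero_deg] at this
      refine Eq.trans ?_ this
      refine Finset.sum_congr rfl fun T _ => ?_
      simp [h1, neg_eq_iff_eq_neg]
    · refine Finset.sum_eq_zero fun T _ => ?_
      simp [h1]
  have e2 : ∀ b : {b // b ∈ B.Pi}, ∑ T ∈ B.Pos.powerset, (-1 : ℝ) ^ T.card *
      (if ((0 : V), (D.d b * (0 : ℕ) + D.d b * 1 : ℝ)) = (-∑ a ∈ T, a, 1) then 1 else 0) =
      if D.d b = 1 then 1 else 0 := fun b => by
    split_ifs with h1
    · refine Eq.trans ?_ D.cnt_vec_zero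
      rw [cnt_vec_zero_deg]
      refine Finset.sum_congr rfl fun T _ => ?_
      simp [h1, eq_comm]
    · refine Finset.sum_eq_zero fun T _ => ?_
      simp [h1]
  simp only [e1, e2]
  have e3 : ∑ a : {a // a ∈ S.R}, (if D.d a = 1 then (if -(a : V) ∈ B.Pi then (-1 : ℝ) else 0) else 0)
      = -∑ b : {b // b ∈ B.Pi}, if D.d b = 1 then (1 : ℝ) else 0 := by
    rw [Finset.sum_coe_sort S.R (fun a => if D.d a = 1 then (if -a ∈ B.Pi then (-1 : ℝ) else 0) else 0),
      Finset.sum_coe_sort B.Pi (fun b => if D.d b = 1 then (1 : ℝ) else 0), ← Finset.sum_neg_distrib]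
    symm
    refine Finset.sum_of_injOn (fun b => -b) (fun _ _ _ _ h => neg_injective h) ?_ ?_ ?_
    · intro b hb; exact neg_mem (Pi_sub B hb)
    · intro a _ ha
      rw [if_neg (c := -a ∈ B.Pi)]
      · simp
      · intro h; exact ha ⟨-a, h, by simp⟩
    · intro b hb
      simp [D.d_neg (Pi_sub B hb), hb]
      split_ifs <;> simp
  rw [e3]; simp

end Datum

end TwistedMacdonald

namespace TwistedMacdonald

section Laplacian

variable {K J σ : Type*}

theorem sum_powerset_prod_of_subset [CommRing K] (f y : J → K) {s U : Finset J} (hU : U ⊆ s)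
    (hy : ∀ j ∈ s, (1 + f j) * y j = -f j) :
    ∑ T ∈ s.powerset, (if U ⊆ T then ∏ j ∈ T, f j else 0) =
      (∏ j ∈ s, (1 + f j)) * ∏ j ∈ U, -y j := by
  have h1 := Finset.prod_add f (fun j => if j ∈ U then (0 : K) else 1) s
  have h2 : ∏ j ∈ s, (f j + if j ∈ U then (0 : K) else 1) =
      (∏ j ∈ s, (1 + f j)) * ∏ j ∈ s, if j ∈ U then -y j else 1 := by
    rw [← Finset.prod_mul_distrib]
    refine Finset.prod_congr rfl fun j hj => ?_
    split_ifs
    · rw [mul_neg, hy j hj]; ring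
    · ring
  rw [Finset.prod_ite_mem, Finset.inter_eq_right.mpr hU] at h2
  rw [← h2, h1]
  refine Finset.sum_congr rfl fun T hT => ?_
  rw [Finset.mem_powerset] at hT
  split_ifs with h
  · have h3 : ∏ j ∈ s \ T, (if j ∈ U then (0 : K) else 1) = 1 := Finset.prod_eq_one fun j hj =>
      if_neg fun hj' => (Finset.mem_sdiff.mp hj).2 (h hj')
    rw [h3, mul_one]
  · obtain ⟨j, hj, hjT⟩ := Finset.not_subset.mp h
    have h3 : ∏ j ∈ s \ T, (if j ∈ U then (0 : K) else 1) = 0 :=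
      Finset.prod_eq_zero (Finset.mem_sdiff.mpr ⟨hU hj, hjT⟩) (if_pos hj)
    rw [h3, mul_zero]

theorem sum_powerset_quadratic [CommRing K] (f y ω : J → K) (b : J → J → K) (s : Finset J)
    (hy : ∀ j ∈ s, (1 + f j) * y j = -f j) :
    ∑ T ∈ s.powerset, (∑ i ∈ T, ω i + ∑ i ∈ T, ∑ j ∈ T.erase i, b i j) * ∏ j ∈ T, f j =
      (∏ j ∈ s, (1 + f j)) *
        (-∑ i ∈ s, ω i * y i + ∑ i ∈ s, ∑ j ∈ s.erase i, b i j * (y i * y j)) := by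
  have h1 : ∀ i ∈ s, (∏ j ∈ s, (1 + f j)) * -y i =
      ∑ T ∈ s.powerset, if i ∈ T then ∏ j ∈ T, f j else 0 := fun i hi => by
    rw [← Finset.prod_singleton (fun j => -y j) i,
      ← sum_powerset_prod_of_subset f y (Finset.singleton_subset_iff.mpr hi) hy]
    simp only [Finset.singleton_subset_iff]
  have h2 : ∀ i ∈ s, ∀ j ∈ s.erase i, (∏ j ∈ s, (1 + f j)) * (y i * y j) =
      ∑ T ∈ s.powerset, if i ∈ T ∧ j ∈ T then ∏ j ∈ T, f j else 0 := fun i hi j hj => by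
    obtain ⟨hne, hj⟩ := Finset.mem_erase.mp hj
    have e := Finset.prod_pair (f := fun j => -y j) hne.symm
    rw [← neg_mul_neg (y i), ← e, ← sum_powerset_prod_of_subset f y _ hy]
    · simp only [Finset.insert_subset_iff, Finset.singleton_subset_iff]
    · simp [Finset.insert_subset_iff, hi, hj]
  have h3 : (∏ j ∈ s, (1 + f j)) *
        (-∑ i ∈ s, ω i * y i + ∑ i ∈ s, ∑ j ∈ s.erase i, b i j * (y i * y j)) =
      ∑ i ∈ s, ω i * ∑ T ∈ s.powerset, (if i ∈ T then ∏ j ∈ T, f j else 0) +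
      ∑ i ∈ s, ∑ j ∈ s.erase i, b i j *
        ∑ T ∈ s.powerset, (if i ∈ T ∧ j ∈ T then ∏ j ∈ T, f j else 0) := by
    rw [mul_add, ← Finset.sum_neg_distrib, Finset.mul_sum, Finset.mul_sum]
    congr 1
    · refine Finset.sum_congr rfl fun i hi => ?_
      rw [← h1 i hi]; ring
    · refine Finset.sum_congr rfl fun i hi => ?_
      rw [Finset.mul_sum]
      refine Finset.sum_congr rfl fun j hj => ?_
      rw [← h2 i hi j hj]; ring
  rw [h3]
  simp only [add_mul, Finset.sum_add_distrib, Finset.mul_sum]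
  congr 1
  · rw [Finset.sum_comm (s := s)]
    refine Finset.sum_congr rfl fun T hT => ?_
    rw [Finset.mem_powerset] at hT
    rw [Finset.sum_mul]
    refine Finset.sum_subset_zero_on_sdiff hT (fun i hi => ?_) (fun i hi => ?_)
    · rw [if_neg (Finset.mem_sdiff.mp hi).2, mul_zero]
    · rw [if_pos hi]
  · have h4 : ∀ i, ∑ j ∈ s.erase i, ∑ T ∈ s.powerset,
        b i j * (if i ∈ T ∧ j ∈ T then ∏ j ∈ T, f j else 0) = _ := fun i => Finset.sum_comm
    simp only [h4]
    rw [Finset.sum_comm (s := s)]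
    refine Finset.sum_congr rfl fun T hT => ?_
    rw [Finset.mem_powerset] at hT
    rw [Finset.sum_mul]
    refine Finset.sum_subset_zero_on_sdiff hT (fun i hi => ?_) (fun i hi => ?_)
    · refine Finset.sum_eq_zero fun j _ => ?_
      rw [if_neg (fun h => (Finset.mem_sdiff.mp hi).2 h.1), mul_zero]
    · rw [Finset.sum_mul]
      refine Finset.sum_subset_zero_on_sdiff (Finset.erase_subset_erase _ hT)
        (fun j hj => ?_) (fun j hj => ?_)
      · rw [if_neg, mul_zero]
        rintro ⟨-, h⟩
        obtain ⟨h4, h5⟩ := Finset.mem_sdiff.mp hj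
        exact h5 (Finset.mem_erase.mpr ⟨(Finset.mem_erase.mp h4).1, h⟩)
      · rw [if_pos ⟨hi, (Finset.mem_erase.mp hj).2⟩]

/-- The power series `X^e + X^(2 * e) + ⋯`. -/
noncomputable def geom (e : σ →₀ ℕ) : MvPowerSeries σ ℝ :=
  fun n => if ∃ k : ℕ, n = (k + 1) • e then 1 else 0

theorem coeff_geom (e n : σ →₀ ℕ) :
    MvPowerSeries.coeff n (geom e) = if ∃ k : ℕ, n = (k + 1) • e then 1 else 0 := rfl

theorem geom_spec {e : σ →₀ ℕ} (he : e ≠ 0) :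
    (1 + -MvPowerSeries.monomial e (1 : ℝ)) * geom e = - -MvPowerSeries.monomial e 1 := by
  ext n
  rw [add_mul, one_mul, neg_mul, neg_neg, map_add, map_neg, MvPowerSeries.coeff_monomial_mul,
    MvPowerSeries.coeff_monomial, coeff_geom, coeff_geom]
  by_cases h : ∃ k : ℕ, n = (k + 1) • e
  · rw [if_pos h]
    obtain ⟨k, rfl⟩ := h
    have h1 : e ≤ (k + 1) • e := by rw [succ_nsmul]; exact le_add_self
    rw [if_pos h1]
    have h2 : (k + 1) • e - e = k • e := by rw [succ_nsmul]; simp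
    rw [h2]
    cases k with
    | zero =>
      have h3 : ¬ ∃ k : ℕ, 0 • e = (k + 1) • e := by
        rintro ⟨k, hk⟩
        rw [zero_smul, eq_comm, smul_eq_zero] at hk
        exact hk.elim (by simp) he
      rw [if_neg h3]; simp
    | succ k =>
      rw [if_pos ⟨k, rfl⟩, if_neg]
      · simp
      · intro h
        have h4 : (k + 1) • e = 0 := by
          rw [succ_nsmul, add_eq_right] at h; exact h
        rw [smul_eq_zero] at h4
        exact h4.elim (by simp) he
  · rw [if_neg h, if_neg (c := n = e)]
    · split_ifs with h1 h2
      · obtain ⟨k, hk⟩ := h2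
        refine absurd ⟨k + 1, ?_⟩ h
        rw [succ_nsmul, ← hk, tsub_add_cancel_of_le h1]
      · simp
      · simp
    · rintro rfl; exact h ⟨0, by simp⟩

theorem laplacian_coeff (s : Finset J) (e : J → σ →₀ ℕ) (he : ∀ i ∈ s, e i ≠ 0)
    (w : (σ →₀ ℕ) → ℝ) (ω : J → ℝ) (b : J → J → ℝ)
    (hw : ∀ T ⊆ s, w (∑ i ∈ T, e i) = ∑ i ∈ T, ω i + ∑ i ∈ T, ∑ j ∈ T.erase i, b i j)
    (P : (σ →₀ ℕ) → ℝ)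
    (hP : ∀ n, P n = ∑ T ∈ s.powerset, if ∑ i ∈ T, e i = n then (-1 : ℝ) ^ T.card else 0)
    (n : σ →₀ ℕ) (hn : ∀ m, m ≤ n → m ≠ n → w m * P m = 0) :
    w n * P n = -∑ i ∈ s, ω i * (if ∃ k : ℕ, n = (k + 1) • e i then 1 else 0) +
      ∑ i ∈ s, ∑ j ∈ s.erase i, b i j * MvPowerSeries.coeff n (geom (e i) * geom (e j)) := by
  let f : J → MvPowerSeries σ ℝ := fun i => -MvPowerSeries.monomial (e i) 1
  have hf : ∀ T : Finset J, ∏ j ∈ T, f j = MvPowerSeries.monomial (∑ i ∈ T, e i) ((-1 : ℝ) ^ T.card) := by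
    intro T
    induction T using Finset.induction_on with
    | empty => simp
    | insert i T hi ih =>
      rw [Finset.prod_insert hi, ih, Finset.sum_insert hi, Finset.card_insert_of_notMem hi]
      simp only [f]
      rw [neg_mul, MvPowerSeries.monomial_mul_monomial, ← map_neg]
      congr 1; ring
  let Q : MvPowerSeries σ ℝ := ∏ j ∈ s, (1 + f j)
  let L : MvPowerSeries σ ℝ := fun m => w m * P m
  have hQ0 : MvPowerSeries.constantCoeff Q = 1 := by
    simp only [Q, map_prod]
    refine Finset.prod_eq_one fun j hj => ?_
    simp only [f, map_add, map_neg, map_one]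
    rw [← MvPowerSeries.coeff_zero_eq_constantCoeff_apply, MvPowerSeries.coeff_monomial,
      if_neg (he j hj).symm]
    simp
  have hLQ : L = Q * (-∑ i ∈ s, MvPowerSeries.C (ω i) * geom (e i) +
      ∑ i ∈ s, ∑ j ∈ s.erase i, MvPowerSeries.C (b i j) * (geom (e i) * geom (e j))) := by
    rw [← sum_powerset_quadratic f (fun i => geom (e i)) (fun i => MvPowerSeries.C (ω i))
      (fun i j => MvPowerSeries.C (b i j)) s fun j hj => geom_spec (he j hj)]
    ext m
    rw [map_sum]
    change w m * P m = _
    rw [hP, Finset.mul_sum]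
    refine Finset.sum_congr rfl fun T hT => ?_
    rw [Finset.mem_powerset] at hT
    have h1 : (∑ i ∈ T, MvPowerSeries.C (ω i) + ∑ i ∈ T, ∑ j ∈ T.erase i, MvPowerSeries.C (b i j) :
        MvPowerSeries σ ℝ) = MvPowerSeries.C (w (∑ i ∈ T, e i)) := by
      rw [hw T hT]; simp
    rw [h1, hf, MvPowerSeries.coeff_C_mul, MvPowerSeries.coeff_monomial]
    by_cases h : m = ∑ i ∈ T, e i
    · rw [if_pos h.symm, if_pos h, h]
    · rw [if_neg (Ne.symm h), if_neg h, mul_zero, mul_zero]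
  have hinv : Q⁻¹ * L = -∑ i ∈ s, MvPowerSeries.C (ω i) * geom (e i) +
      ∑ i ∈ s, ∑ j ∈ s.erase i, MvPowerSeries.C (b i j) * (geom (e i) * geom (e j)) := by
    rw [hLQ, ← mul_assoc, MvPowerSeries.inv_mul_cancel _ (by rw [hQ0]; exact one_ne_zero), one_mul]
  have h2 := congrArg (MvPowerSeries.coeff n) hinv
  rw [MvPowerSeries.coeff_mul, Finset.sum_eq_single (0, n)] at h2
  · rw [MvPowerSeries.coeff_zero_eq_constantCoeff_apply, MvPowerSeries.constantCoeff_inv, hQ0,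
      inv_one, one_mul] at h2
    change w n * P n = _ at h2
    rw [h2]
    simp only [map_add, map_neg, map_sum, MvPowerSeries.coeff_C_mul, coeff_geom]
  · rintro ⟨p, q⟩ hpq hne
    rw [Finset.HasAntidiagonal.mem_antidiagonal] at hpq
    simp only at hpq
    have h3 : MvPowerSeries.coeff q L = 0 := by
      refine hn q (hpq ▸ le_add_self) fun h => hne ?_
      subst h
      rw [add_eq_right] at hpq
      rw [hpq]
    simp only [h3, mul_zero]
  · intro h; simp at h

end Laplacian

end TwistedMacdonald

namespace TwistedMacdonald

section

variable {σ : Type*}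

theorem coeff_geom_mul_geom {e e' n : σ →₀ ℕ} (he : e + e' ≠ 0)
    (hu : ∀ k l : ℕ, n = (k + 1) • e + (l + 1) • e' → k = l) :
    MvPowerSeries.coeff n (geom e * geom e') =
      if ∃ k : ℕ, n = (k + 1) • (e + e') then 1 else 0 := by
  rw [MvPowerSeries.coeff_mul]
  split_ifs with h
  · obtain ⟨k, hk⟩ := h
    rw [Finset.sum_eq_single ((k + 1) • e, (k + 1) • e')]
    · simp only [coeff_geom]
      rw [if_pos ⟨k, rfl⟩, if_pos ⟨k, rfl⟩, one_mul]
    · rintro ⟨p, q⟩ hpq hne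
      rw [Finset.HasAntidiagonal.mem_antidiagonal] at hpq
      simp only [coeff_geom] at hpq ⊢
      by_contra hc
      obtain ⟨h1, h2⟩ := ne_zero_and_ne_zero_of_mul hc
      obtain ⟨i, rfl⟩ := (by_contra fun h => h1 (if_neg h) : ∃ k : ℕ, p = (k + 1) • e)
      obtain ⟨j, rfl⟩ := (by_contra fun h => h2 (if_neg h) : ∃ k : ℕ, q = (k + 1) • e')
      obtain rfl := hu i j hpq.symm
      obtain ⟨x, hx⟩ := Finsupp.ne_iff.mp he
      rw [← nsmul_add, hk] at hpq
      have h3 := DFunLike.congr_fun hpq x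
      rw [Finsupp.smul_apply, Finsupp.smul_apply, smul_eq_mul, smul_eq_mul] at h3
      have h4 := Nat.eq_of_mul_eq_mul_right (Nat.pos_of_ne_zero hx) h3
      exact hne (by rw [h4])
    · intro h
      exact absurd (by rw [Finset.HasAntidiagonal.mem_antidiagonal, hk, nsmul_add]) h
  · refine Finset.sum_eq_zero fun x hx => ?_
    rw [Finset.HasAntidiagonal.mem_antidiagonal] at hx
    simp only [coeff_geom]
    by_contra hc
    obtain ⟨h1, h2⟩ := ne_zero_and_ne_zero_of_mul hc
    obtain ⟨i, hi⟩ := (by_contra fun h => h1 (if_neg h) : ∃ k : ℕ, x.1 = (k + 1) • e)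
    obtain ⟨j, hj⟩ := (by_contra fun h => h2 (if_neg h) : ∃ k : ℕ, x.2 = (k + 1) • e')
    rw [hi, hj] at hx
    obtain rfl := hu i j hx.symm
    exact h ⟨i, by rw [← hx, nsmul_add]⟩

end

theorem sum_range_sum_range_add (N : ℕ) (G : ℕ → ℝ) (hG : ∀ q, N < q → G q = 0) :
    ∑ p ∈ Finset.range (N + 1), ∑ q ∈ Finset.range (N + 1), G (p + q) =
      ∑ q ∈ Finset.range (N + 1), (q + 1) * G q := by
  have h1 : ∀ q : ℕ, (q + 1) * G q = ∑ x ∈ Finset.HasAntidiagonal.antidiagonal q, G (x.1 + x.2) := fun q => by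
    rw [Finset.sum_congr rfl (g := fun _ => G q)]
    · simp
    · intro x hx
      rw [Finset.HasAntidiagonal.mem_antidiagonal] at hx
      rw [hx]
  simp only [h1]
  rw [← Finset.sum_product' (f := fun p q => G (p + q)), Finset.sum_sigma']
  symm
  refine Finset.sum_of_injOn (fun x => x.2) ?_ ?_ ?_ (fun _ _ => rfl)
  · rintro ⟨q, x⟩ hx ⟨q', x'⟩ hx' h
    simp only [Finset.coe_sigma, Set.mem_sigma_iff, Finset.mem_coe,
      Finset.HasAntidiagonal.mem_antidiagonal] at hx hx' h
    subst h
    obtain rfl : q = q' := by rw [← hx.2, ← hx'.2]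
    rfl
  · rintro ⟨q, x⟩ hx
    simp only [Finset.coe_sigma, Set.mem_sigma_iff, Finset.mem_coe,
      Finset.HasAntidiagonal.mem_antidiagonal, Finset.mem_range, Finset.mem_product] at hx ⊢
    omega
  · rintro x hx hx'
    refine hG _ ?_
    by_contra hc
    refine hx' ⟨⟨x.1 + x.2, x⟩, ?_, rfl⟩
    simp only [Finset.coe_sigma, Set.mem_sigma_iff, Finset.mem_coe,
      Finset.HasAntidiagonal.mem_antidiagonal, Finset.mem_range, and_true]
    omega

section Coordinates

variable {V : Type} [AddCommGroup V] [Module ℝ V] {S : RootSys V}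

/-- The linear combination of the simple roots and `δ - H·Σ b` with the given coefficients. -/
noncomputable def lin (B : Base S) (H : ℕ) : (Option {b // b ∈ B.Pi} →₀ ℕ) →+ V × ℝ where
  toFun n := (∑ b : {b // b ∈ B.Pi}, ((n (some b) : ℝ) - H * n none) • (b : V), n none)
  map_zero' := by simp
  map_add' n n' := by
    ext1
    · simp only [Prod.mk_add_mk, ← Finset.sum_add_distrib, ← add_smul]
      refine Finset.sum_congr rfl fun b _ => ?_
      congr 1
      simp only [Finsupp.add_apply, Nat.cast_add]; ring
    · simp

variable {B : Base S} {H : ℕ}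

theorem lin_snd (n) : (lin B H n).2 = n none := rfl

theorem crd_lin (n) (b) : crd B b (lin B H n).1 = n (some b) - H * n none := by
  change crd B b (∑ b : {b // b ∈ B.Pi}, ((n (some b) : ℝ) - H * n none) • (b : V)) = _
  simp [crd_simple]

theorem lin_injective : Function.Injective (lin B H) := fun n n' h => by
  have h0 : n none = n' none := by
    have : ((n none : ℕ) : ℝ) = n' none := congrArg Prod.snd h
    exact_mod_cast this
  ext x
  rcases x with _ | b
  · exact h0
  · have := congrArg (fun x => crd B b x.1) h
    simp only [crd_lin, h0, sub_left_inj] at this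
    exact_mod_cast this

theorem exists_lin {x : V × ℝ} {m : ℕ} (hm : x.2 = m) (hx : ∀ b, ∃ k : ℕ, crd B b x.1 + H * m = k) :
    ∃ n, lin B H n = x := by
  choose k hk using hx
  refine ⟨Finsupp.equivFunOnFinite.symm fun o => o.elim m k, ?_⟩
  ext1
  · refine eq_of_crd B fun b => ?_
    rw [crd_lin]
    simp [← hk]
  · rw [lin_snd, hm]; simp

variable (B) in
theorem exists_crd_bound : ∃ H : ℕ, ∀ a ∈ S.R, ∀ b, -(H : ℝ) ≤ crd B b a := by
  refine ⟨∑ a ∈ S.R, ∑ b, ⌈|crd B b a|⌉₊, fun a ha b => ?_⟩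
  have h1 := (Finset.single_le_sum (f := fun b => ⌈|crd B b a|⌉₊) (fun _ _ => Nat.zero_le _)
    (Finset.mem_univ b)).trans (Finset.single_le_sum (f := fun a => ∑ b, ⌈|crd B b a|⌉₊)
    (fun _ _ => Nat.zero_le _) ha)
  have h2 : |crd B b a| ≤ ((∑ a ∈ S.R, ∑ b, ⌈|crd B b a|⌉₊ : ℕ) : ℝ) :=
    (Nat.le_ceil _).trans (by exact_mod_cast h1)
  linarith [(abs_le.mp h2).1]

theorem crd_int {a : V} (ha : a ∈ S.R) (b) : ∃ z : ℤ, crd B b a = z := by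
  by_cases h : a ∈ B.Pos
  · obtain ⟨n, hn⟩ := crd_nat_of_pos h b
    exact ⟨n, by rw [hn]; simp⟩
  · obtain ⟨n, hn⟩ := crd_nat_of_pos (pos_or_neg ha h) b
    rw [map_neg] at hn
    exact ⟨-n, by push_cast; linarith⟩

end Coordinates

namespace Datum

variable {V : Type} [AddCommGroup V] [Module ℝ V] {S : RootSys V} {B : Base S} (D : Datum B)

theorem exists_lin_vec {H : ℕ} (hH : ∀ a ∈ S.R, ∀ b, -(H : ℝ) ≤ crd B b a) (i : Idx B) :
    ∃ n, lin B H n = D.vec i := by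
  rcases i with ⟨a, p⟩ | ⟨b, p⟩
  · refine exists_lin (m := D.d a * (p + eps B a)) (by rw [vec_inl]; push_cast; rfl) fun b => ?_
    obtain ⟨z, hz⟩ := crd_int a.2 b
    have h1 : (0 : ℝ) ≤ crd B b a + H * (D.d a * (p + eps B a) : ℕ) := by
      by_cases h : (a : V) ∈ B.Pos
      · have := crd_nonneg h b
        positivity
      · have h2 := hH a a.2 b
        have h3 : 1 ≤ D.d a * (p + eps B a) := by
          rw [eps_neg h]
          exact one_le_mul (D.d_pos a.2) (Nat.le_add_left _ _)
        have h4 : (1 : ℝ) ≤ (D.d a * (p + eps B a) : ℕ) := by exact_mod_cast h3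
        nlinarith [H.cast_nonneg (α := ℝ)]
    rw [vec_inl]
    rw [hz] at h1 ⊢
    have h2 : 0 ≤ z + H * (D.d a * (p + eps B a) : ℕ) := by exact_mod_cast h1
    obtain ⟨k, hk⟩ := Int.eq_ofNat_of_zero_le h2
    exact ⟨k, by exact_mod_cast hk⟩
  · refine exists_lin (m := D.d b * (p + 1)) (by rw [vec_inr]; push_cast; rfl) fun b' => ?_
    rw [vec_inr]
    exact ⟨H * (D.d b * (p + 1)), by simp⟩

theorem vec_ne_zero (i : Idx B) : D.vec i ≠ 0 := by
  rcases i with ⟨a, p⟩ | ⟨b, p⟩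
  · rw [vec_inl]
    exact fun h => ne_zero_of_mem a.2 (congrArg Prod.fst h)
  · rw [vec_inr]
    intro h
    have h1 : (D.d b * (p + 1) : ℝ) = 0 := congrArg Prod.snd h
    have := D.one_le_d (Pi_sub B b.2)
    have : (0 : ℝ) < D.d b * (p + 1) := by positivity
    linarith

end Datum

end TwistedMacdonald

namespace TwistedMacdonald

namespace Datum

variable {V : Type} [AddCommGroup V] [Module ℝ V] {S : RootSys V} {B : Base S} (D : Datum B)

/-- The sum of the divisors of `n` that are multiples of `d`. -/
noncomputable def divSum (n d : ℕ) : ℝ :=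
  ∑ p ∈ Finset.range (n + 1), if d * (p + 1) ∣ n then (d * (p + 1) : ℝ) else 0

theorem eps_add_eps_neg {a : V} (ha : a ∈ S.R) : eps B a + eps B (-a) = 1 := by
  by_cases h : a ∈ B.Pos
  · rw [eps_pos h, eps_neg (neg_notMem_pos h)]
  · rw [eps_neg h, eps_pos (pos_or_neg ha h)]

theorem smul_vec_eq_iff {n₀ : ℕ} (k : ℕ) (b : {b // b ∈ B.Pi}) (p : ℕ) :
    ((0 : V), (n₀ : ℝ)) = (k + 1) • D.vec (Sum.inr (b, p)) ↔ n₀ = (k + 1) * (D.d b * (p + 1)) := by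
  rw [vec_inr, Prod.smul_mk, smul_zero, Prod.ext_iff, nsmul_eq_mul]
  simp only [true_and]
  norm_cast

theorem exists_smul_vec_inr {n₀ : ℕ} (h1 : 1 ≤ n₀) (b : {b // b ∈ B.Pi}) (p : ℕ) :
    (∃ k : ℕ, ((0 : V), (n₀ : ℝ)) = (k + 1) • D.vec (Sum.inr (b, p))) ↔ D.d b * (p + 1) ∣ n₀ := by
  simp only [smul_vec_eq_iff]
  constructor
  · rintro ⟨k, hk⟩
    exact ⟨k + 1, by rw [hk, mul_comm]⟩
  · rintro ⟨k, hk⟩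
    cases k with
    | zero => omega
    | succ k => exact ⟨k, by rw [hk, mul_comm]⟩

theorem not_exists_smul_vec_inl {n₀ : ℕ} (a : {a // a ∈ S.R}) (p : ℕ) :
    ¬ ∃ k : ℕ, ((0 : V), (n₀ : ℝ)) = (k + 1) • D.vec (Sum.inl (a, p)) := by
  rintro ⟨k, hk⟩
  have h1 : (0 : V) = (k + 1) • (a : V) := congrArg Prod.fst hk
  rw [← Nat.cast_smul_eq_nsmul ℝ, eq_comm, smul_eq_zero] at h1
  refine h1.elim (fun h => ?_) (ne_zero_of_mem a.2)
  have : (k + 1 : ℕ) = 0 := by exact_mod_cast h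
  omega

theorem vec_pair {n₀ : ℕ} {a a' : {a // a ∈ S.R}} {p p' k l : ℕ}
    (h : ((0 : V), (n₀ : ℝ)) = (k + 1) • D.vec (Sum.inl (a, p)) + (l + 1) • D.vec (Sum.inl (a', p'))) :
    (a' : V) = -a ∧ k = l := by
  have h1 : (0 : V) = (k + 1) • (a : V) + (l + 1) • (a' : V) := congrArg Prod.fst h
  have hk : ((k : ℝ) + 1) ≠ 0 := by positivity
  have hl : ((l : ℝ) + 1) ≠ 0 := by positivity
  have h2 : (a' : V) = (-((k + 1) / (l + 1)) : ℝ) • (a : V) := by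
    have h3 : ((l : ℝ) + 1) • (a' : V) = -(((k : ℝ) + 1) • (a : V)) := by
      rw [eq_neg_iff_add_eq_zero, add_comm, h1, ← Nat.cast_smul_eq_nsmul ℝ (k + 1),
        ← Nat.cast_smul_eq_nsmul ℝ (l + 1)]
      push_cast; rfl
    rw [← inv_smul_smul₀ hl (a' : V), h3, smul_neg, smul_smul, neg_smul]
    congr 2; field_simp
  have h4 : ((k : ℝ) + 1) / (l + 1) = 1 := by
    have hpos : (0 : ℝ) < (k + 1) / (l + 1) := by positivity
    rcases S.reduced a a.2 _ (by rw [← h2]; exact a'.2) with h | h <;> linarith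
  refine ⟨by rw [h2, h4, neg_smul, one_smul], ?_⟩
  rw [div_eq_one_iff_eq hl] at h4
  have : (k : ℝ) = l := by linarith
  exact_mod_cast this

theorem vec_add_vec_neg {a a' : {a // a ∈ S.R}} (h : (a' : V) = -a) (p p' : ℕ) :
    D.vec (Sum.inl (a, p)) + D.vec (Sum.inl (a', p')) = ((0 : V), ((D.d a * (p + p' + 1) : ℕ) : ℝ)) := by
  rw [vec_inl, vec_inl, h, D.d_neg a.2]
  have h1 : (eps B (a : V) : ℝ) + eps B (-(a : V)) = 1 := by
    exact_mod_cast eps_add_eps_neg a.2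
  ext1
  · simp
  · push_cast
    simp only [Prod.snd_add]
    linear_combination (D.d a : ℝ) * h1

section

variable {H n₀ : ℕ} (e : Idx B → Option {b // b ∈ B.Pi} →₀ ℕ) (he : ∀ i, lin B H (e i) = D.vec i)
  {n : Option {b // b ∈ B.Pi} →₀ ℕ} (hn : lin B H n = (0, (n₀ : ℝ)))

include he hn

theorem coeff_geom_real_pair (h1 : 1 ≤ n₀) (a a' : {a // a ∈ S.R}) (p p' : ℕ) :
    MvPowerSeries.coeff n (geom (e (Sum.inl (a, p))) * geom (e (Sum.inl (a', p')))) =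
      if (a' : V) = -a then (if D.d a * (p + p' + 1) ∣ n₀ then 1 else 0) else 0 := by
  have key : ∀ k l : ℕ, n = (k + 1) • e (Sum.inl (a, p)) + (l + 1) • e (Sum.inl (a', p')) →
      (a' : V) = -a ∧ k = l := fun k l h => by
    have := congrArg (lin B H) h
    rw [map_add, map_nsmul, map_nsmul, he, he, hn] at this
    exact D.vec_pair this
  rw [coeff_geom_mul_geom]
  · by_cases h : (a' : V) = -a
    · rw [if_pos h]
      congr 1
      rw [eq_iff_iff]
      have h2 : ∀ k : ℕ, n = (k + 1) • (e (Sum.inl (a, p)) + e (Sum.inl (a', p'))) ↔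
          n₀ = (k + 1) * (D.d a * (p + p' + 1)) := fun k => by
        rw [← (lin_injective (B := B) (H := H)).eq_iff, map_nsmul, map_add, he, he, hn,
          D.vec_add_vec_neg h, Prod.smul_mk, smul_zero, Prod.ext_iff, nsmul_eq_mul]
        simp only [true_and]
        norm_cast
      simp only [h2]
      constructor
      · rintro ⟨k, hk⟩
        exact ⟨k + 1, by rw [hk, mul_comm]⟩
      · rintro ⟨k, hk⟩
        cases k with
        | zero => omega
        | succ k => exact ⟨k, by rw [hk, mul_comm]⟩
    · rw [if_neg h, if_neg]
      rintro ⟨k, hk⟩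
      exact h (key k k (by rw [← nsmul_add, hk])).1
  · intro h
    rw [add_eq_zero] at h
    have := congrArg (lin B H) h.1
    rw [he, map_zero] at this
    exact D.vec_ne_zero _ this
  · exact fun k l h => (key k l h).2

theorem sum_pairs (h1 : 1 ≤ n₀) :
    ∑ i ∈ upTo B n₀, ∑ j ∈ (upTo B n₀).erase i, S.I (D.vec i).1 (D.vec j).1 *
      MvPowerSeries.coeff n (geom (e i) * geom (e j)) =
    -(S.I D.θs D.θs * ∑ a : {a // a ∈ S.R}, divSum n₀ (D.d a)) := by
  have hself : ∀ i, S.I (D.vec i).1 (D.vec i).1 *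
      MvPowerSeries.coeff n (geom (e i) * geom (e i)) = 0 := by
    rintro (⟨a, p⟩ | ⟨b, p⟩)
    · rw [D.coeff_geom_real_pair e he hn h1, if_neg, mul_zero]
      intro h
      have h2 : (2 : ℝ) • (a : V) = 0 := by
        rw [two_smul]; nth_rw 1 [h]; simp
      rw [smul_eq_zero] at h2
      exact h2.elim (by norm_num) (ne_zero_of_mem a.2)
    · rw [vec_inr]; simp
  have h0 : ∀ i, ∑ j ∈ (upTo B n₀).erase i, S.I (D.vec i).1 (D.vec j).1 *
      MvPowerSeries.coeff n (geom (e i) * geom (e j)) = ∑ j ∈ upTo B n₀,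
      S.I (D.vec i).1 (D.vec j).1 * MvPowerSeries.coeff n (geom (e i) * geom (e j)) := fun i =>
    Finset.sum_erase (f := fun j => S.I (D.vec i).1 (D.vec j).1 *
      MvPowerSeries.coeff n (geom (e i) * geom (e j))) _ (hself i)
  simp only [h0]
  simp only [upTo, Finset.sum_disjSum, Finset.sum_product]
  have e1 : ∀ (b : {b // b ∈ B.Pi}) p x, S.I (D.vec (Sum.inr (b, p))).1 x = 0 := fun b p x => by
    rw [vec_inr]; simp
  have e2 : ∀ (b : {b // b ∈ B.Pi}) p x, S.I x (D.vec (Sum.inr (b, p))).1 = 0 := fun b p x => by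
    rw [vec_inr]; simp
  simp only [e1, e2, zero_mul, Finset.sum_const_zero, add_zero,
    D.coeff_geom_real_pair e he hn h1]
  rw [Finset.mul_sum, ← Finset.sum_neg_distrib]
  refine Finset.sum_congr rfl fun a _ => ?_
  have e3 : ∀ p, ∑ a' : {a // a ∈ S.R}, ∑ p' ∈ Finset.range (n₀ + 1),
      S.I (D.vec (Sum.inl (a, p))).1 (D.vec (Sum.inl (a', p'))).1 *
        (if (a' : V) = -a then (if D.d a * (p + p' + 1) ∣ n₀ then (1 : ℝ) else 0) else 0) =
      ∑ p' ∈ Finset.range (n₀ + 1), -(S.I (a : V) a) *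
        (if D.d a * (p + p' + 1) ∣ n₀ then (1 : ℝ) else 0) := fun p => by
    rw [Finset.sum_eq_single ⟨-(a : V), neg_mem a.2⟩]
    · simp [vec_inl]
    · intro a' _ hne
      refine Finset.sum_eq_zero fun p' _ => ?_
      rw [if_neg, mul_zero]
      exact fun h => hne (Subtype.ext h)
    · simp
  simp only [e3, ← Finset.mul_sum]
  rw [sum_range_sum_range_add n₀ (fun q => if D.d a * (q + 1) ∣ n₀ then (1 : ℝ) else 0), divSum,
    D.norm a a.2, Finset.mul_sum, Finset.mul_sum, ← Finset.sum_neg_distrib]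
  · refine Finset.sum_congr rfl fun q _ => ?_
    split_ifs <;> ring
  · intro q hq
    rw [if_neg]
    intro h
    have h2 := Nat.le_of_dvd h1 h
    have h3 := D.d_pos a.2
    nlinarith

theorem sum_imag (h1 : 1 ≤ n₀) (ω : Idx B → ℝ) (c : ℝ)
    (hω : ∀ b p, ω (Sum.inr (b, p)) = -(c * (D.d b * (p + 1)))) :
    -∑ i ∈ upTo B n₀, ω i * (if ∃ k : ℕ, n = (k + 1) • e i then 1 else 0) =
      c * ∑ b : {b // b ∈ B.Pi}, divSum n₀ (D.d b) := by
  have hiff : ∀ i (k : ℕ), n = (k + 1) • e i ↔ ((0 : V), (n₀ : ℝ)) = (k + 1) • D.vec i := fun i k => by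
    rw [← (lin_injective (B := B) (H := H)).eq_iff, map_nsmul, he, hn]
  simp only [hiff, upTo, Finset.sum_disjSum, Finset.sum_product, D.not_exists_smul_vec_inl,
    D.exists_smul_vec_inr h1, if_false, mul_zero, Finset.sum_const_zero, zero_add, hω]
  rw [Finset.mul_sum, ← Finset.sum_neg_distrib]
  refine Finset.sum_congr rfl fun b _ => ?_
  rw [divSum, Finset.mul_sum, ← Finset.sum_neg_distrib]
  refine Finset.sum_congr rfl fun p _ => ?_
  split_ifs <;> ring

end

/-- The eigenvalue of the Laplacian, normalised to vanish on the support of the theta sum. -/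
noncomputable def lap (l : V) (m : ℝ) : ℝ :=
  S.I l l - S.I (weylVec B) (weylVec B) - D.h * S.I D.θs D.θs * m

theorem lap_sum (T : Finset (Idx B)) :
    D.lap (weylVec B - (∑ i ∈ T, D.vec i).1) (∑ i ∈ T, D.vec i).2 =
      ∑ i ∈ T, (S.I (D.vec i).1 (D.vec i).1 - 2 * S.I (weylVec B) (D.vec i).1 -
        D.h * S.I D.θs D.θs * (D.vec i).2) +
      ∑ i ∈ T, ∑ j ∈ T.erase i, S.I (D.vec i).1 (D.vec j).1 := by
  have h1 : ∑ i ∈ T, ∑ j ∈ T.erase i, S.I (D.vec i).1 (D.vec j).1 =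
      ∑ i ∈ T, (∑ j ∈ T, S.I (D.vec i).1 (D.vec j).1 - S.I (D.vec i).1 (D.vec i).1) :=
    Finset.sum_congr rfl fun i hi => by rw [← Finset.sum_erase_add _ _ hi, add_sub_cancel_right]
  rw [h1, lap, Prod.fst_sum, Prod.snd_sum]
  simp only [map_sub, LinearMap.sub_apply, Finset.sum_sub_distrib, map_sum, LinearMap.sum_apply,
    ← Finset.mul_sum]
  rw [Finset.sum_congr rfl fun i _ => S.symm (D.vec i).1 (weylVec B), Finset.sum_comm]
  ring

theorem lap_eq_zero_of_theta (hW : (Weyl S : Set (V ≃ₗ[ℝ] V)).Finite) {l : V} {m : ℝ}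
    (h : D.theta hW l m ≠ 0) : D.lap l m = 0 := by
  obtain ⟨u, -, -, h2⟩ := D.exists_cond_of_theta hW h
  rw [lap, h2]; ring

variable [FiniteDimensional ℝ V]

theorem den_eq_of_lt (hW : (Weyl S : Set (V ≃ₗ[ℝ] V)).Finite) {n₀ : ℕ} (h1 : 1 ≤ n₀)
    (hk : ∀ k : ℕ, 1 ≤ k → k < n₀ → D.den (weylVec B) k = 0) {m : ℕ} (hm : m ≤ n₀) (l : V) :
    D.den l m = D.theta hW l m + D.den (weylVec B) n₀ * D.theta hW l (m - n₀) := by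
  have hA := (D.anti_den.add ((D.anti_theta hW).smul (-1))).add
    (((D.anti_theta hW).shift n₀).smul (-D.den (weylVec B) n₀))
  have := hA.eq_zero (N := n₀) (fun k hkn => ?_) m hm l
  · linarith
  · simp only [theta_weylVec]
    rcases Nat.eq_zero_or_pos k with rfl | hk0
    · have h2 : (0 : ℝ) - n₀ ≠ 0 := by
        have : (1 : ℝ) ≤ n₀ := by exact_mod_cast h1
        linarith
      rw [Nat.cast_zero, if_pos rfl, if_neg h2, den, sub_self, cnt_vec_zero]; ring
    · have h3 : (k : ℝ) ≠ 0 := by exact_mod_cast hk0.ne'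
      rw [if_neg h3]
      rcases hkn.lt_or_eq with h4 | rfl
      · have h5 : (k : ℝ) - n₀ ≠ 0 := sub_ne_zero.mpr (by exact_mod_cast h4.ne)
        rw [hk k hk0 h4, if_neg h5]; ring
      · rw [sub_self, if_pos rfl]; ring

omit [FiniteDimensional ℝ V] in
theorem theta_zero_of_dominant (hW : (Weyl S : Set (V ≃ₗ[ℝ] V)).Finite) {x : V} (hx : x ≠ 0)
    (h : ∀ b, 0 ≤ crd B b x) : D.theta hW (weylVec B + x) 0 = 0 := by
  by_contra hc
  have h1 := D.lap_eq_zero_of_theta hW hc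
  have h2 := form_pos_of_crd (fun _ => form_weylVec_simple) h hx
  have h3 := S.posdef x hx
  rw [lap] at h1
  simp only [map_add, LinearMap.add_apply, S.symm x (weylVec B)] at h1
  linarith

set_option maxHeartbeats 1000000 in
theorem den_step (hW : (Weyl S : Set (V ≃ₗ[ℝ] V)).Finite) {n₀ : ℕ} (h1 : 1 ≤ n₀)
    (hk : ∀ k : ℕ, 1 ≤ k → k < n₀ → D.den (weylVec B) k = 0) :
    -(D.h * n₀ * D.den (weylVec B) n₀) =
      D.h * ∑ b : {b // b ∈ B.Pi}, divSum n₀ (D.d b) - ∑ a : {a // a ∈ S.R}, divSum n₀ (D.d a) := by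
  obtain ⟨H, hH⟩ := exists_crd_bound B
  choose e he using D.exists_lin_vec hH
  obtain ⟨n, hn⟩ : ∃ n, lin B H n = ((0 : V), (n₀ : ℝ)) :=
    exists_lin (m := n₀) rfl fun b => ⟨H * n₀, by simp⟩
  have hnn : n none = n₀ := by
    have := congrArg Prod.snd hn
    rw [lin_snd] at this
    simp only at this
    exact_mod_cast this
  have hnb : ∀ b, n (some b) = H * n₀ := fun b => by
    have := congrArg (fun x => crd B b x.1) hn
    simp only [crd_lin, hnn, map_zero] at this
    have h2 : (n (some b) : ℝ) = (H * n₀ : ℕ) := by push_cast; linarith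
    exact_mod_cast h2
  let P : (Option {b // b ∈ B.Pi} →₀ ℕ) → ℝ := fun n =>
    ∑ T ∈ (upTo B n₀).powerset, if ∑ i ∈ T, e i = n then (-1 : ℝ) ^ T.card else 0
  have hP : ∀ m : Option {b // b ∈ B.Pi} →₀ ℕ, m none ≤ n₀ →
      P m = D.den (weylVec B - (lin B H m).1) (m none) := fun m hm => by
    rw [den, sub_sub_cancel, ← lin_snd (B := B) (H := H) m]
    rw [cnt_eq (upTo B n₀) fun T hT => D.subset_upTo (by
      rw [hT]; exact le_of_eq_of_le (lin_snd m) (by exact_mod_cast hm))]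
    refine Finset.sum_congr rfl fun T _ => ?_
    have : ∑ i ∈ T, e i = m ↔ ∑ i ∈ T, D.vec i = ((lin B H m).1, (lin B H m).2) := by
      rw [← (lin_injective (B := B) (H := H)).eq_iff, map_sum]
      simp only [he]
    by_cases h : ∑ i ∈ T, e i = m
    · rw [if_pos h, if_pos (this.mp h)]
    · rw [if_neg h, if_neg (mt this.mpr h)]
  have hL := laplacian_coeff (upTo B n₀) e (fun i _ h => D.vec_ne_zero i (by rw [← he, h, map_zero]))
    (fun m => D.lap (weylVec B - (lin B H m).1) (lin B H m).2)
    (fun i => S.I (D.vec i).1 (D.vec i).1 - 2 * S.I (weylVec B) (D.vec i).1 -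
        D.h * S.I D.θs D.θs * (D.vec i).2)
    (fun i j => S.I (D.vec i).1 (D.vec j).1)
    (fun T _ => by
      simp only [map_sum, he]
      convert D.lap_sum T)
    P (fun _ => Finset.sum_congr rfl fun T _ => by congr) n (fun m hm hne => ?_)
  · have h3 : D.lap (weylVec B - (lin B H n).1) (lin B H n).2 * P n =
        D.h * S.I D.θs D.θs * ∑ b : {b // b ∈ B.Pi}, divSum n₀ (D.d b) +
          -(S.I D.θs D.θs * ∑ a : {a // a ∈ S.R}, divSum n₀ (D.d a)) := by
      refine hL.trans ?_
      congr 1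
      · rw [← D.sum_imag e he hn h1 (fun i => S.I (D.vec i).1 (D.vec i).1 -
          2 * S.I (weylVec B) (D.vec i).1 - D.h * S.I D.θs D.θs * (D.vec i).2)
          (D.h * S.I D.θs D.θs) fun b p => by rw [vec_inr]; simp]
      · rw [← D.sum_pairs e he hn h1]
        congr! 3
    rw [hP n hnn.le, hn, hnn, sub_zero] at h3
    simp only [lap] at h3
    have h2 := norm_pos D.mem
    apply mul_left_cancel₀ h2.ne'
    linarith
  · have hm0 : m none ≤ n₀ := hnn ▸ hm none
    rw [hP m hm0, D.den_eq_of_lt hW h1 hk hm0, lin_snd, mul_add]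
    have h3 : D.lap (weylVec B - (lin B H m).1) (m none) *
        D.theta hW (weylVec B - (lin B H m).1) (m none) = 0 := by
      by_contra hc
      obtain ⟨h4, h5⟩ := ne_zero_and_ne_zero_of_mul hc
      exact h4 (D.lap_eq_zero_of_theta hW h5)
    rw [h3, zero_add]
    have h6 : D.theta hW (weylVec B - (lin B H m).1) ((m none : ℝ) - n₀) = 0 := by
      rcases hm0.lt_or_eq with hlt | heq
      · by_contra hc
        obtain ⟨k, hk⟩ := (D.anti_theta hW).nat _ _ hc
        have : (m none : ℝ) < n₀ := by exact_mod_cast hlt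
        linarith [k.cast_nonneg (α := ℝ)]
      · rw [heq, sub_self, sub_eq_add_neg]
        refine D.theta_zero_of_dominant hW (fun h => hne ?_) fun b => ?_
        · apply lin_injective (B := B) (H := H)
          rw [hn]
          ext1
          · exact neg_eq_zero.mp h
          · rw [lin_snd, heq]
        · have h7 := hm (some b)
          rw [hnb] at h7
          have h8 : (m (some b) : ℝ) ≤ H * n₀ := by exact_mod_cast h7
          rw [map_neg, crd_lin, heq]
          linarith
    rw [h6, mul_zero, mul_zero]

theorem den_weylVec (hW : (Weyl S : Set (V ≃ₗ[ℝ] V)).Finite) (n : ℕ) (h1 : 1 ≤ n) :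
    D.den (weylVec B) n = 0 := by
  have ht := D.two_le
  have key1 : D.h * ∑ b : {b // b ∈ B.Pi}, (if D.d b = 1 then (1 : ℝ) else 0) =
      ∑ a : {a // a ∈ S.R}, (if D.d a = 1 then (1 : ℝ) else 0) := by
    have h2 := D.den_step hW (n₀ := 1) le_rfl (fun k hk hk' => by omega)
    have h3 := D.den_weylVec_one
    rw [Nat.cast_one, h3] at h2
    have h4 : ∀ d : ℕ, 1 ≤ d → divSum 1 d = if d = 1 then 1 else 0 := fun d hd => by
      rw [divSum]
      simp only [Nat.dvd_one, Finset.sum_range_succ, Finset.sum_range_zero, zero_add]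
      have h5 : ¬ d * (1 + 1) = 1 := by omega
      rw [if_neg h5]
      simp only [mul_one, Nat.cast_zero, zero_add, add_zero]
      split_ifs with h <;> simp [h]
    simp only [fun b : {b // b ∈ B.Pi} => h4 _ (D.d_pos (Pi_sub B b.2)),
      fun a : {a // a ∈ S.R} => h4 _ (D.d_pos a.2)] at h2
    linarith
  have key2 : D.h * ∑ _b : {b // b ∈ B.Pi}, (1 : ℝ) = ∑ _a : {a // a ∈ S.R}, (1 : ℝ) := by
    have := D.card_R
    simp only [Finset.sum_const, nsmul_eq_mul, mul_one, Finset.card_univ, Fintype.card_coe]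
    exact this.symm
  induction n using Nat.strong_induction_on with
  | _ n ih =>
  have h2 := D.den_step hW h1 fun k hk hk' => ih k hk' hk
  have h3 : ∀ a ∈ S.R, divSum n (D.d a) =
      divSum n D.t * 1 + (divSum n 1 - divSum n D.t) * if D.d a = 1 then 1 else 0 := fun a ha => by
    rcases D.d_or a ha with h | h
    · rw [h, if_pos rfl]; ring
    · rw [h, if_neg (by omega)]; ring
  simp only [fun b : {b // b ∈ B.Pi} => h3 _ (Pi_sub B b.2), fun a : {a // a ∈ S.R} => h3 _ a.2,
    Finset.sum_add_distrib, ← Finset.mul_sum] at h2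
  have h4 : D.h * n * D.den (weylVec B) n = 0 := by
    linear_combination -h2 - divSum n D.t * key2 - (divSum n 1 - divSum n D.t) * key1
  have h5 := D.h_pos
  have h6 : (0 : ℝ) < n := by exact_mod_cast h1
  exact (mul_eq_zero.mp h4).resolve_left (by positivity)

theorem den_eq_theta (hW : (Weyl S : Set (V ≃ₗ[ℝ] V)).Finite) (l : V) (m : ℝ) :
    D.den l m = D.theta hW l m := by
  by_cases hm : ∃ n : ℕ, m = n
  · obtain ⟨n, rfl⟩ := hm
    rw [D.den_eq_of_lt hW (n₀ := n + 1) (by omega) (fun k hk _ => D.den_weylVec hW k hk)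
      (Nat.le_succ n), D.den_weylVec hW (n + 1) (by omega)]
    ring
  · have h1 : D.den l m = 0 := by
      by_contra h; exact hm (D.anti_den.nat l m h)
    have h2 : D.theta hW l m = 0 := by
      by_contra h; exact hm ((D.anti_theta hW).nat l m h)
    rw [h1, h2]

end Datum

end TwistedMacdonald

namespace TwistedMacdonald

variable {V : Type} [AddCommGroup V] [Module ℝ V] {S : RootSys V} {B : Base S}

/-- Multiplication by the finite denominator is injective on functions of bounded height. -/
theorem eq_zero_of_denominator_mul {g : V → ℝ} {M : ℝ} (hM : ∀ l, g l ≠ 0 → hgt B l ≤ M)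
    (hg : ∀ l, ∑ T ∈ B.Pos.powerset, (-1 : ℝ) ^ T.card * g (l + ∑ a ∈ T, a) = 0) (l : V) :
    g l = 0 := by
  by_contra hl
  have step : ∀ l, g l ≠ 0 → ∃ l', g l' ≠ 0 ∧ hgt B l + 1 ≤ hgt B l' := fun l hl => by
    have h1 := hg l
    rw [← Finset.add_sum_erase _ _ (Finset.empty_mem_powerset B.Pos)] at h1
    simp only [Finset.card_empty, pow_zero, one_mul, Finset.sum_empty, add_zero] at h1
    obtain ⟨T, hT, h2⟩ := Finset.exists_ne_zero_of_sum_ne_zero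
      (fun h => hl (by rwa [h, add_zero] at h1))
    rw [Finset.mem_erase, Finset.mem_powerset, ← Finset.nonempty_iff_ne_empty] at hT
    obtain ⟨⟨a, ha⟩, hT⟩ := hT
    refine ⟨_, right_ne_zero_of_mul h2, ?_⟩
    rw [map_add, ← Finset.add_sum_erase _ _ ha, map_add]
    have h3 := one_le_hgt (hT ha)
    have h4 : 0 ≤ hgt B (∑ a ∈ T.erase a, a) := Datum.hgt_sum_nonneg ((Finset.erase_subset _ _).trans hT)
    linarith
  have iter : ∀ n : ℕ, ∃ l', g l' ≠ 0 ∧ hgt B l + n ≤ hgt B l' := fun n => by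
    induction n with
    | zero => exact ⟨l, hl, by simp⟩
    | succ n ih =>
      obtain ⟨l', h1, h2⟩ := ih
      obtain ⟨l'', h3, h4⟩ := step l' h1
      exact ⟨l'', h3, by push_cast; linarith⟩
  obtain ⟨n, hn⟩ := exists_nat_gt (M - hgt B l)
  obtain ⟨l', h1, h2⟩ := iter n
  linarith [hM l' h1]

theorem hgt_le_of_memE {θs : V} {f : HatV V → ℝ} (hf : memE B (deltaH - embH θs) f) (x z : ℝ) :
    ∃ M : ℝ, ∀ l, f (l, x, z) ≠ 0 → hgt B l ≤ M := by
  obtain ⟨r, μ, h⟩ := hf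
  refine ⟨∑ i, |hgt B (μ i).1 + ((μ i).2.1 - x) * hgt B θs|, fun l hl => ?_⟩
  obtain ⟨i, k, m, hp⟩ := h _ hl
  have h1 : l = (μ i).1 + (k : ℝ) • θs - ∑ b ∈ B.Pi, (m b : ℝ) • b := by
    have := congrArg Prod.fst hp
    simpa [deltaH, embH, sub_eq_add_neg] using this
  have h2 : x = (μ i).2.1 - k := by
    have := congrArg (fun q => q.2.1) hp
    simpa [deltaH, embH] using this
  have h3 : hgt B (∑ b ∈ B.Pi, (m b : ℝ) • b) = ∑ b ∈ B.Pi, (m b : ℝ) := by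
    rw [map_sum]
    exact Finset.sum_congr rfl fun b hb => by rw [map_smul, hgt_simple hb, smul_eq_mul, mul_one]
  have h4 : hgt B l ≤ hgt B (μ i).1 + ((μ i).2.1 - x) * hgt B θs := by
    rw [h1, map_sub, map_add, map_smul, h3, smul_eq_mul, h2, sub_sub_cancel]
    have : (0 : ℝ) ≤ ∑ b ∈ B.Pi, (m b : ℝ) := Finset.sum_nonneg fun b _ => Nat.cast_nonneg _
    linarith
  exact h4.trans ((le_abs_self _).trans (Finset.single_le_sum
    (f := fun i => |hgt B (μ i).1 + ((μ i).2.1 - x) * hgt B θs|) (fun _ _ => abs_nonneg _)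
    (Finset.mem_univ i)))

namespace Datum

variable (D : Datum B)

/-- The lattice `h · Q(R)`. -/
abbrev Shift : Type := {x : V // ∃ y ∈ rootLat S, x = D.h • y}

theorem finite_shift (K : ℝ) :
    {γ : D.Shift | S.I (weylVec B + γ.1) (weylVec B + γ.1) = K}.Finite := by
  refine Set.Finite.of_finite_image ((D.finite_norm K).subset ?_)
    (f := fun γ : D.Shift => weylVec B + γ.1) fun γ _ γ' _ h => Subtype.ext (add_left_cancel h)
  rintro _ ⟨⟨_, y, hy, rfl⟩, h, rfl⟩
  refine ⟨?_, h⟩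
  obtain ⟨k, hk⟩ := D.h_int
  simp only [add_sub_cancel_left]
  rw [hk, Int.cast_smul_eq_zsmul]
  exact AddSubgroup.zsmul_mem _ hy k

theorem hgt_le_of_cnt_vecP (m : ℝ) : ∃ M : ℝ, ∀ l, cnt D.vecP (-l, m) ≠ 0 → hgt B l ≤ M := by
  obtain ⟨N, hN⟩ := exists_nat_ge m
  refine ⟨∑ T ∈ (upTo B N).powerset, |hgt B (∑ i ∈ T, D.vecP i).1|, fun l hl => ?_⟩
  obtain ⟨T, hT⟩ := exists_of_cnt_ne_zero hl
  have h1 : hgt B l ≤ |hgt B (∑ i ∈ T, D.vecP i).1| := by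
    rw [hT, map_neg, abs_neg]; exact le_abs_self _
  exact h1.trans (Finset.single_le_sum (f := fun T => |hgt B (∑ i ∈ T, D.vecP i).1|)
    (fun _ _ => abs_nonneg _)
    (Finset.mem_powerset.mpr (D.subset_upTo_vecP (by rw [hT]; exact hN))))

theorem theta_eq_sum (hW : (Weyl S : Set (V ≃ₗ[ℝ] V)).Finite) (l : V) (m : ℝ) :
    D.theta hW l m = ∑ γ ∈ (D.finite_shift
      (S.I (weylVec B) (weylVec B) + D.h * S.I D.θs D.θs * m)).toFinset,
      ∑ u ∈ hW.toFinset, LinearMap.det ((u : V ≃ₗ[ℝ] V) : V →ₗ[ℝ] V) *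
        (if l = u (weylVec B + γ.1) then 1 else 0) := by
  rw [theta, Finset.sum_comm]
  refine Finset.sum_congr rfl fun u hu => ?_
  rw [Set.Finite.mem_toFinset, SetLike.mem_coe] at hu
  rw [← Finset.mul_sum]
  congr 1
  by_cases h : D.cond u l m
  · rw [if_pos h]
    obtain ⟨⟨y, hy, rfl⟩, h2⟩ := h
    rw [weyl_form hu] at h2
    rw [Finset.sum_eq_single ⟨D.h • y, y, hy, rfl⟩]
    · simp
    · intro γ _ hne
      rw [if_neg]
      intro h
      exact hne (Subtype.ext (add_left_cancel (u.injective h)).symm)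
    · intro h
      exact absurd ((D.finite_shift _).mem_toFinset.mpr h2) h
  · rw [if_neg h, eq_comm]
    refine Finset.sum_eq_zero fun γ hγ => ?_
    rw [if_neg]
    rintro rfl
    obtain ⟨γ, y, hy, rfl⟩ := γ
    exact h ⟨⟨y, hy, rfl⟩, by rw [weyl_form hu]; exact (D.finite_shift _).mem_toFinset.mp hγ⟩

variable [FiniteDimensional ℝ V]

/-- The product side as a sum over lattice points on a sphere. -/
theorem cnt_vecP_eq_sum (hW : (Weyl S : Set (V ≃ₗ[ℝ] V)).Finite) (a : D.Shift → V → ℝ)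
    (ha : ∀ γ, ∃ M : ℝ, ∀ l, a γ l ≠ 0 → hgt B l ≤ M)
    (hmul : ∀ γ l, ∑ T ∈ B.Pos.powerset, (-1 : ℝ) ^ T.card * a γ (l + ∑ b ∈ T, b) =
      ∑ u ∈ hW.toFinset, LinearMap.det ((u : V ≃ₗ[ℝ] V) : V →ₗ[ℝ] V) *
        (if weylVec B + l = u (weylVec B + γ.1) then 1 else 0)) (l : V) (m : ℝ) :
    cnt D.vecP (-l, m) = ∑ γ ∈ (D.finite_shift
      (S.I (weylVec B) (weylVec B) + D.h * S.I D.θs D.θs * m)).toFinset, a γ l := by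
  set G := (D.finite_shift (S.I (weylVec B) (weylVec B) + D.h * S.I D.θs D.θs * m)).toFinset
  choose M hM using ha
  obtain ⟨N, hN⟩ := D.hgt_le_of_cnt_vecP m
  refine sub_eq_zero.mp (eq_zero_of_denominator_mul (B := B)
    (g := fun l => cnt D.vecP (-l, m) - ∑ γ ∈ G, a γ l) (M := |N| + ∑ γ ∈ G, |M γ|)
    (fun l hl => ?_) (fun l => ?_) l)
  · have h0 : 0 ≤ ∑ γ ∈ G, |M γ| := Finset.sum_nonneg fun _ _ => abs_nonneg _
    by_cases h1 : cnt D.vecP (-l, m) = 0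
    · simp only [h1, zero_sub, ne_eq, neg_eq_zero] at hl
      obtain ⟨γ, hγ, h2⟩ := Finset.exists_ne_zero_of_sum_ne_zero hl
      have h3 := Finset.single_le_sum (f := fun γ => |M γ|) (fun _ _ => abs_nonneg _) hγ
      linarith [hM γ l h2, le_abs_self (M γ), abs_nonneg N]
    · linarith [hN l h1, le_abs_self N]
  · have h1 : ∑ T ∈ B.Pos.powerset, (-1 : ℝ) ^ T.card * cnt D.vecP (-(l + ∑ b ∈ T, b), m) =
        D.den (weylVec B + l) m := by
      rw [den, cnt_vec_eq]
      refine Finset.sum_congr rfl fun T _ => ?_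
      congr 3
      simp only; abel
    have h2 : ∑ T ∈ B.Pos.powerset, (-1 : ℝ) ^ T.card * ∑ γ ∈ G, a γ (l + ∑ b ∈ T, b) =
        D.theta hW (weylVec B + l) m := by
      rw [D.theta_eq_sum hW]
      simp only [Finset.mul_sum]
      rw [Finset.sum_comm]
      refine Finset.sum_congr rfl fun γ _ => ?_
      simp only [hmul γ l]
    simp only [mul_sub, Finset.sum_sub_distrib, h1, h2, D.den_eq_theta hW, sub_self]

end Datum

end TwistedMacdonald

namespace TwistedMacdonald

variable {V : Type} [AddCommGroup V] [Module ℝ V] {S : RootSys V} {B : Base S}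

/-- The index type of the infinite product over the imaginary and real roots of the two lengths. -/
abbrev Factor (S : RootSys V) (P : Finset V) (s l : ℝ) : Type :=
  (ℕ × Fin (P.filter fun b => S.I b b = s).card) ⊕
    ((ℕ × Fin (P.filter fun b => S.I b b = l).card) ⊕
    ((ℕ × {α : V // α ∈ S.R ∧ S.I α α = s}) ⊕ (ℕ × {α : V // α ∈ S.R ∧ S.I α α = l})))

/-- The factors of the product as affine roots. -/
noncomputable def Factor.toIdx (B : Base S) (s l : ℝ) : Factor S B.Pi s l → Datum.Idx B :=
  Sum.elim (fun x => Sum.inr (⟨_, (Finset.mem_filter.mp ((Finset.equivFin _).symm x.2).2).1⟩, x.1))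
    (Sum.elim
      (fun x => Sum.inr (⟨_, (Finset.mem_filter.mp ((Finset.equivFin _).symm x.2).2).1⟩, x.1))
      (Sum.elim (fun x => Sum.inl (⟨x.2.1, x.2.2.1⟩, x.1))
        (fun x => Sum.inl (⟨x.2.1, x.2.2.1⟩, x.1))))

theorem Factor.toIdx_bijective {s l : ℝ} (hne : s ≠ l) (h : ∀ a ∈ S.R, S.I a a = s ∨ S.I a a = l) :
    Function.Bijective (Factor.toIdx B s l) := by
  have key : ∀ {r : ℝ} (i : Fin (B.Pi.filter fun b => S.I b b = r).card),
      S.I ((Finset.equivFin _).symm i : V) ((Finset.equivFin _).symm i : V) = r := fun i =>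
    (Finset.mem_filter.mp ((Finset.equivFin _).symm i).2).2
  constructor
  · rintro (⟨n, i⟩ | ⟨n, i⟩ | ⟨n, a, ha, h1⟩ | ⟨n, a, ha, h1⟩)
      (⟨n', j⟩ | ⟨n', j⟩ | ⟨n', b, hb, h2⟩ | ⟨n', b, hb, h2⟩) e <;>
      simp only [toIdx, Sum.elim_inl, Sum.elim_inr, Sum.inl.injEq, Sum.inr.injEq, Prod.mk.injEq,
        Subtype.mk.injEq, reduceCtorEq] at e ⊢
    · exact ⟨e.2, (Finset.equivFin _).symm.injective (Subtype.ext e.1)⟩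
    · exact hne ((key i).symm.trans (by rw [e.1, key j]))
    · exact hne ((key j).symm.trans (by rw [← e.1, key i]))
    · exact ⟨e.2, (Finset.equivFin _).symm.injective (Subtype.ext e.1)⟩
    · exact ⟨e.2, e.1⟩
    · exact hne (h1.symm.trans (by rw [e.1, h2]))
    · exact hne (h2.symm.trans (by rw [← e.1, h1]))
    · exact ⟨e.2, e.1⟩
  · rintro (⟨⟨a, ha⟩, n⟩ | ⟨⟨b, hb⟩, n⟩)
    · rcases h a ha with h1 | h1
      · exact ⟨Sum.inr (Sum.inr (Sum.inl (n, ⟨a, ha, h1⟩))), rfl⟩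
      · exact ⟨Sum.inr (Sum.inr (Sum.inr (n, ⟨a, ha, h1⟩))), rfl⟩
    · rcases h b (Pi_sub B hb) with h1 | h1
      · refine ⟨Sum.inl (n, Finset.equivFin _ ⟨b, Finset.mem_filter.mpr ⟨hb, h1⟩⟩), ?_⟩
        simp [toIdx]
      · refine ⟨Sum.inr (Sum.inl (n, Finset.equivFin _ ⟨b, Finset.mem_filter.mpr ⟨hb, h1⟩⟩)), ?_⟩
        simp [toIdx]

/-- The combinatorial data of the twisted affine root system. -/
noncomputable def twistedDatum (B : Base S) {θ θs : V} (hθs : θs ∈ S.R)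
    (htwo : ∀ α ∈ S.R, S.I α α = S.I θs θs ∨ S.I α α = S.I θ θ) (hne : S.I θs θs ≠ S.I θ θ)
    (high : ∀ α ∈ S.R, S.I α α = S.I θs θs →
      ∃ cf : V → ℕ, θs - α = ∑ b ∈ B.Pi, (cf b : ℝ) • b)
    (t : ℕ) (ht : 2 ≤ t) (hθ : S.I θ θ = t * S.I θs θs) : Datum B where
  θs := θs
  mem := hθs
  d a := if S.I a a = S.I θs θs then 1 else t
  t := t
  two_le := ht
  d_or a _ := by split_ifs <;> simp
  norm a ha := by
    rcases htwo a ha with h | h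
    · rw [if_pos h, h]; simp
    · rw [h, if_neg hne.symm, hθ]
  high a ha h := by
    refine high a ha ?_
    by_contra hc
    rw [if_neg hc] at h
    omega

end TwistedMacdonald

open TwistedMacdonald

/-- **Intermediate identity (13), twisted case, not of type `BC_l^{(2)}`**
(coefficientwise, in the algebra `ℰ`). -/
theorem intermediate_identity_twisted (V : Type) [AddCommGroup V] [Module ℝ V]
    [FiniteDimensional ℝ V]
    (S : RootSys V) (B : Base S)
    -- θ is the highest root, θs the highest short root; R_f has two root lengths
    (θ : V) (hθR : θ ∈ S.R)
    (hθhigh : ∀ α ∈ S.R, ∃ cf : V → ℕ, θ - α = ∑ b ∈ B.Pi, (cf b : ℝ) • b)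
    (θs : V) (hθsR : θs ∈ S.R)
    (htwo : ∀ α ∈ S.R, S.I α α = S.I θs θs ∨ S.I α α = S.I θ θ)
    (hne : S.I θs θs ≠ S.I θ θ)
    (hθshigh : ∀ α ∈ S.R, S.I α α = S.I θs θs →
      ∃ cf : V → ℕ, θs - α = ∑ b ∈ B.Pi, (cf b : ℝ) • b)
    -- the tier number t = I(θ,θ)/I(θs,θs) ∈ {2,3}
    (t : ℝ) (htdef : t = S.I θ θ / S.I θs θs) (ht : t = 2 ∨ t = 3)
    -- h^∨_t = 1 + I(ρ_f,θs^∨) and c = (I(θs,θs)/2)·h^∨_t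
    (hvt : ℝ) (hhvt : hvt = 1 + S.I (weylVec B) ((2 / S.I θs θs) • θs))
    (c : ℝ) (hc : c = S.I θs θs / 2 * hvt)
    -- the Weyl group is finite
    (hWfin : (Weyl S : Set (V ≃ₗ[ℝ] V)).Finite)
    -- the coefficient functions A_γ of the elements A_γ ∈ ℰ
    (A : V → HatV V → ℝ)
    (hAE : ∀ γ : V, (∃ y ∈ rootLat S, γ = hvt • y) → memE B (deltaH - embH θs) (A γ))
    -- A_γ · (e^{ρ_f} ∏_{α ∈ R_f⁺} (1 − e^{−α})) = Σ_{u ∈ W(R_f)} det(u)·e^{u(ρ_f+γ)}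
    (hA : ∀ γ : V, (∃ y ∈ rootLat S, γ = hvt • y) → ∀ p : HatV V,
      ∑ T ∈ B.Pos.powerset, (-1 : ℝ) ^ T.card *
          A γ (p - embH (weylVec B) + embH (∑ α ∈ T, α)) =
        ∑ u ∈ hWfin.toFinset, LinearMap.det ((u : V ≃ₗ[ℝ] V) : V →ₗ[ℝ] V) *
          (if p = embH (u (weylVec B + γ)) then 1 else 0)) :
    -- the factors of the infinite product: for n ≥ 1, (1−e^{−nδ}) with multiplicity
    -- |Π_{f,s}|, (1−e^{−tnδ}) with multiplicity |Π_{f,l}|, (1−e^{−α−nδ}) for α short,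
    -- and (1−e^{−α−tnδ}) for α long
    let vec : (ℕ × Fin (B.Pi.filter fun b => S.I b b = S.I θs θs).card) ⊕
        ((ℕ × Fin (B.Pi.filter fun b => S.I b b = S.I θ θ).card) ⊕
        ((ℕ × {α : V // α ∈ S.R ∧ S.I α α = S.I θs θs}) ⊕
         (ℕ × {α : V // α ∈ S.R ∧ S.I α α = S.I θ θ}))) → HatV V :=
      Sum.elim (fun x => ((x.1 : ℝ) + 1) • deltaH)
        (Sum.elim (fun x => (t * ((x.1 : ℝ) + 1)) • deltaH)
          (Sum.elim (fun x => embH x.2.1 + ((x.1 : ℝ) + 1) • deltaH)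
            (fun x => embH x.2.1 + (t * ((x.1 : ℝ) + 1)) • deltaH)))
    -- coefficientwise identity of the two sides
    ∀ p : HatV V,
      (∑' T : {T : Finset ((ℕ × Fin (B.Pi.filter fun b => S.I b b = S.I θs θs).card) ⊕
          ((ℕ × Fin (B.Pi.filter fun b => S.I b b = S.I θ θ).card) ⊕
          ((ℕ × {α : V // α ∈ S.R ∧ S.I α α = S.I θs θs}) ⊕
           (ℕ × {α : V // α ∈ S.R ∧ S.I α α = S.I θ θ})))) //
          p = (-(S.I (weylVec B) (weylVec B) / (2 * c))) • deltaH - ∑ i ∈ T, vec i},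
        (-1 : ℝ) ^ T.1.card) =
      ∑' γ : {x : V // ∃ y ∈ rootLat S, x = hvt • y},
        A γ.1 (p + (S.I (weylVec B + γ.1) (weylVec B + γ.1) / (2 * c)) • deltaH) := by
  intro vec
  obtain ⟨tn, htn, htt⟩ : ∃ tn : ℕ, 2 ≤ tn ∧ t = tn := by
    rcases ht with h | h
    · exact ⟨2, le_rfl, by simpa using h⟩
    · exact ⟨3, by norm_num, by simpa using h⟩
  have hs := norm_pos hθsR
  have hθ : S.I θ θ = tn * S.I θs θs := by
    rw [← htt, htdef, div_mul_cancel₀ _ hs.ne']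
  let D := twistedDatum B hθsR htwo hne hθshigh tn htn hθ
  have hDs : D.θs = θs := rfl
  have hh : D.h = hvt := by
    rw [Datum.h, hDs, pr_apply, hhvt, map_smul, smul_eq_mul, S.symm θs]; ring
  subst hh
  have hh0 := D.h_pos
  have hc2 : 2 * c = D.h * S.I D.θs D.θs := by rw [hc, hDs]; ring
  have hc0 : c ≠ 0 := by rw [hc]; positivity
  have hsupp : ∀ (γ : D.Shift) (l : V) (x z : ℝ), (x, z) ≠ ((0 : ℝ), (0 : ℝ)) →
      A γ.1 (l, x, z) = 0 := fun γ l x z hxz => by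
    obtain ⟨M, hM⟩ := hgt_le_of_memE (hAE γ.1 γ.2) x z
    refine eq_zero_of_denominator_mul (B := B) (g := fun l => A γ.1 (l, x, z)) hM (fun l => ?_) l
    have h1 := hA γ.1 γ.2 (l + weylVec B, x, z)
    rw [Finset.sum_eq_zero (s := hWfin.toFinset) fun u _ => by
      rw [if_neg, mul_zero]
      exact fun h => hxz (congrArg Prod.snd h)] at h1
    rw [← h1]
    refine Finset.sum_congr rfl fun T _ => ?_
    simp [embH]
  have hmul : ∀ (γ : D.Shift) l, ∑ T ∈ B.Pos.powerset, (-1 : ℝ) ^ T.card *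
      A γ.1 (l + ∑ b ∈ T, b, 0, 0) =
      ∑ u ∈ hWfin.toFinset, LinearMap.det ((u : V ≃ₗ[ℝ] V) : V →ₗ[ℝ] V) *
        (if weylVec B + l = u (weylVec B + γ.1) then 1 else 0) := fun γ l => by
    have h1 := hA γ.1 γ.2 (weylVec B + l, 0, 0)
    have h2 : ∀ u : V ≃ₗ[ℝ] V, ((weylVec B + l, (0 : ℝ), (0 : ℝ)) : HatV V) =
        embH (u (weylVec B + γ.1)) ↔ weylVec B + l = u (weylVec B + γ.1) := fun u => by
      simp [embH]
    simp only [h2] at h1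
    rw [← h1]
    refine Finset.sum_congr rfl fun T _ => ?_
    simp [embH]
  let F := Equiv.ofBijective _ (Factor.toIdx_bijective (B := B) hne htwo)
  have hvec : ∀ i, vec i = ((D.vecP (F i)).1, (D.vecP (F i)).2, 0) := by
    have hl : ∀ {a : V}, S.I a a = S.I θ θ → D.d a = tn := fun h => if_neg (h ▸ hne.symm)
    have hs : ∀ {a : V}, S.I a a = S.I θs θs → D.d a = 1 := fun h => if_pos h
    rintro (⟨n, i⟩ | ⟨n, i⟩ | ⟨n, a, ha, h⟩ | ⟨n, a, ha, h⟩)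
    · have h1 := hs (Finset.mem_filter.mp ((Finset.equivFin _).symm i).2).2
      simp [vec, F, Factor.toIdx, Datum.vecP_inr, deltaH, h1]
    · have h1 := hl (Finset.mem_filter.mp ((Finset.equivFin _).symm i).2).2
      simp [vec, F, Factor.toIdx, Datum.vecP_inr, deltaH, h1, htt]
    · simp [vec, F, Factor.toIdx, Datum.vecP_inl, deltaH, embH, hs h]
    · simp [vec, F, Factor.toIdx, Datum.vecP_inl, deltaH, embH, hl h, htt]
  rintro ⟨l, x, z⟩
  have hsum : ∀ T : Finset (Factor S B.Pi (S.I θs θs) (S.I θ θ)),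
      ((l, x, z) : HatV V) = (-(S.I (weylVec B) (weylVec B) / (2 * c))) • deltaH - ∑ i ∈ T, vec i ↔
      ∑ i ∈ T, (D.vecP ∘ F) i = (-l, -(S.I (weylVec B) (weylVec B) / (2 * c)) - x) ∧ z = 0 :=
    fun T => by
    simp only [hvec, Prod.ext_iff, Prod.fst_sum, Prod.snd_sum, deltaH, Prod.fst_sub, Prod.snd_sub,
      Prod.smul_fst, Prod.smul_snd, smul_zero, zero_sub, smul_eq_mul, mul_one, mul_zero,
      Finset.sum_const_zero, sub_zero, Function.comp_apply]
    constructor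
    · rintro ⟨h1, h2, h3⟩
      exact ⟨⟨by rw [h1, neg_neg], by rw [h2]; ring⟩, h3⟩
    · rintro ⟨⟨h1, h2⟩, h3⟩
      exact ⟨by rw [h1, neg_neg], by rw [h2]; ring, h3⟩
  have hright : ∀ γ : D.Shift, ((l, x, z) : HatV V) +
      (S.I (weylVec B + γ.1) (weylVec B + γ.1) / (2 * c)) • deltaH =
      (l, x + S.I (weylVec B + γ.1) (weylVec B + γ.1) / (2 * c), z) := fun γ => by
    simp [deltaH]
  simp only [hright]
  by_cases hz : z = 0
  · subst hz
    set m := -(S.I (weylVec B) (weylVec B) / (2 * c)) - x with hm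
    have hmx : ∀ K : ℝ, x + K / (2 * c) = 0 ↔
        K = S.I (weylVec B) (weylVec B) + D.h * S.I D.θs D.θs * m := fun K => by
      rw [← hc2, hm]
      constructor
      · intro h
        have : K = 2 * c * (K / (2 * c)) := by field_simp
        have h2 : S.I (weylVec B) (weylVec B) = 2 * c * (S.I (weylVec B) (weylVec B) / (2 * c)) := by
          field_simp
        linear_combination this + 2 * c * h - h2
      · rintro rfl
        field_simp
        ring
    have hleft := D.cnt_vecP_eq_sum hWfin (fun γ l => A γ.1 (l, 0, 0))
      (fun γ => hgt_le_of_memE (hAE γ.1 γ.2) 0 0) hmul l m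
    rw [← cnt_comp_equiv F, cnt] at hleft
    have hiff := fun T => (hsum T).trans (and_iff_left rfl)
    rw [← (Equiv.subtypeEquivRight hiff).tsum_eq] at hleft
    refine hleft.trans ?_
    rw [tsum_eq_sum (s := (D.finite_shift
      (S.I (weylVec B) (weylVec B) + D.h * S.I D.θs D.θs * m)).toFinset)]
    · refine Finset.sum_congr rfl fun γ hγ => ?_
      rw [(hmx _).mpr ((D.finite_shift _).mem_toFinset.mp hγ)]
    · intro γ hγ
      refine hsupp γ _ _ _ fun h => hγ ((D.finite_shift _).mem_toFinset.mpr ?_)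
      exact (hmx _).mp (congrArg Prod.fst h)
  · have : IsEmpty {T : Finset (Factor S B.Pi (S.I θs θs) (S.I θ θ)) //
        ((l, x, z) : HatV V) =
          (-(S.I (weylVec B) (weylVec B) / (2 * c))) • deltaH - ∑ i ∈ T, vec i} :=
      ⟨fun T => hz ((hsum T.1).mp T.2).2⟩
    rw [tsum_empty, eq_comm]
    refine (tsum_congr fun γ => ?_).trans tsum_zero
    exact hsupp γ _ _ _ fun h => hz (congrArg Prod.snd h)
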